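/- Let n ≥ 2, 0 ≤ q ≤ n, s, k ≥ 1 integers, 0 < λ < 1, δ > 0, μ > 0, T > 0, and let w be a q-form in C^{k,s(s,λ,δ)}_{T,Λ^q,D_{d⊕d*}}. Then the operator u ↦ Ψ_{μ,q} B_q(w,u) is continuous from C^{k,s(s,λ,δ)}_{T,Λ^q} to C^{k−1,s(s+1,λ,2δ−1)}_{T,Λ^q}; the operator u ↦ Ψ_{μ,q} W_q u is continuous from C^{k,s(s,λ,δ)}_{T,Λ^q,D_{d⊕d*}} to C^{k,s(s+1,λ,2δ−1)}_{T,Λ^q}; and the operator u ↦ (d_q ⊕ d_{q−1}*)Ψ_{μ,q} W_q u is continuous from C^{k,s(s,λ,δ)}_{T,Λ^q,D_{d⊕d*}} to C^{k−1,s(s+1,λ,2δ)}_{T,Λ^{q+1}⊕Λ^{q−1}}. -/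

import Mathlib

open scoped BigOperators ENNReal Classical
open Filter MeasureTheory

noncomputable section

namespace NSdeRham

/-- Euclidean space `ℝⁿ`. -/
abbrev Spc (n : ℕ) := EuclideanSpace ℝ (Fin n)

variable {n : ℕ}

/-- The weight `w(x) = √(1+|x|²)`. -/
def wt (x : Spc n) : ℝ := Real.sqrt (1 + ‖x‖ ^ 2)

/-- `w(x,y) = max (w x) (w y)`. -/
def wt2 (x y : Spc n) : ℝ := max (wt x) (wt y)

/-- Partial derivative in the `i`-th coordinate direction. -/
def pd (i : Fin n) (f : Spc n → ℝ) (x : Spc n) : ℝ :=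
  fderiv ℝ f x (EuclideanSpace.single i 1)

/-- The Laplace operator `Δ = ∑ ∂²/∂xᵢ²`. -/
def lap (f : Spc n → ℝ) (x : Spc n) : ℝ := ∑ i : Fin n, pd i (pd i f) x

section enorms

variable {F : Type*} [NormedAddCommGroup F]

/-- Weighted sup-"norm" `sup_x w(x)^δ ‖g x‖` (with values in `ℝ≥0∞`). -/
def eWSup (δ : ℝ) (g : Spc n → F) : ℝ≥0∞ :=
  ⨆ x : Spc n, ENNReal.ofReal (wt x ^ δ * ‖g x‖)

/-- Weighted Hölder seminorm `⟨g⟩_{λ,δ}`. -/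
def eWHold (lam δ : ℝ) (g : Spc n → F) : ℝ≥0∞ :=
  ⨆ (x : Spc n) (y : Spc n) (_ : x ≠ y ∧ ‖x - y‖ ≤ ‖x‖ / 2),
    ENNReal.ofReal (wt2 x y ^ (δ + lam) * ‖g x - g y‖ / ‖x - y‖ ^ lam)

/-- The ordinary Hölder norm on the (closed) unit ball around the origin. -/
def eOHold (lam : ℝ) (g : Spc n → F) : ℝ≥0∞ :=
  (⨆ (x : Spc n) (_ : ‖x‖ ≤ 1), ENNReal.ofReal ‖g x‖) +
    ⨆ (x : Spc n) (y : Spc n) (_ : ‖x‖ ≤ 1 ∧ ‖y‖ ≤ 1 ∧ x ≠ y),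
      ENNReal.ofReal (‖g x - g y‖ / ‖x - y‖ ^ lam)

/-- The norm of `C^{0,λ,δ}`; for `λ = 0` this is just the weighted sup-norm. -/
def eHol0 (lam δ : ℝ) (g : Spc n → F) : ℝ≥0∞ :=
  if lam = 0 then eWSup δ g else eOHold lam g + eWSup δ g + eWHold lam δ g

/-- The norm of the base anisotropic space `C^{𝐬(0,λ,δ)}_T`. -/
def eAniso0 (T lam δ : ℝ) (v : ℝ → Spc n → F) : ℝ≥0∞ :=
  (⨆ t : Set.Icc (0 : ℝ) T, eHol0 lam δ (v t)) +
    if lam = 0 then 0 else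
      ⨆ (t₁ : Set.Icc (0 : ℝ) T) (t₂ : Set.Icc (0 : ℝ) T) (_ : (t₁ : ℝ) ≠ (t₂ : ℝ))
        (x : Spc n),
        ENNReal.ofReal (wt x ^ δ * ‖v t₁ x - v t₂ x‖ / |(t₁ : ℝ) - (t₂ : ℝ)| ^ (lam / 2))

end enorms

/-- The norm of the static weighted Hölder space `C^{s,λ,δ}`. -/
def eHolS (s : ℕ) (lam δ : ℝ) (g : Spc n → ℝ) : ℝ≥0∞ :=
  ∑ m ∈ Finset.range (s + 1), eHol0 lam (δ + m) (iteratedFDeriv ℝ m g)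

/-- Membership in the static weighted Hölder space `C^{s,λ,δ}`. -/
def HolSMem (s : ℕ) (lam δ : ℝ) (g : Spc n → ℝ) : Prop :=
  ContDiff ℝ s g ∧ eHolS s lam δ g ≠ ⊤

/-- Time derivative of order `j` (within `[0,T]`). -/
def tDeriv (T : ℝ) (j : ℕ) (u : ℝ → Spc n → ℝ) (t : ℝ) (x : Spc n) : ℝ :=
  iteratedDerivWithin j (fun τ => u τ x) (Set.Icc 0 T) t

/-- Mixed derivative `∂_x^m ∂_t^j`. -/
def mixDeriv (T : ℝ) (m j : ℕ) (u : ℝ → Spc n → ℝ) (t : ℝ) :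
    Spc n → ContinuousMultilinearMap ℝ (fun _ : Fin m => Spc n) ℝ :=
  iteratedFDeriv ℝ m (fun x => tDeriv T j u t x)

/-- The norm of the anisotropic weighted parabolic Hölder space `C^{k,𝐬(s,λ,δ)}_T`. -/
def eAnisoKS (T : ℝ) (k s : ℕ) (lam δ : ℝ) (u : ℝ → Spc n → ℝ) : ℝ≥0∞ :=
  ∑ b ∈ Finset.range (k + 1), ∑ m ∈ Finset.range (2 * s + 1), ∑ j ∈ Finset.range (s + 1),
    if m + 2 * j ≤ 2 * s then eAniso0 T lam (δ + b + m) (mixDeriv T (b + m) j u) else 0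

/-- Regularity required of members of `C^{k,𝐬(s,λ,δ)}_T`. -/
def AnisoReg (T : ℝ) (k s : ℕ) (u : ℝ → Spc n → ℝ) : Prop :=
  (∀ x : Spc n, ContDiffOn ℝ s (fun t => u t x) (Set.Icc 0 T)) ∧
  (∀ j : ℕ, j ≤ s → ∀ t ∈ Set.Icc (0 : ℝ) T,
    ContDiff ℝ (2 * (s - j) + k) (fun x => tDeriv T j u t x)) ∧
  (∀ j m : ℕ, j ≤ s → m + 2 * j ≤ 2 * s + k →
    Continuous fun p : Set.Icc (0 : ℝ) T × Spc n => mixDeriv T m j u p.1 p.2)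

/-- Membership in `C^{k,𝐬(s,λ,δ)}_T`. -/
def AnisoMem (T : ℝ) (k s : ℕ) (lam δ : ℝ) (u : ℝ → Spc n → ℝ) : Prop :=
  AnisoReg T k s u ∧ eAnisoKS T k s lam δ u ≠ ⊤

/-- The norm of `𝓕^{k,𝐬(s,λ,λ',δ)}_T = C^{k+1,𝐬(s,λ,δ)}_T ∩ C^{k,𝐬(s,λ',δ)}_T`. -/
def eFn (T : ℝ) (k s : ℕ) (lam lam' δ : ℝ) (u : ℝ → Spc n → ℝ) : ℝ≥0∞ :=
  eAnisoKS T (k + 1) s lam δ u + eAnisoKS T k s lam' δ u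

/-- Membership in `𝓕^{k,𝐬(s,λ,λ',δ)}_T`. -/
def FMem (T : ℝ) (k s : ℕ) (lam lam' δ : ℝ) (u : ℝ → Spc n → ℝ) : Prop :=
  AnisoReg T (k + 1) s u ∧ eFn T k s lam lam' δ u ≠ ⊤

/-- Index set of a basis of `Λ^q`. -/
abbrev Idx (n q : ℕ) := {I : Finset (Fin n) // I.card = q}

/-- Static differential `q`-forms: coefficient functions. -/
abbrev FormS (n q : ℕ) := Idx n q → Spc n → ℝ

/-- Time-dependent differential `q`-forms. -/
abbrev FormT (n q : ℕ) := Idx n q → ℝ → Spc n → ℝ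

/-- Fibre of the bundle `Λ^q`. -/
abbrev Fib (n q : ℕ) := Idx n q → ℝ

/-- The exterior derivative `d_q` on static `q`-forms. -/
def dS {q : ℕ} (u : FormS n q) : FormS n (q + 1) := fun J x =>
  ∑ i : Fin n,
    if h : i ∈ J.1 then
      (-1 : ℝ) ^ (J.1.filter fun j => j < i).card *
        pd i (u ⟨J.1.erase i, by simp [Finset.card_erase_of_mem h, J.2]⟩) x
    else 0

/-- The exterior derivative `d_{q-1}` mapping `(q-1)`-forms to `q`-forms. -/
def dLowS {q : ℕ} (p : FormS n (q - 1)) : FormS n q := fun J x =>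
  ∑ i : Fin n,
    if h : i ∈ J.1 ∧ (J.1.erase i).card = q - 1 then
      (-1 : ℝ) ^ (J.1.filter fun j => j < i).card * pd i (p ⟨J.1.erase i, h.2⟩) x
    else 0

/-- The formal adjoint `d_{q-1}^*` mapping `q`-forms to `(q-1)`-forms. -/
def coDS {q : ℕ} (u : FormS n q) : FormS n (q - 1) := fun K x =>
  -∑ i : Fin n,
    if h : i ∉ K.1 ∧ (insert i K.1).card = q then
      (-1 : ℝ) ^ (K.1.filter fun j => j < i).card * pd i (u ⟨insert i K.1, h.2⟩) x
    else 0

/-- `d_q` on time-dependent forms. -/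
def dT {q : ℕ} (u : FormT n q) : FormT n (q + 1) := fun J t => dS (fun I => u I t) J

/-- `d_{q-1}` on time-dependent forms. -/
def dLowT {q : ℕ} (p : FormT n (q - 1)) : FormT n q := fun J t => dLowS (fun I => p I t) J

/-- `d_{q-1}^*` on time-dependent forms. -/
def coDT {q : ℕ} (u : FormT n q) : FormT n (q - 1) := fun K t => coDS (fun I => u I t) K

/-- Norm of `C^{k,𝐬(s,λ,δ)}_{T,Λ^q}`. -/
def eAnisoKSF {q : ℕ} (T : ℝ) (k s : ℕ) (lam δ : ℝ) (u : FormT n q) : ℝ≥0∞ :=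
  ∑ I : Idx n q, eAnisoKS T k s lam δ (u I)

/-- Membership in `C^{k,𝐬(s,λ,δ)}_{T,Λ^q}`. -/
def CMemF {q : ℕ} (T : ℝ) (k s : ℕ) (lam δ : ℝ) (u : FormT n q) : Prop :=
  (∀ I, AnisoReg T k s (u I)) ∧ eAnisoKSF T k s lam δ u ≠ ⊤

/-- Graph norm of `C^{k,𝐬(s,λ,δ)}_{T,Λ^q,𝒟_{d⊕d*}}`. -/
def eCD {q : ℕ} (T : ℝ) (k s : ℕ) (lam δ : ℝ) (u : FormT n q) : ℝ≥0∞ :=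
  eAnisoKSF T k s lam δ u + eAnisoKSF T k s lam (δ + 1) (dT u) +
    eAnisoKSF T k s lam (δ + 1) (coDT u)

/-- Membership in `C^{k,𝐬(s,λ,δ)}_{T,Λ^q,𝒟_{d⊕d*}}`. -/
def CMemD {q : ℕ} (T : ℝ) (k s : ℕ) (lam δ : ℝ) (u : FormT n q) : Prop :=
  CMemF T k s lam δ u ∧ CMemF T k s lam (δ + 1) (dT u) ∧ CMemF T k s lam (δ + 1) (coDT u)

/-- Norm of `𝓕^{k,𝐬(s,λ,λ',δ)}_{T,Λ^q}`. -/
def eFF {q : ℕ} (T : ℝ) (k s : ℕ) (lam lam' δ : ℝ) (u : FormT n q) : ℝ≥0∞ :=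
  ∑ I : Idx n q, eFn T k s lam lam' δ (u I)

/-- Membership in `𝓕^{k,𝐬(s,λ,λ',δ)}_{T,Λ^q}`. -/
def FMemF {q : ℕ} (T : ℝ) (k s : ℕ) (lam lam' δ : ℝ) (u : FormT n q) : Prop :=
  (∀ I, AnisoReg T (k + 1) s (u I)) ∧ eFF T k s lam lam' δ u ≠ ⊤

/-- Graph norm of `𝓕^{k,𝐬(s,λ,λ',δ)}_{T,Λ^q,𝒟_{d⊕d*}}`. -/
def eFD {q : ℕ} (T : ℝ) (k s : ℕ) (lam lam' δ : ℝ) (u : FormT n q) : ℝ≥0∞ :=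
  eFF T k s lam lam' δ u + eFF T k s lam lam' (δ + 1) (dT u) +
    eFF T k s lam lam' (δ + 1) (coDT u)

/-- Membership in `𝓕^{k,𝐬(s,λ,λ',δ)}_{T,Λ^q,𝒟_{d⊕d*}}`. -/
def FMemD {q : ℕ} (T : ℝ) (k s : ℕ) (lam lam' δ : ℝ) (u : FormT n q) : Prop :=
  FMemF T k s lam lam' δ u ∧ FMemF T k s lam lam' (δ + 1) (dT u) ∧
    FMemF T k s lam lam' (δ + 1) (coDT u)

/-- Norm of the static space `C^{s,λ,δ}_{Λ^q}`. -/
def eHolSF {q : ℕ} (s : ℕ) (lam δ : ℝ) (g : FormS n q) : ℝ≥0∞ :=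
  ∑ I : Idx n q, eHolS s lam δ (g I)

/-- Membership in the static space `C^{s,λ,δ}_{Λ^q}`. -/
def HolMemF {q : ℕ} (s : ℕ) (lam δ : ℝ) (g : FormS n q) : Prop :=
  (∀ I, ContDiff ℝ s (g I)) ∧ eHolSF s lam δ g ≠ ⊤

/-- Equality of time-dependent forms on `ℝⁿ × [0,T]`. -/
def EqOnT {q : ℕ} (T : ℝ) (u v : FormT n q) : Prop :=
  ∀ I, ∀ t ∈ Set.Icc (0 : ℝ) T, ∀ x, u I t x = v I t x

/-- The form `u` is co-closed (`d^* u = 0`) on `ℝⁿ × [0,T]`. -/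
def CoClosed {q : ℕ} (T : ℝ) (u : FormT n q) : Prop :=
  ∀ K, ∀ t ∈ Set.Icc (0 : ℝ) T, ∀ x, coDT u K t x = 0

/-- Type of the bilinear zero order operator `M₁^{(q)}`. -/
abbrev M1Type (n q : ℕ) := (Fib n (q + 1) × Fib n (q - 1)) →ₗ[ℝ] Fib n q →ₗ[ℝ] Fib n q

/-- Type of the bilinear zero order operator `M₂^{(q)}`. -/
abbrev M2Type (n q : ℕ) := Fib n q →ₗ[ℝ] Fib n q →ₗ[ℝ] Fib n (q - 1)

/-- Value of a time-dependent form at a point, as an element of the fibre. -/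
def fib {q : ℕ} (u : FormT n q) (t : ℝ) (x : Spc n) : Fib n q := fun I => u I t x

/-- Value of `(d_q ⊕ d_{q-1}^*) u` at a point. -/
def ddFib {q : ℕ} (u : FormT n q) (t : ℝ) (x : Spc n) : Fib n (q + 1) × Fib n (q - 1) :=
  (fun J => dT u J t x, fun K => coDT u K t x)

/-- The operator `W_q u = M₁((d⊕d^*)u, w) + M₁((d⊕d^*)w, u)`. -/
def Wop {q : ℕ} (M₁ : M1Type n q) (w u : FormT n q) : FormT n q := fun I t x =>
  M₁ (ddFib u t x) (fib w t x) I + M₁ (ddFib w t x) (fib u t x) I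

/-- The symmetric bilinearization `B_q(w,u)` of the nonlinearity. -/
def Bop {q : ℕ} (M₁ : M1Type n q) (M₂ : M2Type n q) (w u : FormT n q) : FormT n q :=
  fun I t x =>
    Wop M₁ w u I t x +
      dLowT (fun K t' x' =>
        M₂ (fib u t' x') (fib w t' x') K + M₂ (fib w t' x') (fib u t' x') K) I t x

/-- The nonlinearity `𝒩_q u = M₁((d⊕d^*)u, u) + d_{q-1} M₂(u,u)`. -/
def Nop {q : ℕ} (M₁ : M1Type n q) (M₂ : M2Type n q) (u : FormT n q) : FormT n q :=
  fun I t x =>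
    M₁ (ddFib u t x) (fib u t x) I +
      dLowT (fun K t' x' => M₂ (fib u t' x') (fib u t' x') K) I t x

/-- Fundamental solution of the heat operator `∂_t - μΔ`. -/
def heatKer (μ : ℝ) (x : Spc n) (t : ℝ) : ℝ :=
  if 0 < t then (4 * Real.pi * μ * t) ^ (-(n : ℝ) / 2) * Real.exp (-‖x‖ ^ 2 / (4 * μ * t))
  else 0

/-- Volume heat potential `Ψ_μ`. -/
def volPot (μ : ℝ) (f : ℝ → Spc n → ℝ) (t : ℝ) (x : Spc n) : ℝ :=
  ∫ τ in Set.Ioc (0 : ℝ) t, ∫ y : Spc n, heatKer μ (x - y) (t - τ) * f τ y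

/-- Poisson heat potential `Ψ_{μ,0}`. -/
def poisPot (μ : ℝ) (g : Spc n → ℝ) (t : ℝ) (x : Spc n) : ℝ :=
  ∫ y : Spc n, heatKer μ (x - y) t * g y

/-- Volume heat potential acting coefficient-wise on forms. -/
def volPotF {q : ℕ} (μ : ℝ) (f : FormT n q) : FormT n q := fun I => volPot μ (f I)

/-- Poisson heat potential acting coefficient-wise on forms. -/
def poisPotF {q : ℕ} (μ : ℝ) (g : FormS n q) : FormT n q := fun I => poisPot μ (g I)

/-- Area of the unit sphere in `ℝⁿ`. -/
def sphArea (n : ℕ) : ℝ := 2 * Real.pi ^ ((n : ℝ) / 2) / Real.Gamma ((n : ℝ) / 2)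

/-- Standard fundamental solution of the Laplace operator in `ℝⁿ`. -/
def lapKer (n : ℕ) (x : Spc n) : ℝ :=
  if n = 2 then (1 / Real.pi) * Real.log ‖x‖
  else ‖x‖ ^ (2 - (n : ℝ)) / (sphArea n * (2 - (n : ℝ)))

/-- Newtonian potential. -/
def newtPot (f : Spc n → ℝ) (x : Spc n) : ℝ := ∫ y : Spc n, lapKer n (x - y) * f y

/-- The integral operator `Φ_q` mapping `(q+1)`-forms to `q`-forms;
concretely `Φ_q f = -d^* (e * f)`. -/
def PhiOp {q : ℕ} (f : FormT n (q + 1)) : FormT n q := fun K t x =>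
  -coDS (n := n) (q := q + 1) (fun J y => newtPot (fun z => f J t z) y) K x

/-- Squared `L²` norm of a form at time `t`. -/
def l2Sq {q : ℕ} (u : FormT n q) (t : ℝ) : ℝ :=
  ∑ I : Idx n q, ∫ x : Spc n, (u I t x) ^ 2

/-- Squared `L²` norm of the spatial gradient of a form at time `t`. -/
def gradSq {q : ℕ} (u : FormT n q) (t : ℝ) : ℝ :=
  ∑ I : Idx n q, ∑ i : Fin n, ∫ x : Spc n, (pd i (fun y => u I t y) x) ^ 2

/-- The norm of `C^{0,𝐬(0,0,δ)}_{T,Λ^q}` (weighted sup-norm). -/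
def eSupT {q : ℕ} (T δ : ℝ) (u : FormT n q) : ℝ≥0∞ :=
  ∑ I : Idx n q,
    ⨆ (t : Set.Icc (0 : ℝ) T) (x : Spc n), ENNReal.ofReal (wt x ^ δ * |u I t x|)

/-- The norm `‖∇u‖_{C^{0,𝐬(0,0,δ)}_{T}}` of the spatial gradient. -/
def eSupGradT {q : ℕ} (T δ : ℝ) (u : FormT n q) : ℝ≥0∞ :=
  ∑ I : Idx n q, ∑ i : Fin n,
    ⨆ (t : Set.Icc (0 : ℝ) T) (x : Spc n),
      ENNReal.ofReal (wt x ^ δ * |pd i (fun y => u I t y) x|)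

/-- `q`-form with coefficients harmonic polynomials of degree at most `m`. -/
def HarmPolyForm {q : ℕ} (m : ℕ) (h : FormS n q) : Prop :=
  ∀ I, (∃ P : MvPolynomial (Fin n) ℝ, P.totalDegree ≤ m ∧
      ∀ x : Spc n, h I x = MvPolynomial.eval (fun i => x i) P) ∧
    ∀ x : Spc n, lap (h I) x = 0

/-- Classical solution of the Cauchy problem
`∂_t u - μ Δ u + extra = f` on `ℝⁿ × (0,T)`, `u(·,0) = u₀`. -/
def CauchySol {q : ℕ} (T μ : ℝ) (u extra f : FormT n q) (u₀ : FormS n q) : Prop :=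
  (∀ I, ∀ t ∈ Set.Ioo (0 : ℝ) T, ∀ x,
    deriv (fun τ => u I τ x) t - μ * lap (fun y => u I t y) x + extra I t x = f I t x) ∧
  ∀ I x, u I 0 x = u₀ I x

/-- `Ψ_{μ,q} 𝒩_q u`. -/
def NopPot {q : ℕ} (μ : ℝ) (M₁ : M1Type n q) (M₂ : M2Type n q) (u : FormT n q) : FormT n q :=
  volPotF μ (Nop M₁ M₂ u)

/-- `u + Ψ_{μ,q} 𝒩_q u`. -/
def TmapN {q : ℕ} (μ : ℝ) (M₁ : M1Type n q) (M₂ : M2Type n q) (u : FormT n q) : FormT n q :=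
  u + NopPot μ M₁ M₂ u

/-- The linearization `u + Ψ_{μ,q} B_q(v,u)`. -/
def LmapB {q : ℕ} (μ : ℝ) (M₁ : M1Type n q) (M₂ : M2Type n q) (v u : FormT n q) :
    FormT n q :=
  u + volPotF μ (Bop M₁ M₂ v u)

/-- `Φ_q d_q Ψ_{μ,q} 𝒩_q u`. -/
def PhiNpot {q : ℕ} (μ : ℝ) (M₁ : M1Type n q) (M₂ : M2Type n q) (u : FormT n q) :
    FormT n q :=
  PhiOp (dT (volPotF μ (Nop M₁ M₂ u)))

/-- `u + Φ_q d_q Ψ_{μ,q} 𝒩_q u`. -/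
def PhiNmap {q : ℕ} (μ : ℝ) (M₁ : M1Type n q) (M₂ : M2Type n q) (u : FormT n q) :
    FormT n q :=
  u + PhiNpot μ M₁ M₂ u

/-- The linearization `u + Φ_q d_q Ψ_{μ,q} B_q(v,u)`. -/
def PhiLmap {q : ℕ} (μ : ℝ) (M₁ : M1Type n q) (M₂ : M2Type n q) (v u : FormT n q) :
    FormT n q :=
  u + PhiOp (dT (volPotF μ (Bop M₁ M₂ v u)))

lemma one_le_wt (x : Spc n) : 1 ≤ wt x := by
  unfold wt
  rw [Real.one_le_sqrt]
  nlinarith [sq_nonneg ‖x‖]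

lemma wt_pos (x : Spc n) : 0 < wt x := lt_of_lt_of_le one_pos (one_le_wt x)

lemma wt_le_one_add (x : Spc n) : wt x ≤ 1 + ‖x‖ := by
  unfold wt
  rw [Real.sqrt_le_left (by positivity)]
  nlinarith [norm_nonneg x]

lemma norm_le_wt (x : Spc n) : ‖x‖ ≤ wt x :=
  Real.le_sqrt_of_sq_le (by linarith)

lemma wt_rpow_pos (x : Spc n) (p : ℝ) : 0 < wt x ^ p := Real.rpow_pos_of_pos (wt_pos x) p

/-- Pairs of points for which the weights are comparable. -/
def Near (x y : Spc n) : Prop := ‖x - y‖ ≤ 2 + ‖x‖ / 2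

lemma Near.wt_le {x y : Spc n} (h : Near x y) : wt x ≤ 7 * wt y ∧ wt y ≤ 7 * wt x := by
  unfold Near at h
  have h1 := wt_le_one_add x
  have h2 := wt_le_one_add y
  have h3 := norm_le_wt x
  have h4 := norm_le_wt y
  have h5 := one_le_wt x
  have h6 := one_le_wt y
  have h7 := norm_sub_norm_le x y
  have h8 := norm_sub_norm_le y x
  rw [norm_sub_rev] at h8
  constructor <;> linarith

lemma rpow_le_of_comparable {a b c : ℝ} (ha : 0 < a) (hb : 0 < b) (hc : 1 ≤ c)
    (h1 : a ≤ c * b) (h2 : b ≤ c * a) (p : ℝ) : a ^ p ≤ c ^ |p| * b ^ p := by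
  have hc0 : 0 < c := by linarith
  rcases le_total 0 p with hp | hp
  · rw [abs_of_nonneg hp, ← Real.mul_rpow hc0.le hb.le]
    exact Real.rpow_le_rpow ha.le h1 hp
  · have : a ^ p ≤ (b / c) ^ p :=
      Real.rpow_le_rpow_of_nonpos (by positivity) (by rw [div_le_iff₀ hc0]; linarith) hp
    refine this.trans (le_of_eq ?_)
    rw [abs_of_nonpos hp, Real.div_rpow hb.le hc0.le, Real.rpow_neg hc0.le]
    field_simp

lemma Near.wt_rpow_le {x y : Spc n} (h : Near x y) (p : ℝ) :
    wt x ^ p ≤ 7 ^ |p| * wt y ^ p :=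
  rpow_le_of_comparable (wt_pos x) (wt_pos y) (by norm_num) h.wt_le.1 h.wt_le.2 p

lemma Near.wt_rpow_le' {x y : Spc n} (h : Near x y) (p : ℝ) :
    wt y ^ p ≤ 7 ^ |p| * wt x ^ p :=
  rpow_le_of_comparable (wt_pos y) (wt_pos x) (by norm_num) h.wt_le.2 h.wt_le.1 p

lemma near_of_norm_le_two {x y : Spc n} (h : ‖x - y‖ ≤ 2) : Near x y := by
  unfold Near; have := norm_nonneg x; linarith

lemma one_le_seven_rpow (p : ℝ) : (1 : ℝ) ≤ 7 ^ |p| :=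
  Real.one_le_rpow (by norm_num) (abs_nonneg p)

/-- Weighted parabolic Hölder bound of order zero with constant `A`. -/
structure HolderBd {F : Type*} [NormedAddCommGroup F] (T lam a A : ℝ) (v : ℝ → Spc n → F) :
    Prop where
  sup : ∀ t ∈ Set.Icc (0 : ℝ) T, ∀ x, wt x ^ a * ‖v t x‖ ≤ A
  space : ∀ t ∈ Set.Icc (0 : ℝ) T, ∀ x y, Near x y →
    wt x ^ (a + lam) * ‖v t x - v t y‖ ≤ A * ‖x - y‖ ^ lam
  time : ∀ t₁ ∈ Set.Icc (0 : ℝ) T, ∀ t₂ ∈ Set.Icc (0 : ℝ) T, ∀ x,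
    wt x ^ a * ‖v t₁ x - v t₂ x‖ ≤ A * |t₁ - t₂| ^ (lam / 2)

namespace HolderBd

variable {F G : Type*} [NormedAddCommGroup F] [NormedAddCommGroup G] {T lam a b A B : ℝ}

lemma nonneg {v : ℝ → Spc n → F} (hT : 0 ≤ T) (h : HolderBd T lam a A v) : 0 ≤ A :=
  le_trans (mul_nonneg (wt_rpow_pos 0 a).le (norm_nonneg _)) (h.sup 0 ⟨le_rfl, hT⟩ 0)

lemma congr {u v : ℝ → Spc n → F} (h : HolderBd T lam a A u)
    (huv : ∀ t ∈ Set.Icc (0 : ℝ) T, ∀ x, u t x = v t x) : HolderBd T lam a A v where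
  sup t ht x := by rw [← huv t ht]; exact h.sup t ht x
  space t ht x y hxy := by rw [← huv t ht, ← huv t ht]; exact h.space t ht x y hxy
  time t ht s hs x := by rw [← huv t ht, ← huv s hs]; exact h.time t ht s hs x

lemma mono {v : ℝ → Spc n → F} (h : HolderBd T lam a A v) (hAB : A ≤ B) :
    HolderBd T lam a B v where
  sup t ht x := (h.sup t ht x).trans hAB
  space t ht x y hxy := (h.space t ht x y hxy).trans (by gcongr)
  time t ht s hs x := (h.time t ht s hs x).trans (by gcongr)

lemma weight_mono {v : ℝ → Spc n → F} (h : HolderBd T lam a A v) (hab : b ≤ a) :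
    HolderBd T lam b A v where
  sup t ht x := le_trans (by gcongr; exact one_le_wt x) (h.sup t ht x)
  space t ht x y hxy := le_trans (by gcongr; exact one_le_wt x) (h.space t ht x y hxy)
  time t ht s hs x := le_trans (by gcongr; exact one_le_wt x) (h.time t ht s hs x)

lemma add {u v : ℝ → Spc n → F} (hu : HolderBd T lam a A u) (hv : HolderBd T lam a B v) :
    HolderBd T lam a (A + B) (fun t x => u t x + v t x) where
  sup t ht x := by
    have h1 := hu.sup t ht x
    have h2 := hv.sup t ht x
    have h3 := mul_le_mul_of_nonneg_left (norm_add_le (u t x) (v t x)) (wt_rpow_pos x a).le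
    linarith
  space t ht x y hxy := by
    have h1 := hu.space t ht x y hxy
    have h2 := hv.space t ht x y hxy
    have h3 := mul_le_mul_of_nonneg_left (norm_add_le (u t x - u t y) (v t x - v t y))
      (wt_rpow_pos x (a + lam)).le
    rw [add_sub_add_comm]
    linarith
  time t ht s hs x := by
    have h1 := hu.time t ht s hs x
    have h2 := hv.time t ht s hs x
    have h3 := mul_le_mul_of_nonneg_left (norm_add_le (u t x - u s x) (v t x - v s x))
      (wt_rpow_pos x a).le
    rw [add_sub_add_comm]
    linarith

lemma clm [NormedSpace ℝ F] [NormedSpace ℝ G] {v : ℝ → Spc n → F} (h : HolderBd T lam a A v)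
    (L : F →L[ℝ] G) : HolderBd T lam a (‖L‖ * A) (fun t x => L (v t x)) where
  sup t ht x := by
    have h1 := mul_le_mul_of_nonneg_left (h.sup t ht x) (norm_nonneg L)
    have h2 := mul_le_mul_of_nonneg_left (L.le_opNorm (v t x)) (wt_rpow_pos x a).le
    linarith
  space t ht x y hxy := by
    have h1 := mul_le_mul_of_nonneg_left (h.space t ht x y hxy) (norm_nonneg L)
    have h2 := mul_le_mul_of_nonneg_left (L.le_opNorm (v t x - v t y))
      (wt_rpow_pos x (a + lam)).le
    rw [← map_sub]
    linarith
  time t ht s hs x := by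
    have h1 := mul_le_mul_of_nonneg_left (h.time t ht s hs x) (norm_nonneg L)
    have h2 := mul_le_mul_of_nonneg_left (L.le_opNorm (v t x - v s x)) (wt_rpow_pos x a).le
    rw [← map_sub]
    linarith

lemma zero : HolderBd T lam a 0 (fun (_ : ℝ) (_ : Spc n) => (0 : F)) where
  sup := by simp
  space := by simp
  time := by simp

lemma sum {ι : Type*} (s : Finset ι) {A : ι → ℝ} {v : ι → ℝ → Spc n → F}
    (h : ∀ i ∈ s, HolderBd T lam a (A i) (v i)) :
    HolderBd T lam a (∑ i ∈ s, A i) (fun t x => ∑ i ∈ s, v i t x) := by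
  induction s using Finset.induction_on with
  | empty => simpa using zero
  | insert i s hi ih =>
    simp only [Finset.sum_insert hi]
    exact (h i (by simp)).add (ih fun j hj => h j (by simp [hj]))

lemma mul {u v : ℝ → Spc n → ℝ} (hT : 0 ≤ T) (hu : HolderBd T lam a A u)
    (hv : HolderBd T lam b B v) :
    HolderBd T lam (a + b) ((1 + 7 ^ |a|) * (A * B)) (fun t x => u t x * v t x) := by
  have hA := hu.nonneg hT
  have hB := hv.nonneg hT
  have h7 := one_le_seven_rpow a
  have hw : ∀ (x : Spc n) (c d : ℝ), wt x ^ (c + d) = wt x ^ c * wt x ^ d := fun x c d =>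
    Real.rpow_add (wt_pos x) c d
  have key : ∀ {p q P Q : ℝ}, 0 ≤ q → p ≤ P → q ≤ Q → 0 ≤ P → p * q ≤ P * Q :=
    fun hq hp hqQ hP => mul_le_mul hp hqQ hq hP
  refine ⟨fun t ht x => ?_, fun t ht x y hxy => ?_, fun t ht s hs x => ?_⟩
  · have h1 := mul_le_mul (hu.sup t ht x) (hv.sup t ht x)
      (mul_nonneg (wt_rpow_pos x b).le (norm_nonneg _)) hA
    rw [norm_mul, hw]
    nlinarith [mul_nonneg hA hB]
  · have h1 := mul_le_mul (hu.space t ht x y hxy) (hv.sup t ht x)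
      (mul_nonneg (wt_rpow_pos x b).le (norm_nonneg _)) (by positivity)
    have h2 : wt x ^ a * ‖u t y‖ ≤ 7 ^ |a| * A := by
      have h3 := mul_le_mul_of_nonneg_right (hxy.wt_rpow_le a) (norm_nonneg (u t y))
      have h4 := mul_le_mul_of_nonneg_left (hu.sup t ht y) (zero_le_one.trans h7)
      linarith
    have h3 := mul_le_mul h2 (hv.space t ht x y hxy)
      (mul_nonneg (wt_rpow_pos x _).le (norm_nonneg _)) (by positivity)
    have h4 : ‖u t x * v t x - u t y * v t y‖ ≤
        ‖u t x - u t y‖ * ‖v t x‖ + ‖u t y‖ * ‖v t x - v t y‖ := by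
      rw [← norm_mul, ← norm_mul]
      refine le_trans (le_of_eq ?_) (norm_add_le _ _)
      congr 1; ring
    have h5 := mul_le_mul_of_nonneg_left h4 (wt_rpow_pos x (a + b + lam)).le
    rw [hw] at h1 h3
    rw [hw, hw] at h5 ⊢
    nlinarith
  · have h1 := mul_le_mul (hu.time t ht s hs x) (hv.sup t ht x)
      (mul_nonneg (wt_rpow_pos x b).le (norm_nonneg _)) (by positivity)
    have h3 := mul_le_mul (hu.sup s hs x) (hv.time t ht s hs x)
      (mul_nonneg (wt_rpow_pos x _).le (norm_nonneg _)) (by positivity)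
    have h4 : ‖u t x * v t x - u s x * v s x‖ ≤
        ‖u t x - u s x‖ * ‖v t x‖ + ‖u s x‖ * ‖v t x - v s x‖ := by
      rw [← norm_mul, ← norm_mul]
      refine le_trans (le_of_eq ?_) (norm_add_le _ _)
      congr 1; ring
    have h5 := mul_le_mul_of_nonneg_left h4 (wt_rpow_pos x (a + b)).le
    have h6 : 0 ≤ (7 ^ |a| - 1) * (A * B * |t - s| ^ (lam / 2)) :=
      mul_nonneg (by linarith) (by positivity)
    rw [hw] at h5 ⊢
    nlinarith

/-- Joint continuity of a function with a Hölder bound. -/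
lemma continuousOn {v : ℝ → Spc n → F} (hl : 0 < lam) (h : HolderBd T lam a A v) :
    ContinuousOn (fun p : ℝ × Spc n => v p.1 p.2) (Set.Icc (0 : ℝ) T ×ˢ Set.univ) := by
  rintro ⟨t, x⟩ ⟨ht, -⟩
  simp only at ht
  rw [ContinuousWithinAt, tendsto_iff_norm_sub_tendsto_zero]
  have hlim : Tendsto (fun p : ℝ × Spc n =>
      7 ^ |a| * wt x ^ (-a) * (A * |p.1 - t| ^ (lam / 2))
        + wt x ^ (-(a + lam)) * (A * ‖x - p.2‖ ^ lam)) (nhdsWithin (t, x) (Set.Icc (0 : ℝ) T ×ˢ Set.univ))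
      (nhds 0) := by
    have : Continuous (fun p : ℝ × Spc n =>
      7 ^ |a| * wt x ^ (-a) * (A * |p.1 - t| ^ (lam / 2))
        + wt x ^ (-(a + lam)) * (A * ‖x - p.2‖ ^ lam)) := by
      have h1 : Continuous (fun p : ℝ × Spc n => |p.1 - t| ^ (lam / 2)) :=
        Continuous.rpow_const (by fun_prop) (fun _ => Or.inr (by positivity))
      have h2 : Continuous (fun p : ℝ × Spc n => ‖x - p.2‖ ^ lam) :=
        Continuous.rpow_const (by fun_prop) (fun _ => Or.inr (by positivity))
      fun_prop
    have h0 := (this.tendsto (t, x)).mono_left (nhdsWithin_le_nhds (s := Set.Icc (0 : ℝ) T ×ˢ Set.univ))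
    simpa [Real.zero_rpow hl.ne', Real.zero_rpow (half_pos hl).ne'] using h0
  refine squeeze_zero' (Eventually.of_forall fun _ => norm_nonneg _) ?_ hlim
  have hball : ∀ᶠ p : ℝ × Spc n in nhdsWithin (t, x) (Set.Icc (0 : ℝ) T ×ˢ Set.univ),
      ‖x - p.2‖ ≤ 2 := by
    refine nhdsWithin_le_nhds ?_
    have hc : Continuous fun p : ℝ × Spc n => ‖x - p.2‖ := by fun_prop
    have := (hc.tendsto (t, x)).eventually (gt_mem_nhds (show ‖x - (t, x).2‖ < 2 by simp))
    filter_upwards [this] with p hp using hp.le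
  filter_upwards [hball, self_mem_nhdsWithin] with p hp hmem
  have hn := near_of_norm_le_two hp
  have h1 := h.time p.1 hmem.1 t ht p.2
  have h2 := h.space t ht x p.2 hn
  have h3 : ‖v p.1 p.2 - v t x‖ ≤ ‖v p.1 p.2 - v t p.2‖ + ‖v t x - v t p.2‖ := by
    rw [norm_sub_rev (v t x)]
    exact norm_sub_le_norm_sub_add_norm_sub _ _ _
  have h4 : ‖v p.1 p.2 - v t p.2‖ ≤ 7 ^ |a| * wt x ^ (-a) * (A * |p.1 - t| ^ (lam / 2)) := by
    have h5 := hn.wt_rpow_le a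
    rw [Real.rpow_neg (wt_pos x).le]
    have hx := wt_rpow_pos x a
    rw [mul_comm (7 ^ |a|), mul_assoc, inv_mul_eq_div, le_div_iff₀ hx]
    have h6 := mul_le_mul_of_nonneg_right h5 (norm_nonneg (v p.1 p.2 - v t p.2))
    have h7 := mul_le_mul_of_nonneg_left h1 (zero_le_one.trans (one_le_seven_rpow a))
    linarith
  have h5 : ‖v t x - v t p.2‖ ≤ wt x ^ (-(a + lam)) * (A * ‖x - p.2‖ ^ lam) := by
    rw [Real.rpow_neg (wt_pos x).le, inv_mul_eq_div, le_div_iff₀ (wt_rpow_pos x _)]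
    linarith
  exact h3.trans (add_le_add h4 h5)

end HolderBd

/-- The linear functional with coefficients `c`. -/
def gradForm (c : Fin n → ℝ) : Spc n →L[ℝ] ℝ := ∑ i, c i • EuclideanSpace.proj i

lemma gradForm_apply (c : Fin n → ℝ) (x : Spc n) : gradForm c x = ∑ i, c i * x i := by
  simp [gradForm]

lemma gradForm_single (c : Fin n → ℝ) (i : Fin n) :
    gradForm c (EuclideanSpace.single i 1) = c i := by
  simp [gradForm_apply]

lemma norm_gradForm_le (c : Fin n → ℝ) : ‖gradForm c‖ ≤ ∑ i, |c i| := by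
  refine ContinuousLinearMap.opNorm_le_bound _ (Finset.sum_nonneg fun _ _ => abs_nonneg _) ?_
  intro x
  rw [gradForm_apply, Finset.sum_mul]
  refine (norm_sum_le _ _).trans (Finset.sum_le_sum fun i _ => ?_)
  rw [norm_mul, Real.norm_eq_abs]
  exact mul_le_mul_of_nonneg_left (PiLp.norm_apply_le x i) (abs_nonneg _)

lemma gradForm_add (c d : Fin n → ℝ) :
    gradForm (fun i => c i + d i) = gradForm c + gradForm d := by
  ext x; simp [gradForm_apply, add_mul, Finset.sum_add_distrib]

lemma gradForm_smul (r : ℝ) (c : Fin n → ℝ) :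
    gradForm (fun i => r * c i) = r • gradForm c := by
  ext x; simp [gradForm_apply, mul_assoc, Finset.mul_sum]

lemma pd_of_hasFDerivAt {f : Spc n → ℝ} {c : Fin n → ℝ} {x : Spc n}
    (h : HasFDerivAt f (gradForm c) x) (i : Fin n) : pd i f x = c i := by
  rw [pd, h.fderiv, gradForm_single]

lemma gradForm_pd {f : Spc n → ℝ} {x : Spc n} :
    gradForm (fun i => pd i f x) = fderiv ℝ f x := by
  ext v
  have hv : v = ∑ i, v i • EuclideanSpace.single i (1 : ℝ) := by
    ext j
    simp [Finset.sum_apply, Pi.single_apply]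
  conv_rhs => rw [hv]
  rw [map_sum, gradForm_apply]
  refine Finset.sum_congr rfl fun i _ => ?_
  rw [map_smul, pd, smul_eq_mul, mul_comm]

lemma hasFDerivAt_pd {f : Spc n → ℝ} {x : Spc n} (h : DifferentiableAt ℝ f x) :
    HasFDerivAt f (gradForm fun i => pd i f x) x := by
  rw [gradForm_pd]; exact h.hasFDerivAt

/-- `g` is the spatial gradient of `u` on `[0,T] × ℝⁿ`. -/
def IsGrad (T : ℝ) (u : ℝ → Spc n → ℝ) (g : Fin n → ℝ → Spc n → ℝ) : Prop :=
  ∀ t ∈ Set.Icc (0 : ℝ) T, ∀ x, HasFDerivAt (u t) (gradForm fun i => g i t x) x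

/-- `v` is the time derivative of `u` on `[0,T] × ℝⁿ`. -/
def IsTDeriv (T : ℝ) (u v : ℝ → Spc n → ℝ) : Prop :=
  ∀ t ∈ Set.Icc (0 : ℝ) T, ∀ x,
    HasDerivWithinAt (fun τ => u τ x) (v t x) (Set.Icc (0 : ℝ) T) t

/-- Bounds for spatial derivatives up to order `M`, with weights increasing with the order. -/
def SpaceBd (T lam : ℝ) : ℕ → ℝ → ℝ → (ℝ → Spc n → ℝ) → Prop
  | 0, a, A, u => HolderBd T lam a A u
  | M + 1, a, A, u => HolderBd T lam a A u ∧
      ∃ g : Fin n → ℝ → Spc n → ℝ, IsGrad T u g ∧ ∀ i, SpaceBd T lam M (a + 1) A (g i)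

/-- Bounds for the mixed derivatives `∂_x^m ∂_t^j`, `j ≤ s`, `m + 2 j ≤ 2 s + k`. -/
def ParBd (T lam : ℝ) : ℕ → ℕ → ℝ → ℝ → (ℝ → Spc n → ℝ) → Prop
  | 0, k, a, A, u => SpaceBd T lam k a A u
  | s + 1, k, a, A, u => SpaceBd T lam (2 * (s + 1) + k) a A u ∧
      ∃ v : ℝ → Spc n → ℝ, IsTDeriv T u v ∧ ParBd T lam s k a A v

section algebra

variable {T lam a b A B : ℝ} {M k s : ℕ} {u v : ℝ → Spc n → ℝ}

lemma IsGrad.congr {g : Fin n → ℝ → Spc n → ℝ} (h : IsGrad T u g)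
    (huv : ∀ t ∈ Set.Icc (0 : ℝ) T, ∀ x, u t x = v t x) : IsGrad T v g := fun t ht x => by
  have : v t = u t := funext fun x => (huv t ht x).symm
  rw [this]; exact h t ht x

lemma IsTDeriv.congr {w : ℝ → Spc n → ℝ} (h : IsTDeriv T u w)
    (huv : ∀ t ∈ Set.Icc (0 : ℝ) T, ∀ x, u t x = v t x) : IsTDeriv T v w := fun t ht x =>
  (h t ht x).congr (fun τ hτ => (huv τ hτ x).symm) (huv t ht x).symm

lemma IsGrad.pd_eq {g : Fin n → ℝ → Spc n → ℝ} (h : IsGrad T u g) {t : ℝ}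
    (ht : t ∈ Set.Icc (0 : ℝ) T) (x : Spc n) (i : Fin n) : pd i (u t) x = g i t x :=
  pd_of_hasFDerivAt (h t ht x) i

lemma IsGrad.add {g h : Fin n → ℝ → Spc n → ℝ} (hu : IsGrad T u g) (hv : IsGrad T v h) :
    IsGrad T (fun t x => u t x + v t x) (fun i t x => g i t x + h i t x) := fun t ht x => by
  rw [gradForm_add]; exact (hu t ht x).add (hv t ht x)

lemma IsGrad.const_mul {g : Fin n → ℝ → Spc n → ℝ} (hu : IsGrad T u g) (c : ℝ) :
    IsGrad T (fun t x => c * u t x) (fun i t x => c * g i t x) := fun t ht x => by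
  rw [gradForm_smul]; exact (hu t ht x).const_mul c

lemma IsGrad.mul {g h : Fin n → ℝ → Spc n → ℝ} (hu : IsGrad T u g) (hv : IsGrad T v h) :
    IsGrad T (fun t x => u t x * v t x) (fun i t x => u t x * h i t x + g i t x * v t x) :=
  fun t ht x => by
  have := (hu t ht x).mul (hv t ht x)
  refine this.congr_fderiv ?_
  rw [gradForm_add, gradForm_smul]
  congr 1
  rw [← gradForm_smul]
  congr 1; ext i; ring

lemma SpaceBd.holderBd (h : SpaceBd T lam M a A u) : HolderBd T lam a A u := by
  cases M with
  | zero => exact h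
  | succ M => exact h.1

lemma SpaceBd.nonneg (hT : 0 ≤ T) (h : SpaceBd T lam M a A u) : 0 ≤ A := h.holderBd.nonneg hT

lemma SpaceBd.congr (h : SpaceBd T lam M a A u)
    (huv : ∀ t ∈ Set.Icc (0 : ℝ) T, ∀ x, u t x = v t x) : SpaceBd T lam M a A v := by
  cases M with
  | zero => exact HolderBd.congr h huv
  | succ M =>
    obtain ⟨h0, g, hg, hb⟩ := h
    exact ⟨h0.congr huv, g, hg.congr huv, hb⟩

lemma SpaceBd.mono (h : SpaceBd T lam M a A u) (hAB : A ≤ B) : SpaceBd T lam M a B u := by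
  induction M generalizing a u with
  | zero => exact HolderBd.mono h hAB
  | succ M ih =>
    obtain ⟨h0, g, hg, hb⟩ := h
    exact ⟨h0.mono hAB, g, hg, fun i => ih (hb i)⟩

lemma SpaceBd.weight_mono (h : SpaceBd T lam M a A u) (hab : b ≤ a) :
    SpaceBd T lam M b A u := by
  induction M generalizing a b u with
  | zero => exact HolderBd.weight_mono h hab
  | succ M ih =>
    obtain ⟨h0, g, hg, hb⟩ := h
    exact ⟨h0.weight_mono hab, g, hg, fun i => ih (hb i) (by linarith)⟩

lemma SpaceBd.of_succ (h : SpaceBd T lam (M + 1) a A u) : SpaceBd T lam M a A u := by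
  induction M generalizing a u with
  | zero => exact h.1
  | succ M ih =>
    obtain ⟨h0, g, hg, hb⟩ := h
    exact ⟨h0, g, hg, fun i => ih (hb i)⟩

lemma SpaceBd.order_mono {N : ℕ} (h : SpaceBd T lam N a A u) (hMN : M ≤ N) :
    SpaceBd T lam M a A u := by
  induction N, hMN using Nat.le_induction with
  | base => exact h
  | succ N _ ih => exact ih h.of_succ

lemma SpaceBd.zero : SpaceBd T lam M a 0 (fun (_ : ℝ) (_ : Spc n) => (0 : ℝ)) := by
  induction M generalizing a with
  | zero => exact HolderBd.zero
  | succ M ih =>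
    refine ⟨HolderBd.zero, fun _ _ _ => 0, fun t _ x => ?_, fun i => ih⟩
    have : gradForm (fun _ : Fin n => (0 : ℝ)) = 0 := by ext; simp [gradForm_apply]
    rw [this]; exact hasFDerivAt_const _ _

lemma SpaceBd.add (hu : SpaceBd T lam M a A u) (hv : SpaceBd T lam M a B v) :
    SpaceBd T lam M a (A + B) (fun t x => u t x + v t x) := by
  induction M generalizing a u v with
  | zero => exact HolderBd.add hu hv
  | succ M ih =>
    obtain ⟨h0, g, hg, hb⟩ := hu
    obtain ⟨h0', g', hg', hb'⟩ := hv
    exact ⟨h0.add h0', _, hg.add hg', fun i => ih (hb i) (hb' i)⟩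

lemma HolderBd.const_mul (hu : HolderBd T lam a A u) (c : ℝ) :
    HolderBd T lam a (|c| * A) (fun t x => c * u t x) where
  sup t ht x := by
    rw [norm_mul, Real.norm_eq_abs c]
    nlinarith [mul_le_mul_of_nonneg_left (hu.sup t ht x) (abs_nonneg c)]
  space t ht x y hxy := by
    rw [← mul_sub, norm_mul, Real.norm_eq_abs c]
    nlinarith [mul_le_mul_of_nonneg_left (hu.space t ht x y hxy) (abs_nonneg c)]
  time t ht s hs x := by
    rw [← mul_sub, norm_mul, Real.norm_eq_abs c]
    nlinarith [mul_le_mul_of_nonneg_left (hu.time t ht s hs x) (abs_nonneg c)]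

lemma SpaceBd.const_mul (hu : SpaceBd T lam M a A u) (c : ℝ) :
    SpaceBd T lam M a (|c| * A) (fun t x => c * u t x) := by
  induction M generalizing a u with
  | zero => exact HolderBd.const_mul hu c
  | succ M ih =>
    obtain ⟨h0, g, hg, hb⟩ := hu
    exact ⟨h0.const_mul c, _, hg.const_mul c, fun i => ih (hb i)⟩

lemma SpaceBd.exists_mul (n : ℕ) (T lam : ℝ) (hT : 0 ≤ T) (M : ℕ) (a b : ℝ) :
    ∃ C, 0 ≤ C ∧ ∀ A B (u v : ℝ → Spc n → ℝ), SpaceBd T lam M a A u → SpaceBd T lam M b B v →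
      SpaceBd T lam M (a + b) (C * (A * B)) (fun t x => u t x * v t x) := by
  induction M generalizing a b with
  | zero => exact ⟨1 + 7 ^ |a|, by positivity, fun A B u v hu hv => HolderBd.mul hT hu hv⟩
  | succ M ih =>
    obtain ⟨C₁, hC₁, h₁⟩ := ih a (b + 1)
    obtain ⟨C₂, hC₂, h₂⟩ := ih (a + 1) b
    refine ⟨1 + 7 ^ |a| + C₁ + C₂, by positivity, fun A B u v hu hv => ?_⟩
    have hAB : 0 ≤ A * B := mul_nonneg (hu.nonneg hT) (hv.nonneg hT)
    have hu' := hu.of_succ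
    have hv' := hv.of_succ
    obtain ⟨h0, g, hg, hb⟩ := hu
    obtain ⟨h0', g', hg', hb'⟩ := hv
    refine ⟨(h0.mul hT h0').mono (by nlinarith [mul_nonneg hC₁ hAB, mul_nonneg hC₂ hAB]), _,
      hg.mul hg', fun i => ?_⟩
    have e1 := h₁ A B _ _ hu' (hb' i)
    have e2 := h₂ A B _ _ (hb i) hv'
    rw [show a + (b + 1) = a + b + 1 by ring] at e1
    rw [show a + 1 + b = a + b + 1 by ring] at e2
    refine (e1.add e2).mono ?_
    have : 0 ≤ (1 + 7 ^ |a|) * (A * B) := by positivity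
    linarith

lemma ParBd.spaceBd (h : ParBd T lam s k a A u) : SpaceBd T lam (2 * s + k) a A u := by
  cases s with
  | zero => rw [Nat.mul_zero, Nat.zero_add]; exact h
  | succ s => exact h.1

lemma ParBd.nonneg (hT : 0 ≤ T) (h : ParBd T lam s k a A u) : 0 ≤ A := h.spaceBd.nonneg hT

lemma ParBd.congr (h : ParBd T lam s k a A u)
    (huv : ∀ t ∈ Set.Icc (0 : ℝ) T, ∀ x, u t x = v t x) : ParBd T lam s k a A v := by
  cases s with
  | zero => exact SpaceBd.congr h huv
  | succ s =>
    obtain ⟨h0, w, hw, hb⟩ := h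
    exact ⟨h0.congr huv, w, hw.congr huv, hb⟩

lemma ParBd.mono (h : ParBd T lam s k a A u) (hAB : A ≤ B) : ParBd T lam s k a B u := by
  induction s generalizing u with
  | zero => exact SpaceBd.mono h hAB
  | succ s ih =>
    obtain ⟨h0, w, hw, hb⟩ := h
    exact ⟨h0.mono hAB, w, hw, ih hb⟩

lemma ParBd.weight_mono (h : ParBd T lam s k a A u) (hab : b ≤ a) :
    ParBd T lam s k b A u := by
  induction s generalizing u with
  | zero => exact SpaceBd.weight_mono h hab
  | succ s ih =>
    obtain ⟨h0, w, hw, hb⟩ := h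
    exact ⟨h0.weight_mono hab, w, hw, ih hb⟩

lemma ParBd.order_mono {l : ℕ} (h : ParBd T lam s l a A u) (hkl : k ≤ l) :
    ParBd T lam s k a A u := by
  induction s generalizing u with
  | zero => exact SpaceBd.order_mono h hkl
  | succ s ih =>
    obtain ⟨h0, w, hw, hb⟩ := h
    exact ⟨h0.order_mono (by omega), w, hw, ih hb⟩

lemma ParBd.of_succ (h : ParBd T lam (s + 1) k a A u) : ParBd T lam s (k + 2) a A u := by
  induction s generalizing u with
  | zero => exact h.1.order_mono (by omega)
  | succ s ih =>
    obtain ⟨h0, w, hw, hb⟩ := h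
    exact ⟨h0.order_mono (by omega), w, hw, ih hb⟩

lemma ParBd.zero : ParBd T lam s k a 0 (fun (_ : ℝ) (_ : Spc n) => (0 : ℝ)) := by
  induction s with
  | zero => exact SpaceBd.zero
  | succ s ih =>
    exact ⟨SpaceBd.zero, _, fun t _ x => hasDerivWithinAt_const _ _ _, ih⟩

lemma ParBd.add (hu : ParBd T lam s k a A u) (hv : ParBd T lam s k a B v) :
    ParBd T lam s k a (A + B) (fun t x => u t x + v t x) := by
  induction s generalizing u v with
  | zero => exact SpaceBd.add hu hv
  | succ s ih =>
    obtain ⟨h0, w, hw, hb⟩ := hu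
    obtain ⟨h0', w', hw', hb'⟩ := hv
    exact ⟨h0.add h0', fun t x => w t x + w' t x, fun t ht x => (hw t ht x).add (hw' t ht x),
      ih hb hb'⟩

lemma ParBd.const_mul (hu : ParBd T lam s k a A u) (c : ℝ) :
    ParBd T lam s k a (|c| * A) (fun t x => c * u t x) := by
  induction s generalizing u with
  | zero => exact SpaceBd.const_mul hu c
  | succ s ih =>
    obtain ⟨h0, w, hw, hb⟩ := hu
    exact ⟨h0.const_mul c, _, fun t ht x => (hw t ht x).const_mul c, ih hb⟩

lemma ParBd.sum {ι : Type*} (S : Finset ι) {A : ι → ℝ} {v : ι → ℝ → Spc n → ℝ}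
    (h : ∀ i ∈ S, ParBd T lam s k a (A i) (v i)) :
    ParBd T lam s k a (∑ i ∈ S, A i) (fun t x => ∑ i ∈ S, v i t x) := by
  induction S using Finset.induction_on with
  | empty => simpa using ParBd.zero
  | insert i S hi ih =>
    simp only [Finset.sum_insert hi]
    exact (h i (by simp)).add (ih fun j hj => h j (by simp [hj]))

lemma ParBd.exists_mul (n : ℕ) (T lam : ℝ) (hT : 0 ≤ T) (s k : ℕ) (a b : ℝ) :
    ∃ C, 0 ≤ C ∧ ∀ A B (u v : ℝ → Spc n → ℝ), ParBd T lam s k a A u → ParBd T lam s k b B v →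
      ParBd T lam s k (a + b) (C * (A * B)) (fun t x => u t x * v t x) := by
  induction s generalizing k with
  | zero => exact SpaceBd.exists_mul n T lam hT k a b
  | succ s ih =>
    obtain ⟨C₁, hC₁, h₁⟩ := ih k
    obtain ⟨C₂, hC₂, h₂⟩ := SpaceBd.exists_mul n T lam hT (2 * (s + 1) + k) a b
    refine ⟨C₂ + 2 * C₁, by positivity, fun A B u v hu hv => ?_⟩
    have hAB : 0 ≤ A * B := mul_nonneg (hu.nonneg hT) (hv.nonneg hT)
    have hu' := hu.of_succ.order_mono (show k ≤ k + 2 by omega)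
    have hv' := hv.of_succ.order_mono (show k ≤ k + 2 by omega)
    obtain ⟨h0, w, hw, hb⟩ := hu
    obtain ⟨h0', w', hw', hb'⟩ := hv
    refine ⟨(h₂ A B _ _ h0 h0').mono (by nlinarith [mul_nonneg hC₁ hAB]), _,
      fun t ht x => (hw t ht x).mul (hw' t ht x), ?_⟩
    refine ((h₁ A B _ _ hb hv').add (h₁ A B _ _ hu' hb')).mono ?_
    nlinarith [mul_nonneg hC₂ hAB]

end algebra

/-- Clamping of the time variable to `[0,T]`. -/
def clampT (T τ : ℝ) : ℝ := max 0 (min τ T)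

lemma clampT_mem {T : ℝ} (hT : 0 ≤ T) (τ : ℝ) : clampT T τ ∈ Set.Icc (0 : ℝ) T :=
  ⟨le_max_left _ _, max_le hT (min_le_right _ _)⟩

lemma clampT_eq {T τ : ℝ} (h : τ ∈ Set.Icc (0 : ℝ) T) : clampT T τ = τ := by
  rw [clampT, min_eq_left h.2, max_eq_right h.1]

lemma continuous_clampT (T : ℝ) : Continuous (clampT T) := by
  unfold clampT; fun_prop

section commute

variable {T lam a b A B : ℝ} {u v : ℝ → Spc n → ℝ} {g gv : Fin n → ℝ → Spc n → ℝ}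

lemma HolderBd.continuous_clamp {F : Type*} [NormedAddCommGroup F] {v : ℝ → Spc n → F}
    (hT : 0 ≤ T) (hl : 0 < lam) (h : HolderBd T lam a A v) :
    Continuous (fun p : ℝ × Spc n => v (clampT T p.1) p.2) := by
  have h1 : Continuous fun p : ℝ × Spc n => (clampT T p.1, p.2) := by
    have := continuous_clampT T
    fun_prop
  exact (h.continuousOn hl).comp_continuous h1 fun p => ⟨clampT_mem hT _, trivial⟩

lemma HolderBd.continuousOn_time {F : Type*} [NormedAddCommGroup F] {v : ℝ → Spc n → F}
    (hl : 0 < lam) (h : HolderBd T lam a A v) (x : Spc n) :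
    ContinuousOn (fun t => v t x) (Set.Icc (0 : ℝ) T) :=
  (h.continuousOn hl).comp (f := fun t : ℝ => (t, x)) (by fun_prop) fun t ht => ⟨ht, trivial⟩

lemma HolderBd.intervalIntegrable {F : Type*} [NormedAddCommGroup F] [NormedSpace ℝ F]
    {v : ℝ → Spc n → F}
    (hl : 0 < lam) (h : HolderBd T lam a A v) (x : Spc n) {t : ℝ} (ht : t ∈ Set.Icc (0 : ℝ) T) :
    IntervalIntegrable (fun τ => v τ x) volume 0 t := by
  refine ContinuousOn.intervalIntegrable ?_
  rw [Set.uIcc_of_le ht.1]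
  exact (h.continuousOn_time hl x).mono (Set.Icc_subset_Icc le_rfl ht.2)

lemma IsTDeriv.integral_eq (hl : 0 < lam) (h : IsTDeriv T u v) (hv : HolderBd T lam a A v)
    {t : ℝ} (ht : t ∈ Set.Icc (0 : ℝ) T) (x : Spc n) :
    ∫ τ in (0 : ℝ)..t, v τ x = u t x - u 0 x := by
  refine intervalIntegral.integral_eq_sub_of_hasDerivAt_of_le (f := fun τ => u τ x) ht.1 ?_ ?_
    (hv.intervalIntegrable hl x ht)
  · intro τ hτ
    have hτ' : τ ∈ Set.Icc (0 : ℝ) T := ⟨hτ.1, hτ.2.trans ht.2⟩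
    exact (h τ hτ' x).continuousWithinAt.mono (Set.Icc_subset_Icc le_rfl ht.2)
  · intro τ hτ
    have hτ' : τ ∈ Set.Ioo (0 : ℝ) T := ⟨hτ.1, hτ.2.trans_le ht.2⟩
    exact (h τ (Set.Ioo_subset_Icc_self hτ') x).hasDerivAt (Icc_mem_nhds hτ'.1 hτ'.2)

/-- Primitives of continuous functions on `[0,T]`. -/
lemma hasDerivWithinAt_of_integral_eq {f F : ℝ → ℝ} (hT : 0 ≤ T)
    (hf : ContinuousOn f (Set.Icc (0 : ℝ) T))
    (hF : ∀ t ∈ Set.Icc (0 : ℝ) T, F t = F 0 + ∫ τ in (0 : ℝ)..t, f τ) :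
    ∀ t ∈ Set.Icc (0 : ℝ) T, HasDerivWithinAt F (f t) (Set.Icc (0 : ℝ) T) t := by
  intro t ht
  have hc : Continuous fun τ => f (clampT T τ) :=
    hf.comp_continuous (continuous_clampT T) fun τ => clampT_mem hT τ
  have h1 : HasDerivAt (fun t => F 0 + ∫ τ in (0 : ℝ)..t, f (clampT T τ)) (f (clampT T t)) t :=
    (hc.integral_hasStrictDerivAt 0 t).hasDerivAt.const_add _
  rw [clampT_eq ht] at h1
  have h2 : ∀ s ∈ Set.Icc (0 : ℝ) T, F s = F 0 + ∫ τ in (0 : ℝ)..s, f (clampT T τ) := by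
    intro s hs
    rw [hF s hs]
    congr 1
    refine intervalIntegral.integral_congr fun τ hτ => ?_
    rw [Set.uIcc_of_le hs.1] at hτ
    simp only [clampT_eq ⟨hτ.1, hτ.2.trans hs.2⟩]
  exact h1.hasDerivWithinAt.congr h2 (h2 t ht)

lemma continuous_gradForm {X : Type*} [TopologicalSpace X] {c : Fin n → X → ℝ}
    (h : ∀ i, Continuous (c i)) : Continuous fun p => gradForm fun i => c i p := by
  unfold gradForm
  exact continuous_finsetSum _ fun i _ => (h i).smul continuous_const

lemma HolderBd.norm_le_of_near {v : ℝ → Spc n → ℝ} (h : HolderBd T lam a A v) {t : ℝ}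
    (ht : t ∈ Set.Icc (0 : ℝ) T) {x y : Spc n} (hxy : Near x y) :
    |v t y| ≤ 7 ^ |a| * A * wt x ^ (-a) := by
  have h1 := h.sup t ht y
  have h2 := mul_le_mul_of_nonneg_right (hxy.wt_rpow_le a) (norm_nonneg (v t y))
  have h3 := mul_le_mul_of_nonneg_left h1 (zero_le_one.trans (one_le_seven_rpow a))
  rw [Real.norm_eq_abs] at *
  rw [Real.rpow_neg (wt_pos x).le, ← div_eq_mul_inv, le_div_iff₀ (wt_rpow_pos x a)]
  linarith

/-- The spatial gradient commutes with the time derivative. -/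
lemma IsTDeriv.grad (hT : 0 ≤ T) (hl : 0 < lam) (hu : IsTDeriv T u v) (hg : IsGrad T u g)
    (hgv : IsGrad T v gv) (hv : HolderBd T lam a A v) (hb : ∀ i, HolderBd T lam b B (gv i))
    (i : Fin n) : IsTDeriv T (g i) (gv i) := by
  intro t ht x
  refine hasDerivWithinAt_of_integral_eq (F := fun τ => g i τ x) (f := fun τ => gv i τ x) hT
    ((hb i).continuousOn_time hl x) (fun t ht => ?_) t ht
  have hsub : Set.uIoc (0 : ℝ) t ⊆ Set.Icc 0 T := by
    rw [Set.uIoc_of_le ht.1]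
    exact fun τ hτ => ⟨hτ.1.le, hτ.2.trans ht.2⟩
  have hInt : ∀ j, IntervalIntegrable (fun τ => gv j τ x) volume 0 t := fun j =>
    (hb j).intervalIntegrable hl x ht
  have hcg : ContinuousOn (fun τ => gradForm fun j => gv j τ x) (Set.Icc (0 : ℝ) t) := by
    unfold gradForm
    exact continuousOn_finsetSum _ fun j _ => ContinuousOn.smul
      (((hb j).continuousOn_time hl x).mono (Set.Icc_subset_Icc le_rfl ht.2)) continuousOn_const
  have hgint : IntervalIntegrable (fun τ => gradForm fun j => gv j τ x) volume 0 t := by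
    refine ContinuousOn.intervalIntegrable ?_
    rwa [Set.uIcc_of_le ht.1]
  have hD : HasFDerivAt (fun y => ∫ τ in (0 : ℝ)..t, v τ y)
      (∫ τ in (0 : ℝ)..t, gradForm fun j => gv j τ x) x := by
    refine intervalIntegral.hasFDerivAt_integral_of_dominated_of_fderiv_le
      (F := fun y τ => v τ y) (F' := fun y τ => gradForm fun j => gv j τ y)
      (bound := fun _ => ∑ j : Fin n, 7 ^ |b| * B * wt x ^ (-b))
      (Metric.ball_mem_nhds x one_pos) ?_ (hv.intervalIntegrable hl x ht)
      hgint.def'.aestronglyMeasurable ?_ intervalIntegrable_const ?_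
    · exact Eventually.of_forall fun y => (hv.intervalIntegrable hl y ht).def'.aestronglyMeasurable
    · refine Eventually.of_forall fun τ hτ y hy => (norm_gradForm_le _).trans ?_
      refine Finset.sum_le_sum fun j _ => (hb j).norm_le_of_near (hsub hτ) ?_
      refine near_of_norm_le_two ?_
      rw [Metric.mem_ball, dist_comm, dist_eq_norm] at hy
      linarith
    · exact Eventually.of_forall fun τ hτ y _ => hgv τ (hsub hτ) y
  have hE : HasFDerivAt (fun y => ∫ τ in (0 : ℝ)..t, v τ y)
      ((gradForm fun j => g j t x) - gradForm fun j => g j 0 x) x := by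
    have : (fun y => ∫ τ in (0 : ℝ)..t, v τ y) = fun y => u t y - u 0 y :=
      funext fun y => hu.integral_eq hl hv ht y
    rw [this]
    exact (hg t ht x).sub (hg 0 ⟨le_rfl, hT⟩ x)
  have := congrArg (fun L : Spc n →L[ℝ] ℝ => L (EuclideanSpace.single i 1)) (hD.unique hE)
  simp only [sub_apply, gradForm_single] at this
  rw [ContinuousLinearMap.intervalIntegral_apply hgint] at this
  simp only [gradForm_single] at this
  linarith

lemma SpaceBd.pd {M : ℕ} (h : SpaceBd T lam (M + 1) a A u) (i : Fin n) :
    SpaceBd T lam M (a + 1) A (fun t => pd i (u t)) := by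
  obtain ⟨-, g, hg, hb⟩ := h
  exact (hb i).congr fun t ht x => (hg.pd_eq ht x i).symm

lemma SpaceBd.isGrad_pd {M : ℕ} (h : SpaceBd T lam (M + 1) a A u) :
    IsGrad T u (fun i t => NSdeRham.pd i (u t)) := by
  obtain ⟨-, g, hg, -⟩ := h
  intro t ht x
  simp only [hg.pd_eq ht x]
  exact hg t ht x

lemma ParBd.pd (hT : 0 ≤ T) (hl : 0 < lam) {s k : ℕ} (h : ParBd T lam s (k + 1) a A u)
    (i : Fin n) : ParBd T lam s k (a + 1) A (fun t => pd i (u t)) := by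
  induction s generalizing u with
  | zero => exact SpaceBd.pd h i
  | succ s ih =>
    obtain ⟨h0, v, hv, hb⟩ := h
    have hs : SpaceBd T lam (2 * s + k + 1) a A v := hb.spaceBd
    refine ⟨SpaceBd.pd (by exact h0) i, fun t => NSdeRham.pd i (v t), ?_, ih hb⟩
    exact hv.grad hT hl (SpaceBd.isGrad_pd (M := 2 * (s + 1) + k) h0) hs.isGrad_pd hs.holderBd
      (fun j => (hs.pd j).holderBd) i

end commute

/-- The class of kernels spanned by polynomials times a Gaussian. -/
inductive IsK (μ : ℝ) : (Spc n → ℝ) → Prop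
  | gauss : IsK μ fun z => Real.exp (-‖z‖ ^ 2 / (4 * μ))
  | smul (c : ℝ) {K : Spc n → ℝ} (h : IsK μ K) : IsK μ fun z => c * K z
  | add {K L : Spc n → ℝ} (hK : IsK μ K) (hL : IsK μ L) : IsK μ fun z => K z + L z
  | coord (i : Fin n) {K : Spc n → ℝ} (h : IsK μ K) : IsK μ fun z => z i * K z

section kernels

variable {μ : ℝ} {K : Spc n → ℝ}

lemma IsK.sum {ι : Type*} {s : Finset ι} (hs : s.Nonempty) {K : ι → Spc n → ℝ}
    (h : ∀ i ∈ s, IsK μ (K i)) : IsK μ fun z => ∑ i ∈ s, K i z := by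
  induction hs using Finset.Nonempty.cons_induction with
  | singleton i => simpa using h i (by simp)
  | cons i s hi hs ih =>
    simp only [Finset.sum_cons]
    exact (h i (by simp)).add (ih fun j hj => h j (by simp [hj]))

lemma hasFDerivAt_norm_sq_gradForm (z : Spc n) :
    HasFDerivAt (fun z : Spc n => ‖z‖ ^ 2) (gradForm fun i => 2 * z i) z := by
  have h := (hasStrictFDerivAt_norm_sq z).hasFDerivAt
  refine h.congr_fderiv ?_
  ext v
  simp [gradForm_apply, PiLp.inner_apply, Finset.mul_sum, mul_assoc, mul_comm]

lemma hasFDerivAt_gauss (μ : ℝ) (z : Spc n) :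
    HasFDerivAt (fun z : Spc n => Real.exp (-‖z‖ ^ 2 / (4 * μ)))
      (gradForm fun i => -(2 * μ)⁻¹ * (z i * Real.exp (-‖z‖ ^ 2 / (4 * μ)))) z := by
  have h := (((hasFDerivAt_norm_sq_gradForm z).neg).mul_const ((4 * μ)⁻¹)).exp
  simp only [← div_eq_mul_inv] at h
  refine h.congr_fderiv ?_
  ext v
  simp only [gradForm_apply, smul_apply, neg_apply, smul_eq_mul, Pi.neg_apply,
    Finset.mul_sum, ← Finset.sum_neg_distrib]
  refine Finset.sum_congr rfl fun i _ => ?_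
  rw [mul_inv, mul_inv]
  ring

lemma hasFDerivAt_coord (i : Fin n) (z : Spc n) :
    HasFDerivAt (fun z : Spc n => z i) (gradForm fun j => if j = i then 1 else 0) z := by
  have h := (EuclideanSpace.proj i : Spc n →L[ℝ] ℝ).hasFDerivAt (x := z)
  refine h.congr_fderiv ?_
  ext v
  simp [gradForm_apply]

lemma IsK.zero : IsK μ (fun _ : Spc n => (0 : ℝ)) := by
  simpa using (IsK.gauss (μ := μ) (n := n)).smul 0

lemma IsK.exists_grad (h : IsK μ K) : ∃ K' : Fin n → Spc n → ℝ, (∀ i, IsK μ (K' i)) ∧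
    ∀ z, HasFDerivAt K (gradForm fun i => K' i z) z := by
  induction h with
  | gauss =>
    exact ⟨fun i z => -(2 * μ)⁻¹ * (z i * Real.exp (-‖z‖ ^ 2 / (4 * μ))),
      fun i => (IsK.gauss.coord i).smul _, hasFDerivAt_gauss μ⟩
  | smul c h ih =>
    obtain ⟨K', h1, h2⟩ := ih
    refine ⟨fun i z => c * K' i z, fun i => (h1 i).smul c, fun z => ?_⟩
    rw [gradForm_smul]
    exact (h2 z).const_mul c
  | add hK hL ihK ihL =>
    obtain ⟨K', h1, h2⟩ := ihK
    obtain ⟨L', h3, h4⟩ := ihL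
    refine ⟨fun i z => K' i z + L' i z, fun i => (h1 i).add (h3 i), fun z => ?_⟩
    rw [gradForm_add]
    exact (h2 z).add (h4 z)
  | @coord i K h ih =>
    obtain ⟨K', h1, h2⟩ := ih
    refine ⟨fun j z => z i * K' j z + (if j = i then 1 else 0) * K z, fun j => ?_, fun z => ?_⟩
    · exact ((h1 j).coord i).add (h.smul _)
    · refine ((hasFDerivAt_coord i z).mul (h2 z)).congr_fderiv ?_
      ext v
      simp [gradForm_apply, add_mul, Finset.sum_add_distrib, Finset.mul_sum, mul_assoc]

lemma IsK.continuous (h : IsK μ K) : Continuous K := by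
  obtain ⟨K', -, h2⟩ := h.exists_grad
  exact continuous_iff_continuousAt.2 fun z => (h2 z).continuousAt

lemma IsK.decay (hμ : 0 < μ) (h : IsK μ K) (N : ℕ) :
    ∃ C : ℝ, 0 ≤ C ∧ ∀ z, |K z| * (1 + ‖z‖) ^ N ≤ C := by
  induction h generalizing N with
  | gauss =>
    refine ⟨N.factorial * Real.exp (1 + μ), by positivity, fun z => ?_⟩
    rw [abs_of_nonneg (Real.exp_pos _).le]
    have h1 : (1 + ‖z‖) ^ N ≤ N.factorial * Real.exp (1 + ‖z‖) := by
      have := Real.pow_div_factorial_le_exp (1 + ‖z‖) (by positivity) N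
      rwa [div_le_iff₀ (by positivity), mul_comm] at this
    have h2 : -‖z‖ ^ 2 / (4 * μ) + (1 + ‖z‖) ≤ 1 + μ := by
      have : -‖z‖ ^ 2 / (4 * μ) + ‖z‖ - μ = -(‖z‖ - 2 * μ) ^ 2 / (4 * μ) := by
        field_simp; ring
      have h3 : -(‖z‖ - 2 * μ) ^ 2 / (4 * μ) ≤ 0 :=
        div_nonpos_of_nonpos_of_nonneg (by nlinarith [sq_nonneg (‖z‖ - 2 * μ)]) (by positivity)
      linarith
    calc Real.exp (-‖z‖ ^ 2 / (4 * μ)) * (1 + ‖z‖) ^ N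
        ≤ Real.exp (-‖z‖ ^ 2 / (4 * μ)) * (N.factorial * Real.exp (1 + ‖z‖)) := by gcongr
      _ = N.factorial * Real.exp (-‖z‖ ^ 2 / (4 * μ) + (1 + ‖z‖)) := by
          rw [Real.exp_add (-‖z‖ ^ 2 / (4 * μ))]; ring
      _ ≤ _ := by gcongr
  | smul c h ih =>
    obtain ⟨C, hC, hb⟩ := ih N
    refine ⟨|c| * C, by positivity, fun z => ?_⟩
    rw [abs_mul, mul_assoc]
    exact mul_le_mul_of_nonneg_left (hb z) (abs_nonneg c)
  | @add K L hK hL ihK ihL =>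
    obtain ⟨C, hC, hb⟩ := ihK N
    obtain ⟨D, hD, hd⟩ := ihL N
    refine ⟨C + D, by positivity, fun z => ?_⟩
    have := mul_le_mul_of_nonneg_right (abs_add_le (K z) (L z)) (by positivity : 0 ≤ (1 + ‖z‖) ^ N)
    refine this.trans ?_
    rw [add_mul]
    exact add_le_add (hb z) (hd z)
  | @coord i K h ih =>
    obtain ⟨C, hC, hb⟩ := ih (N + 1)
    refine ⟨C, hC, fun z => le_trans ?_ (hb z)⟩
    rw [abs_mul, pow_succ]
    have h1 : |z i| ≤ 1 + ‖z‖ := by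
      have := PiLp.norm_apply_le z i
      rw [Real.norm_eq_abs] at this
      linarith
    have h2 : 0 ≤ |K z| * (1 + ‖z‖) ^ N := by positivity
    nlinarith

/-- The integrable majorant used for kernels. -/
def maj (z : Spc n) : ℝ := ((1 + ‖z‖) ^ (n + 1))⁻¹

lemma maj_pos (z : Spc n) : 0 < maj z := by unfold maj; positivity

lemma integrable_maj : Integrable (maj (n := n)) := by
  have h := integrable_one_add_norm (E := Spc n) (μ := volume) (r := (n : ℝ) + 1) (by simp)
  refine h.congr (Eventually.of_forall fun z => ?_)
  simp only [maj]
  rw [Real.rpow_neg (by positivity), ← Real.rpow_natCast]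
  push_cast; rfl

lemma maj_le_of_le {z w : Spc n} {c : ℝ} (h : 1 + ‖w‖ ≤ c * (1 + ‖z‖)) :
    maj z ≤ c ^ (n + 1) * maj w := by
  unfold maj
  rw [← div_eq_mul_inv, le_div_iff₀ (by positivity), inv_mul_le_iff₀ (by positivity),
    mul_comm, ← mul_pow]
  exact pow_le_pow_left₀ (by positivity) h _

lemma IsK.rpow_decay (hμ : 0 < μ) (h : IsK μ K) (p : ℝ) :
    ∃ C : ℝ, 0 ≤ C ∧ ∀ z, |K z| * (1 + ‖z‖) ^ p ≤ C * maj z := by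
  obtain ⟨N, hN⟩ := exists_nat_ge p
  obtain ⟨C, hC, hb⟩ := h.decay hμ (N + (n + 1))
  refine ⟨C, hC, fun z => ?_⟩
  unfold maj
  rw [← div_eq_mul_inv, le_div_iff₀ (by positivity)]
  refine le_trans ?_ (hb z)
  rw [pow_add _ N, ← mul_assoc, ← Real.rpow_natCast (1 + ‖z‖) N]
  gcongr
  have := norm_nonneg z
  linarith

lemma IsK.le_maj (hμ : 0 < μ) (h : IsK μ K) : ∃ C : ℝ, 0 ≤ C ∧ ∀ z, |K z| ≤ C * maj z := by
  obtain ⟨C, hC, hb⟩ := h.rpow_decay hμ 0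
  exact ⟨C, hC, by simpa using hb⟩

lemma IsK.integrable (hμ : 0 < μ) (h : IsK μ K) : Integrable K := by
  obtain ⟨C, hC, hb⟩ := h.le_maj hμ
  exact (integrable_maj.const_mul C).mono' h.continuous.aestronglyMeasurable
    (Eventually.of_forall hb)

/-- Convolution with the dilated kernel `ρ⁻ⁿ K(·/ρ)`. -/
def op (K : Spc n → ℝ) (ρ : ℝ) (g : Spc n → ℝ) (x : Spc n) : ℝ := ∫ z, K z * g (x - ρ • z)

lemma op_eq (K : Spc n → ℝ) {ρ : ℝ} (hρ : 0 < ρ) (g : Spc n → ℝ) (x : Spc n) :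
    op K ρ g x = (ρ ^ n)⁻¹ * ∫ y, K (ρ⁻¹ • (x - y)) * g y := by
  have h1 := integral_sub_left_eq_self (fun y => K (ρ⁻¹ • y) * g (x - y)) volume x
  simp only [sub_sub_cancel] at h1
  have h2 := Measure.integral_comp_smul (volume : Measure (Spc n))
    (fun y => K (ρ⁻¹ • y) * g (x - y)) ρ
  rw [← h1] at h2
  simp only [smul_smul, inv_mul_cancel₀ hρ.ne', one_smul] at h2
  rw [op, h2, finrank_euclideanSpace_fin, smul_eq_mul, abs_of_pos (by positivity)]

lemma op_integrable (hμ : 0 < μ) (h : IsK μ K) {g : Spc n → ℝ} (hg : Continuous g) {A : ℝ}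
    (hA : ∀ x, |g x| ≤ A) (ρ : ℝ) (x : Spc n) : Integrable fun z => K z * g (x - ρ • z) := by
  refine ((h.integrable hμ).norm.mul_const A).mono' ?_ (Eventually.of_forall fun z => ?_)
  · have := h.continuous
    exact (by fun_prop : Continuous fun z => K z * g (x - ρ • z)).aestronglyMeasurable
  · rw [norm_mul]
    exact mul_le_mul_of_nonneg_left (hA _) (norm_nonneg _)

lemma op_add (hμ : 0 < μ) {L : Spc n → ℝ} (h : IsK μ K) (hL : IsK μ L) {g : Spc n → ℝ}
    (hg : Continuous g) {A : ℝ} (hA : ∀ x, |g x| ≤ A) (ρ : ℝ) (x : Spc n) :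
    op (fun z => K z + L z) ρ g x = op K ρ g x + op L ρ g x := by
  unfold op
  rw [← integral_add (op_integrable hμ h hg hA ρ x) (op_integrable hμ hL hg hA ρ x)]
  simp only [add_mul]

lemma op_smul (c : ℝ) (g : Spc n → ℝ) (ρ : ℝ) (x : Spc n) :
    op (fun z => c * K z) ρ g x = c * op K ρ g x := by
  unfold op
  rw [← integral_const_mul]
  simp only [mul_assoc]

lemma op_one (K : Spc n → ℝ) (ρ : ℝ) (x : Spc n) : op K ρ (fun _ => 1) x = ∫ z, K z := by
  simp [op]

lemma integral_gradForm {X : Type*} [MeasurableSpace X] {ν : Measure X} {c : Fin n → X → ℝ}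
    (h : ∀ i, Integrable (c i) ν) :
    ∫ y, gradForm (fun i => c i y) ∂ν = gradForm fun i => ∫ y, c i y ∂ν := by
  unfold gradForm
  rw [integral_finsetSum _ fun i _ => (h i).smul_const _]
  exact Finset.sum_congr rfl fun i _ => integral_smul_const _ _

/-- Differentiation of the convolution in the space variable falls on the kernel. -/
lemma op_hasFDerivAt (hμ : 0 < μ) (h : IsK μ K) {K' : Fin n → Spc n → ℝ}
    (hK' : ∀ i, IsK μ (K' i)) (hd : ∀ z, HasFDerivAt K (gradForm fun i => K' i z) z)
    {g : Spc n → ℝ} (hg : Continuous g) {A : ℝ} (hA : ∀ x, |g x| ≤ A) {ρ : ℝ} (hρ : 0 < ρ)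
    (x : Spc n) : HasFDerivAt (op K ρ g) (gradForm fun i => ρ⁻¹ * op (K' i) ρ g x) x := by
  have hA0 : 0 ≤ A := (abs_nonneg _).trans (hA 0)
  choose C hC hCb using fun i => (hK' i).le_maj hμ
  have hcont := h.continuous
  have hcont' := fun i => (hK' i).continuous
  have hInt : ∀ {L : Spc n → ℝ}, IsK μ L → ∀ x, Integrable fun y => L (ρ⁻¹ • (x - y)) * g y := by
    intro L hL x
    have h0 := (hL.integrable hμ).comp_smul (R := ρ⁻¹) (inv_ne_zero hρ.ne')
    have h1 := h0.comp_sub_left x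
    refine (h1.norm.mul_const A).mono' ?_ (Eventually.of_forall fun z => ?_)
    · have := hL.continuous
      exact (by fun_prop : Continuous fun y => L (ρ⁻¹ • (x - y)) * g y).aestronglyMeasurable
    · rw [norm_mul]
      exact mul_le_mul_of_nonneg_left (hA _) (norm_nonneg _)
  have hmaj : Integrable fun y => maj (ρ⁻¹ • (x - y)) :=
    ((integrable_maj).comp_smul (R := ρ⁻¹) (inv_ne_zero hρ.ne')).comp_sub_left x
  have hgc : Continuous fun y => gradForm fun i => ρ⁻¹ * (K' i (ρ⁻¹ • (x - y)) * g y) := by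
    refine continuous_gradForm (c := fun i y => ρ⁻¹ * (K' i (ρ⁻¹ • (x - y)) * g y)) fun i => ?_
    have := hcont' i
    fun_prop
  have key := hasFDerivAt_integral_of_dominated_of_fderiv_le (𝕜 := ℝ) (μ := volume)
    (F := fun x y => K (ρ⁻¹ • (x - y)) * g y)
    (F' := fun x y => gradForm fun i => ρ⁻¹ * (K' i (ρ⁻¹ • (x - y)) * g y)) (x₀ := x)
    (bound := fun y => (∑ i, ρ⁻¹ * (C i * 2 ^ (n + 1) * A)) * maj (ρ⁻¹ • (x - y)))
    (Metric.ball_mem_nhds x hρ)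
    (Eventually.of_forall fun x =>
      (by fun_prop : Continuous fun y => K (ρ⁻¹ • (x - y)) * g y).aestronglyMeasurable)
    (hInt h x) hgc.aestronglyMeasurable ?_ (hmaj.const_mul _) ?_
  · have hfun : op K ρ g = fun x => (ρ ^ n)⁻¹ * ∫ y, K (ρ⁻¹ • (x - y)) * g y :=
      funext fun x => op_eq K hρ g x
    rw [hfun]
    refine (key.const_mul ((ρ ^ n)⁻¹)).congr_fderiv ?_
    rw [integral_gradForm fun i => (hInt (hK' i) x).const_mul ρ⁻¹, ← gradForm_smul]
    congr 1
    funext i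
    rw [integral_const_mul, op_eq (K' i) hρ g x]
    ring
  · refine Eventually.of_forall fun y x' hx' => (norm_gradForm_le _).trans ?_
    rw [Finset.sum_mul]
    refine Finset.sum_le_sum fun i _ => ?_
    rw [abs_mul, abs_mul, abs_of_pos (inv_pos.2 hρ), mul_assoc]
    refine mul_le_mul_of_nonneg_left ?_ (by positivity)
    have h1 := hCb i (ρ⁻¹ • (x' - y))
    have h2 : maj (ρ⁻¹ • (x' - y)) ≤ 2 ^ (n + 1) * maj (ρ⁻¹ • (x - y)) := by
      refine maj_le_of_le ?_
      have h3 : ‖ρ⁻¹ • (x - y)‖ ≤ ‖ρ⁻¹ • (x' - y)‖ + 1 := by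
        have h4 : ρ⁻¹ • (x - y) = ρ⁻¹ • (x' - y) - ρ⁻¹ • (x' - x) := by
          rw [← smul_sub]; congr 1; abel
        rw [h4]
        refine (norm_sub_le _ _).trans (add_le_add le_rfl ?_)
        rw [norm_smul, norm_inv, Real.norm_of_nonneg hρ.le, inv_mul_le_iff₀ hρ, mul_one]
        rw [Metric.mem_ball, dist_eq_norm] at hx'
        exact hx'.le
      linarith [norm_nonneg (ρ⁻¹ • (x' - y))]
    calc |K' i (ρ⁻¹ • (x' - y))| * |g y| ≤ (C i * (2 ^ (n + 1) * maj (ρ⁻¹ • (x - y)))) * A :=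
          mul_le_mul (h1.trans (mul_le_mul_of_nonneg_left h2 (hC i))) (hA y) (abs_nonneg _)
            (mul_nonneg (hC i) (mul_nonneg (by positivity) (maj_pos _).le))
      _ = _ := by ring
  · refine Eventually.of_forall fun y x' _ => ?_
    have h1 : HasFDerivAt (fun x' : Spc n => ρ⁻¹ • (x' - y))
        (ρ⁻¹ • ContinuousLinearMap.id ℝ (Spc n)) x' :=
      ((hasFDerivAt_id x').sub_const y).const_smul ρ⁻¹
    refine (((hd (ρ⁻¹ • (x' - y))).comp (g := K) x' h1).mul_const (g y)).congr_fderiv ?_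
    ext v
    simp [gradForm_apply, Finset.mul_sum]
    refine Finset.sum_congr rfl fun i _ => ?_
    ring

/-- The kernel produced by differentiating `op K ρ` in the scale `ρ`. -/
def scaleKer (K : Spc n → ℝ) (K' : Fin n → Spc n → ℝ) (z : Spc n) : ℝ :=
  -(n : ℝ) * K z + ∑ i, -1 * (z i * K' i z)

lemma IsK.scaleKer (h : IsK μ K) {K' : Fin n → Spc n → ℝ} (hK' : ∀ i, IsK μ (K' i)) :
    IsK μ (scaleKer K K') := by
  refine (h.smul _).add ?_
  rcases (Finset.univ : Finset (Fin n)).eq_empty_or_nonempty with he | he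
  · rw [he]; simpa using IsK.zero
  · exact IsK.sum he fun i _ => ((hK' i).coord i).smul _

/-- Differentiation of the convolution in the scale. -/
lemma op_hasDerivAt_scale (hμ : 0 < μ) (h : IsK μ K) {K' : Fin n → Spc n → ℝ}
    (hK' : ∀ i, IsK μ (K' i)) (hd : ∀ z, HasFDerivAt K (gradForm fun i => K' i z) z)
    {g : Spc n → ℝ} (hg : Continuous g) {A : ℝ} (hA : ∀ x, |g x| ≤ A) {ρ : ℝ} (hρ : 0 < ρ)
    (x : Spc n) :
    HasDerivAt (fun ρ => op K ρ g x) (ρ⁻¹ * op (scaleKer K K') ρ g x) ρ := by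
  have hA0 : 0 ≤ A := (abs_nonneg _).trans (hA 0)
  obtain ⟨C, hC, hCb⟩ := (h.scaleKer hK').le_maj hμ
  have hcont := h.continuous
  have hcont' := (h.scaleKer hK').continuous
  have hInt : ∀ {L : Spc n → ℝ}, IsK μ L → Integrable fun y => L (ρ⁻¹ • (x - y)) * g y := by
    intro L hL
    have h0 := (hL.integrable hμ).comp_smul (R := ρ⁻¹) (inv_ne_zero hρ.ne')
    have h1 := h0.comp_sub_left x
    refine (h1.norm.mul_const A).mono' ?_ (Eventually.of_forall fun z => ?_)
    · have := hL.continuous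
      exact (by fun_prop : Continuous fun y => L (ρ⁻¹ • (x - y)) * g y).aestronglyMeasurable
    · rw [norm_mul]
      exact mul_le_mul_of_nonneg_left (hA _) (norm_nonneg _)
  have hmaj : Integrable fun y => maj (ρ⁻¹ • (x - y)) :=
    ((integrable_maj).comp_smul (R := ρ⁻¹) (inv_ne_zero hρ.ne')).comp_sub_left x
  have key := hasDerivAt_integral_of_dominated_loc_of_deriv_le (𝕜 := ℝ) (μ := volume)
    (F := fun r y => (r ^ n)⁻¹ * (K (r⁻¹ • (x - y)) * g y))
    (F' := fun r y => (r ^ (n + 1))⁻¹ * (scaleKer K K' (r⁻¹ • (x - y)) * g y)) (x₀ := ρ)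
    (bound := fun y => (((ρ / 2) ^ (n + 1))⁻¹ * (C * 2 ^ (n + 1) * A)) * maj (ρ⁻¹ • (x - y)))
    (Metric.ball_mem_nhds ρ (half_pos hρ))
    (Eventually.of_forall fun r =>
      (by fun_prop : Continuous fun y => (r ^ n)⁻¹ * (K (r⁻¹ • (x - y)) * g y)).aestronglyMeasurable)
    ((hInt h).const_mul _)
    ((by fun_prop : Continuous fun y =>
      (ρ ^ (n + 1))⁻¹ * (scaleKer K K' (ρ⁻¹ • (x - y)) * g y)).aestronglyMeasurable)
    ?_ (hmaj.const_mul _) ?_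
  · have h1 := key.2
    have h2 : (fun r => op K r g x) =ᶠ[nhds ρ]
        fun r => ∫ y, (r ^ n)⁻¹ * (K (r⁻¹ • (x - y)) * g y) := by
      filter_upwards [lt_mem_nhds hρ] with r hr
      rw [op_eq K hr, integral_const_mul]
    refine (h1.congr_of_eventuallyEq h2).congr_deriv ?_
    rw [integral_const_mul, op_eq _ hρ, pow_succ, mul_inv]
    ring
  · refine Eventually.of_forall fun y r hr => ?_
    rw [Metric.mem_ball, Real.dist_eq, abs_lt] at hr
    have hr1 : ρ / 2 < r := by linarith
    have hr2 : r < 2 * ρ := by linarith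
    have hr0 : 0 < r := by linarith
    have h1 := hCb (r⁻¹ • (x - y))
    have h2 : maj (r⁻¹ • (x - y)) ≤ 2 ^ (n + 1) * maj (ρ⁻¹ • (x - y)) := by
      refine maj_le_of_le ?_
      rw [norm_smul, norm_smul, norm_inv, norm_inv, Real.norm_of_nonneg hρ.le,
        Real.norm_of_nonneg hr0.le]
      have h3 : ρ⁻¹ ≤ 2 * r⁻¹ := by
        rw [inv_le_iff_one_le_mul₀ hρ, ← div_eq_mul_inv, div_mul_eq_mul_div, le_div_iff₀ hr0]
        linarith
      nlinarith [mul_le_mul_of_nonneg_right h3 (norm_nonneg (x - y))]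
    have h3 : (r ^ (n + 1))⁻¹ ≤ ((ρ / 2) ^ (n + 1))⁻¹ := by gcongr
    rw [norm_mul, norm_mul, Real.norm_of_nonneg (by positivity : 0 ≤ (r ^ (n + 1))⁻¹), mul_assoc]
    refine mul_le_mul h3 ?_ (by positivity) (by positivity)
    calc |scaleKer K K' (r⁻¹ • (x - y))| * |g y|
        ≤ (C * (2 ^ (n + 1) * maj (ρ⁻¹ • (x - y)))) * A :=
          mul_le_mul (h1.trans (mul_le_mul_of_nonneg_left h2 hC)) (hA y) (abs_nonneg _)
            (mul_nonneg hC (mul_nonneg (by positivity) (maj_pos _).le))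
      _ = _ := by ring
  · refine Eventually.of_forall fun y r hr => ?_
    rw [Metric.mem_ball, Real.dist_eq, abs_lt] at hr
    have hr0 : 0 < r := by linarith
    have h1 : HasDerivAt (fun r : ℝ => r⁻¹ • (x - y)) ((-(r ^ 2)⁻¹) • (x - y)) r :=
      (hasDerivAt_inv hr0.ne').smul_const _
    have h2 : HasDerivAt (fun r : ℝ => K (r⁻¹ • (x - y))) _ r :=
      (hd (r⁻¹ • (x - y))).comp_hasDerivAt r h1
    have h3 : HasDerivAt (fun r : ℝ => (r ^ n)⁻¹) _ r := (hasDerivAt_pow n r).inv (by positivity)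
    have h4 := h3.mul (h2.mul_const (g y))
    refine h4.congr_deriv ?_
    simp only [scaleKer, gradForm_apply, PiLp.smul_apply, smul_eq_mul]
    have h5 : ((n : ℝ) * r ^ (n - 1)) = n * r ^ n * r⁻¹ := by
      cases n with
      | zero => simp
      | succ m => simp [pow_succ]; field_simp
    have h6 : ∑ i, K' i (r⁻¹ • (x - y)) * (-(r ^ 2)⁻¹ * (x - y) i) =
        r⁻¹ * ∑ i, -1 * (r⁻¹ * (x - y) i * K' i (r⁻¹ • (x - y))) := by
      rw [Finset.mul_sum]
      refine Finset.sum_congr rfl fun i _ => ?_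
      rw [pow_two, mul_inv]; ring
    rw [h5, h6]
    field_simp
    ring

/-- Differentiation of the convolution in the space variable falls on the function. -/
lemma op_hasFDerivAt_right (hμ : 0 < μ) (h : IsK μ K) {g : Spc n → ℝ} {g' : Fin n → Spc n → ℝ}
    (hg : Continuous g) {A B : ℝ} (hA : ∀ x, |g x| ≤ A) (hg' : ∀ i, Continuous (g' i))
    (hB : ∀ i x, |g' i x| ≤ B) (hd : ∀ x, HasFDerivAt g (gradForm fun i => g' i x) x) (ρ : ℝ)
    (x : Spc n) : HasFDerivAt (op K ρ g) (gradForm fun i => op K ρ (g' i) x) x := by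
  have hcont := h.continuous
  have hgc : Continuous fun z => gradForm fun i => K z * g' i (x - ρ • z) :=
    continuous_gradForm (c := fun i z => K z * g' i (x - ρ • z)) fun i => by
      have := hg' i
      fun_prop
  have key := hasFDerivAt_integral_of_dominated_of_fderiv_le (𝕜 := ℝ) (μ := volume)
    (F := fun x z => K z * g (x - ρ • z))
    (F' := fun x z => gradForm fun i => K z * g' i (x - ρ • z)) (x₀ := x)
    (bound := fun z => ∑ _i : Fin n, |K z| * B)
    (Metric.ball_mem_nhds x one_pos)
    (Eventually.of_forall fun x =>
      (by fun_prop : Continuous fun z => K z * g (x - ρ • z)).aestronglyMeasurable)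
    (op_integrable hμ h hg hA ρ x) hgc.aestronglyMeasurable ?_
    (integrable_finsetSum _ fun i _ => (h.integrable hμ).norm.mul_const _) ?_
  · rw [integral_gradForm fun i => op_integrable hμ h (hg' i) (hB i) ρ x] at key
    exact key
  · refine Eventually.of_forall fun y x' hx' => (norm_gradForm_le _).trans ?_
    refine Finset.sum_le_sum fun i _ => ?_
    rw [abs_mul]
    exact mul_le_mul_of_nonneg_left (hB i _) (abs_nonneg _)
  · refine Eventually.of_forall fun z x' _ => ?_
    rw [gradForm_smul]
    have h1 : HasFDerivAt (fun x' : Spc n => x' - ρ • z) (ContinuousLinearMap.id ℝ (Spc n)) x' :=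
      (hasFDerivAt_id x').sub_const _
    have h2 := (hd (x' - ρ • z)).comp (g := g) x' h1
    exact h2.const_mul (K z)

/-- Joint continuity of the convolution. -/
lemma op_continuous (hμ : 0 < μ) (h : IsK μ K) {X : Type*} [TopologicalSpace X]
    [FirstCountableTopology X] {g : X → Spc n → ℝ}
    (hg : Continuous fun p : X × Spc n => g p.1 p.2) {A : ℝ} (hA : ∀ p x, |g p x| ≤ A)
    {ρ : X → ℝ} (hρ : Continuous ρ) {y : X → Spc n} (hy : Continuous y) :
    Continuous fun p => op K (ρ p) (g p) (y p) := by
  have hcont := h.continuous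
  refine continuous_of_dominated (bound := fun z => |K z| * A) ?_ ?_ ?_ ?_
  · intro p
    have : Continuous fun x => g p x := hg.comp (Continuous.prodMk_right p)
    exact (by fun_prop : Continuous fun z => K z * g p (y p - ρ p • z)).aestronglyMeasurable
  · intro p
    refine Eventually.of_forall fun z => ?_
    rw [norm_mul]
    exact mul_le_mul_of_nonneg_left (hA _ _) (abs_nonneg _)
  · exact (h.integrable hμ).norm.mul_const A
  · refine Eventually.of_forall fun z => continuous_const.mul ?_
    exact hg.comp (by fun_prop : Continuous fun p => (p, y p - ρ p • z))

end kernels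

/-- Weighted sup bound and global weighted Hölder bound for a function of the space variable. -/
structure StatBd (lam a A : ℝ) (g : Spc n → ℝ) : Prop where
  cont : Continuous g
  sup : ∀ x, wt x ^ a * |g x| ≤ A
  hold : ∀ x y, wt x ^ (a + lam) * |g x - g y| ≤ A * ‖x - y‖ ^ lam * (1 + ‖x - y‖) ^ a

section estimates

variable {μ lam a A T : ℝ} {K : Spc n → ℝ}

lemma StatBd.abs_le {g : Spc n → ℝ} (ha : 0 ≤ a) (h : StatBd lam a A g) (x : Spc n) :
    |g x| ≤ A := by
  refine le_trans ?_ (h.sup x)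
  exact le_mul_of_one_le_left (abs_nonneg _) (Real.one_le_rpow (one_le_wt x) ha)

lemma StatBd.nonneg {g : Spc n → ℝ} (h : StatBd lam a A g) : 0 ≤ A :=
  le_trans (mul_nonneg (wt_rpow_pos 0 a).le (abs_nonneg _)) (h.sup 0)

lemma HolderBd.statBd {f : ℝ → Spc n → ℝ} (hT : 0 ≤ T) (ha : 0 ≤ a) (hl : 0 < lam)
    (h : HolderBd T lam a A f) {t : ℝ} (ht : t ∈ Set.Icc (0 : ℝ) T) :
    StatBd lam a (2 * 2 ^ (a + lam) * A) (f t) := by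
  have hA := h.nonneg hT
  have h2 : (1 : ℝ) ≤ 2 ^ (a + lam) := Real.one_le_rpow (by norm_num) (by linarith)
  have hC : A ≤ 2 * 2 ^ (a + lam) * A := by nlinarith
  have hsup := h.sup t ht
  simp only [Real.norm_eq_abs] at hsup
  refine ⟨?_, fun x => (hsup x).trans hC, fun x y => ?_⟩
  · exact (h.continuousOn hl).comp_continuous (f := fun x => (t, x)) (by fun_prop)
      fun x => ⟨ht, trivial⟩
  · by_cases hn : Near x y
    · have h1 := h.space t ht x y hn
      rw [Real.norm_eq_abs] at h1
      have h3 : (1 : ℝ) ≤ (1 + ‖x - y‖) ^ a :=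
        Real.one_le_rpow (by linarith [norm_nonneg (x - y)]) ha
      have h4 : 0 ≤ ‖x - y‖ ^ lam := by positivity
      calc _ ≤ A * ‖x - y‖ ^ lam := h1
        _ ≤ 2 * 2 ^ (a + lam) * A * ‖x - y‖ ^ lam := by gcongr
        _ ≤ _ := le_mul_of_one_le_right (by positivity) h3
    · unfold Near at hn
      push Not at hn
      set d := ‖x - y‖ with hd
      have hd0 : 0 < d := by linarith [norm_nonneg x]
      have hw : wt x ≤ 2 * d := by linarith [wt_le_one_add x]
      have h3 : wt x ^ (a + lam) * |f t x| ≤ 2 ^ (a + lam) * A * d ^ lam * (1 + d) ^ a := by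
        have h4 : wt x ^ lam ≤ 2 ^ lam * d ^ lam := by
          rw [← Real.mul_rpow (by norm_num) hd0.le]
          exact Real.rpow_le_rpow (wt_pos x).le hw hl.le
        have h5 : (2 : ℝ) ^ lam ≤ 2 ^ (a + lam) :=
          Real.rpow_le_rpow_of_exponent_le (by norm_num) (by linarith)
        have h6 : (1 : ℝ) ≤ (1 + d) ^ a := Real.one_le_rpow (by linarith) ha
        rw [Real.rpow_add (wt_pos x)]
        calc wt x ^ a * wt x ^ lam * |f t x| = wt x ^ lam * (wt x ^ a * |f t x|) := by ring
          _ ≤ (2 ^ (a + lam) * d ^ lam) * A := by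
            refine mul_le_mul (h4.trans (by gcongr)) (hsup x)
              (mul_nonneg (wt_rpow_pos x a).le (abs_nonneg _)) (by positivity)
          _ = 2 ^ (a + lam) * A * d ^ lam := by ring
          _ ≤ _ := le_mul_of_one_le_right (by positivity) h6
      have h4 : wt x ^ (a + lam) * |f t y| ≤ 2 ^ (a + lam) * A * d ^ lam * (1 + d) ^ a := by
        have h5 : |f t y| ≤ A := le_trans
          (le_mul_of_one_le_left (abs_nonneg _) (Real.one_le_rpow (one_le_wt y) ha)) (hsup y)
        have h6 : wt x ^ (a + lam) ≤ 2 ^ (a + lam) * (d ^ lam * (1 + d) ^ a) := by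
          calc wt x ^ (a + lam) ≤ (2 * d) ^ (a + lam) :=
                Real.rpow_le_rpow (wt_pos x).le hw (by linarith)
            _ = 2 ^ (a + lam) * (d ^ lam * d ^ a) := by
                rw [Real.mul_rpow (by norm_num) hd0.le, Real.rpow_add hd0]; ring
            _ ≤ _ := by gcongr; linarith
        calc _ ≤ 2 ^ (a + lam) * (d ^ lam * (1 + d) ^ a) * A :=
              mul_le_mul h6 h5 (abs_nonneg _) (by positivity)
          _ = _ := by ring
      have h5 := mul_le_mul_of_nonneg_left (abs_sub (f t x) (f t y))
        (wt_rpow_pos x (a + lam)).le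
      linarith

lemma wt_le_mul (x y : Spc n) : wt x ≤ 2 * wt y * (1 + ‖x - y‖) := by
  have h1 := wt_le_one_add x
  have h2 := norm_le_wt y
  have h3 := one_le_wt y
  have h4 : ‖x‖ ≤ ‖x - y‖ + ‖y‖ := by simpa using norm_add_le (x - y) y
  nlinarith [norm_nonneg (x - y)]

lemma one_add_smul_le {R ρ : ℝ} (hρ : 0 ≤ ρ) (hR : ρ ≤ R) (z : Spc n) :
    1 + ‖ρ • z‖ ≤ (1 + R) * (1 + ‖z‖) := by
  rw [norm_smul, Real.norm_of_nonneg hρ]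
  nlinarith [norm_nonneg z, mul_le_mul_of_nonneg_right hR (norm_nonneg z)]

lemma op_sup_bound (hμ : 0 < μ) (h : IsK μ K) (ha : 0 ≤ a) {R : ℝ} (hR : 0 ≤ R) :
    ∃ C : ℝ, 0 ≤ C ∧ ∀ (g : Spc n → ℝ) (A : ℝ), StatBd lam a A g → ∀ ρ, 0 ≤ ρ → ρ ≤ R → ∀ x,
      wt x ^ a * |op K ρ g x| ≤ C * A := by
  obtain ⟨C, hC, hb⟩ := h.rpow_decay hμ a
  refine ⟨2 ^ a * (1 + R) ^ a * C * ∫ z : Spc n, maj z, ?_, ?_⟩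
  · exact mul_nonneg (by positivity) (integral_nonneg fun z => (maj_pos z).le)
  intro g A hg ρ hρ hρR x
  have hA := hg.nonneg
  have key : ‖∫ z, wt x ^ a * (K z * g (x - ρ • z))‖ ≤
      ∫ z : Spc n, (2 ^ a * (1 + R) ^ a * C * A) * maj z := by
    refine norm_integral_le_of_norm_le (integrable_maj.const_mul _) (Eventually.of_forall ?_)
    intro z
    have h1 : wt x ^ a ≤ 2 ^ a * wt (x - ρ • z) ^ a * ((1 + R) ^ a * (1 + ‖z‖) ^ a) := by
      rw [← Real.mul_rpow (by norm_num) (wt_pos _).le, ← Real.mul_rpow (by positivity)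
        (by positivity), ← Real.mul_rpow (by have := wt_pos (x - ρ • z); positivity) (by positivity)]
      refine Real.rpow_le_rpow (wt_pos x).le ?_ ha
      have h2 := wt_le_mul x (x - ρ • z)
      rw [sub_sub_cancel] at h2
      refine h2.trans (mul_le_mul_of_nonneg_left (one_add_smul_le hρ hρR z) ?_)
      have := wt_pos (x - ρ • z); positivity
    have h2 := hg.sup (x - ρ • z)
    rw [norm_mul, norm_mul, Real.norm_of_nonneg (wt_rpow_pos x a).le, Real.norm_eq_abs,
      Real.norm_eq_abs]
    calc wt x ^ a * (|K z| * |g (x - ρ • z)|)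
        ≤ (2 ^ a * wt (x - ρ • z) ^ a * ((1 + R) ^ a * (1 + ‖z‖) ^ a)) *
          (|K z| * |g (x - ρ • z)|) := by gcongr
      _ = 2 ^ a * (1 + R) ^ a * (|K z| * (1 + ‖z‖) ^ a) *
          (wt (x - ρ • z) ^ a * |g (x - ρ • z)|) := by ring
      _ ≤ 2 ^ a * (1 + R) ^ a * (C * maj z) * A := by
          refine mul_le_mul (mul_le_mul_of_nonneg_left (hb z) (by positivity)) h2
            (mul_nonneg (wt_rpow_pos _ a).le (abs_nonneg _)) ?_
          exact mul_nonneg (by positivity) (mul_nonneg hC (maj_pos z).le)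
      _ = _ := by ring
  rw [integral_const_mul, integral_const_mul, norm_mul,
    Real.norm_of_nonneg (wt_rpow_pos x a).le] at key
  calc _ ≤ _ := key
    _ = _ := by ring

lemma op_zero_mean_bound (hμ : 0 < μ) (h : IsK μ K) (h0 : ∫ z, K z = 0) (ha : 0 ≤ a)
    (hl : 0 < lam) {R : ℝ} (hR : 0 ≤ R) :
    ∃ C : ℝ, 0 ≤ C ∧ ∀ (g : Spc n → ℝ) (A : ℝ), StatBd lam a A g → ∀ ρ, 0 ≤ ρ → ρ ≤ R → ∀ x,
      wt x ^ (a + lam) * |op K ρ g x| ≤ C * A * ρ ^ lam := by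
  obtain ⟨C, hC, hb⟩ := h.rpow_decay hμ (a + lam)
  refine ⟨(1 + R) ^ a * C * ∫ z : Spc n, maj z, ?_, ?_⟩
  · exact mul_nonneg (by positivity) (integral_nonneg fun z => (maj_pos z).le)
  intro g A hg ρ hρ hρR x
  have hA := hg.nonneg
  have hop : op K ρ g x = ∫ z, K z * (g (x - ρ • z) - g x) := by
    simp only [mul_sub]
    rw [integral_sub (op_integrable hμ h hg.cont (hg.abs_le ha) ρ x)
      ((h.integrable hμ).mul_const _), integral_mul_const, h0, zero_mul, sub_zero, op]
  have key : ‖∫ z, wt x ^ (a + lam) * (K z * (g (x - ρ • z) - g x))‖ ≤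
      ∫ z : Spc n, ((1 + R) ^ a * C * A * ρ ^ lam) * maj z := by
    refine norm_integral_le_of_norm_le (integrable_maj.const_mul _) (Eventually.of_forall ?_)
    intro z
    have h1 := hg.hold x (x - ρ • z)
    rw [sub_sub_cancel] at h1
    have h2 : ‖ρ • z‖ ^ lam ≤ ρ ^ lam * (1 + ‖z‖) ^ lam := by
      rw [norm_smul, Real.norm_of_nonneg hρ, Real.mul_rpow hρ (norm_nonneg z)]
      gcongr
      linarith
    have h3 : (1 + ‖ρ • z‖) ^ a ≤ (1 + R) ^ a * (1 + ‖z‖) ^ a := by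
      rw [← Real.mul_rpow (by positivity) (by positivity)]
      exact Real.rpow_le_rpow (by positivity) (one_add_smul_le hρ hρR z) ha
    rw [norm_mul, norm_mul, Real.norm_of_nonneg (wt_rpow_pos x _).le, Real.norm_eq_abs,
      Real.norm_eq_abs, abs_sub_comm (g _)]
    calc wt x ^ (a + lam) * (|K z| * |g x - g (x - ρ • z)|)
        = |K z| * (wt x ^ (a + lam) * |g x - g (x - ρ • z)|) := by ring
      _ ≤ |K z| * (A * (ρ ^ lam * (1 + ‖z‖) ^ lam) * ((1 + R) ^ a * (1 + ‖z‖) ^ a)) := by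
          refine mul_le_mul_of_nonneg_left (h1.trans ?_) (abs_nonneg _)
          gcongr
      _ = (1 + R) ^ a * A * ρ ^ lam * (|K z| * (1 + ‖z‖) ^ (a + lam)) := by
          rw [Real.rpow_add (by positivity)]; ring
      _ ≤ (1 + R) ^ a * A * ρ ^ lam * (C * maj z) :=
          mul_le_mul_of_nonneg_left (hb z) (by positivity)
      _ = _ := by ring
  rw [integral_const_mul, integral_const_mul, norm_mul, ← hop,
    Real.norm_of_nonneg (wt_rpow_pos x _).le] at key
  calc _ ≤ _ := key
    _ = _ := by ring

lemma IsK.integral_grad_eq_zero (hμ : 0 < μ) (h : IsK μ K) {K' : Fin n → Spc n → ℝ}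
    (hK' : ∀ i, IsK μ (K' i)) (hd : ∀ z, HasFDerivAt K (gradForm fun i => K' i z) z)
    (i : Fin n) : ∫ z, K' i z = 0 := by
  have h1 := op_hasFDerivAt hμ h hK' hd (g := fun _ => 1) continuous_const (A := 1) (by simp)
    one_pos 0
  have h2 : HasFDerivAt (op K 1 fun _ => 1) (0 : Spc n →L[ℝ] ℝ) 0 := by
    have : (op K 1 fun _ => 1) = fun _ => ∫ z, K z := funext fun x => op_one K 1 x
    rw [this]; exact hasFDerivAt_const _ _
  have h3 := congrArg (fun L : Spc n →L[ℝ] ℝ => L (EuclideanSpace.single i 1)) (h1.unique h2)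
  simpa [gradForm_single, op_one] using h3

lemma IsK.integral_scaleKer_eq_zero (hμ : 0 < μ) (h : IsK μ K) {K' : Fin n → Spc n → ℝ}
    (hK' : ∀ i, IsK μ (K' i)) (hd : ∀ z, HasFDerivAt K (gradForm fun i => K' i z) z) :
    ∫ z, NSdeRham.scaleKer K K' z = 0 := by
  have h1 := op_hasDerivAt_scale hμ h hK' hd (g := fun _ => 1) continuous_const (A := 1) (by simp)
    one_pos 0
  simp only [op_one] at h1
  have h3 := h1.unique (hasDerivAt_const _ _)
  simpa using h3

end estimates

section singular

variable {κ D T : ℝ}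

lemma sing_intervalIntegrable (hκ : 0 < κ) {F : ℝ → ℝ} {t : ℝ} (ht : 0 ≤ t)
    (hF : ContinuousOn F (Set.Ioo 0 t)) (hb : ∀ r ∈ Set.Ioo 0 t, |F r| ≤ D * r ^ (κ - 1)) :
    IntervalIntegrable F volume 0 t := by
  rw [intervalIntegrable_iff_integrableOn_Ioo_of_le ht]
  have h1 : IntegrableOn (fun r : ℝ => D * r ^ (κ - 1)) (Set.Ioo 0 t) := by
    rw [← intervalIntegrable_iff_integrableOn_Ioo_of_le ht]
    exact (intervalIntegral.intervalIntegrable_rpow' (by linarith)).const_mul D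
  exact h1.mono' (hF.aestronglyMeasurable measurableSet_Ioo)
    ((ae_restrict_iff' measurableSet_Ioo).2 (Eventually.of_forall hb))

lemma abs_integral_le_of_le {F : ℝ → ℝ} {b t : ℝ} (hbt : b ≤ t) {g : ℝ → ℝ}
    (hg : IntervalIntegrable g volume b t) (hb : ∀ r ∈ Set.Ioo b t, |F r| ≤ g r) :
    |∫ r in b..t, F r| ≤ ∫ r in b..t, g r := by
  rw [← Real.norm_eq_abs]
  refine intervalIntegral.norm_integral_le_of_norm_le (E := ℝ) (f := F) hbt ?_ hg
  have : ∀ᵐ r : ℝ, r ≠ t := by simp [ae_iff]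
  filter_upwards [this] with r hr hmem
  exact hb r ⟨hmem.1, lt_of_le_of_ne hmem.2 hr⟩

lemma integral_sing (hκ : 0 < κ) (t : ℝ) :
    ∫ r in (0 : ℝ)..t, D * r ^ (κ - 1) = D * (t ^ κ / κ) := by
  rw [intervalIntegral.integral_const_mul, integral_rpow (Or.inl (by linarith))]
  simp [Real.zero_rpow hκ.ne']

lemma sing_abs_integral_le (hκ : 0 < κ) {F : ℝ → ℝ} {t : ℝ} (ht : 0 ≤ t)
    (hb : ∀ r ∈ Set.Ioo 0 t, |F r| ≤ D * r ^ (κ - 1)) :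
    |∫ r in (0 : ℝ)..t, F r| ≤ D * (t ^ κ / κ) := by
  rw [← integral_sing hκ t]
  exact abs_integral_le_of_le ht
    ((intervalIntegral.intervalIntegrable_rpow' (by linarith)).const_mul D) hb

/-- Splitting a singular integral at the scale `H`. -/
lemma split_abs_integral_le {β H : ℝ} (hκ : 0 < κ) (hβ : κ < β) (hH : 0 < H) (hD : 0 ≤ D)
    {F : ℝ → ℝ} {t : ℝ} (ht : 0 ≤ t) (hF : IntervalIntegrable F volume 0 t)
    (hb : ∀ r ∈ Set.Ioo 0 t, |F r| ≤ D * r ^ (κ - 1))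
    (hb' : ∀ r ∈ Set.Ioo 0 t, |F r| ≤ D * H ^ β * r ^ (κ - 1 - β)) :
    |∫ r in (0 : ℝ)..t, F r| ≤ D * (κ⁻¹ + (β - κ)⁻¹) * H ^ κ := by
  have hβκ : 0 < β - κ := by linarith
  have hnn : 0 ≤ D * H ^ κ * (β - κ)⁻¹ := by positivity
  rcases le_total t H with htH | htH
  · refine (sing_abs_integral_le hκ ht hb).trans ?_
    have : t ^ κ / κ ≤ κ⁻¹ * H ^ κ := by
      rw [div_eq_inv_mul]; gcongr
    nlinarith [mul_le_mul_of_nonneg_left this hD]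
  · have h1 : IntervalIntegrable F volume 0 H := hF.mono_set (by
      rw [Set.uIcc_of_le hH.le, Set.uIcc_of_le ht]; exact Set.Icc_subset_Icc le_rfl htH)
    have h2 : IntervalIntegrable F volume H t := hF.mono_set (by
      rw [Set.uIcc_of_le htH, Set.uIcc_of_le ht]; exact Set.Icc_subset_Icc hH.le le_rfl)
    rw [← intervalIntegral.integral_add_adjacent_intervals h1 h2]
    have h3 := sing_abs_integral_le hκ hH.le fun r hr => hb r ⟨hr.1, hr.2.trans_le htH⟩
    have h0 : (0 : ℝ) ∉ Set.uIcc H t := by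
      rw [Set.uIcc_of_le htH]; exact fun h => absurd h.1 (not_le.2 hH)
    have h4 : |∫ r in H..t, F r| ≤ ∫ r in H..t, D * H ^ β * r ^ (κ - 1 - β) :=
      abs_integral_le_of_le htH
        ((intervalIntegral.intervalIntegrable_rpow (Or.inr h0)).const_mul _)
        fun r hr => hb' r ⟨hH.trans hr.1, hr.2⟩
    rw [intervalIntegral.integral_const_mul, integral_rpow (Or.inr ⟨by linarith, h0⟩)] at h4
    have h5 : (t ^ (κ - 1 - β + 1) - H ^ (κ - 1 - β + 1)) / (κ - 1 - β + 1) ≤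
        H ^ (κ - β) * (β - κ)⁻¹ := by
      rw [show κ - 1 - β + 1 = -(β - κ) by ring, div_neg, ← neg_div, div_eq_mul_inv,
        show κ - β = -(β - κ) by ring]
      gcongr
      have : 0 ≤ t ^ (-(β - κ)) := Real.rpow_nonneg ht _
      linarith
    have h6 : H ^ β * H ^ (κ - β) = H ^ κ := by rw [← Real.rpow_add hH]; ring_nf
    calc |(∫ r in (0 : ℝ)..H, F r) + ∫ r in H..t, F r|
        ≤ D * (H ^ κ / κ) + D * H ^ β * (H ^ (κ - β) * (β - κ)⁻¹) :=
          (abs_add_le _ _).trans (add_le_add h3 (h4.trans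
            (mul_le_mul_of_nonneg_left h5 (by positivity))))
      _ = D * (H ^ κ / κ) + D * (H ^ β * H ^ (κ - β)) * (β - κ)⁻¹ := by ring
      _ = _ := by rw [h6]; ring

/-- Duhamel integral of a family singular at `r = 0`. -/
def duh (G : ℝ → ℝ → ℝ) (t : ℝ) : ℝ := ∫ τ in (0 : ℝ)..t, G (t - τ) τ

lemma duh_eq (G : ℝ → ℝ → ℝ) (t : ℝ) : duh G t = ∫ r in (0 : ℝ)..t, G r (t - r) := by
  have := intervalIntegral.integral_comp_sub_left (a := 0) (b := t)
    (fun r => G r (t - r)) t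
  simp only [sub_sub_cancel, sub_self, sub_zero] at this
  exact this

/-- A family `G r τ` with an integrable singularity at `r = 0`. -/
structure SingBd (T κ D : ℝ) (G : ℝ → ℝ → ℝ) : Prop where
  cont : ContinuousOn (Function.uncurry G) (Set.Ioi 0 ×ˢ Set.univ)
  bd : ∀ r ∈ Set.Ioc 0 T, ∀ τ, |G r τ| ≤ D * r ^ (κ - 1)

lemma SingBd.nonneg {G : ℝ → ℝ → ℝ} (hT : 0 < T) (h : SingBd T κ D G) : 0 ≤ D := by
  have h1 := (abs_nonneg _).trans (h.bd T ⟨hT, le_rfl⟩ 0)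
  have h2 := Real.rpow_pos_of_pos hT (κ - 1)
  exact nonneg_of_mul_nonneg_left h1 h2

lemma SingBd.intervalIntegrable {G : ℝ → ℝ → ℝ} (hκ : 0 < κ) (h : SingBd T κ D G) {t : ℝ}
    (ht : t ∈ Set.Icc 0 T) (c : ℝ) :
    IntervalIntegrable (fun r => G r (c - r)) volume 0 t := by
  refine sing_intervalIntegrable hκ ht.1 ?_ fun r hr => h.bd r ⟨hr.1, hr.2.le.trans ht.2⟩ _
  exact h.cont.comp (f := fun r => (r, c - r)) (by fun_prop) fun r hr => ⟨hr.1, trivial⟩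

lemma SingBd.intervalIntegrable' {G : ℝ → ℝ → ℝ} (hκ : 0 < κ) (h : SingBd T κ D G) {t : ℝ}
    (ht : t ∈ Set.Icc 0 T) :
    IntervalIntegrable (fun τ => G (t - τ) τ) volume 0 t := by
  have := (h.intervalIntegrable hκ ht t).comp_sub_left t
  simpa using this.symm

lemma SingBd.abs_duh_le {G : ℝ → ℝ → ℝ} (hT : 0 < T) (hκ : 0 < κ) (h : SingBd T κ D G) {t : ℝ}
    (ht : t ∈ Set.Icc 0 T) : |duh G t| ≤ D * (T ^ κ / κ) := by
  rw [duh_eq]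
  refine (sing_abs_integral_le hκ ht.1 fun r hr => h.bd r ⟨hr.1, hr.2.le.trans ht.2⟩ _).trans ?_
  have := h.nonneg hT
  have h1 := ht.1
  have h2 := ht.2
  gcongr

lemma SingBd.duh_holder_aux {G G' : ℝ → ℝ → ℝ} (hT : 0 < T) (hκ : 0 < κ) (hκ1 : κ < 1)
    (h : SingBd T κ D G) (hd : ∀ r ∈ Set.Ioc 0 T, ∀ τ, HasDerivAt (fun r => G r τ) (G' r τ) r)
    (hb : ∀ r ∈ Set.Ioc 0 T, ∀ τ, |G' r τ| ≤ D * r ^ (κ - 2)) {t₁ t₂ : ℝ}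
    (h1 : 0 ≤ t₁) (h2 : t₁ < t₂) (h3 : t₂ ≤ T) :
    |duh G t₂ - duh G t₁| ≤ D * (κ⁻¹ + 2 * (κ⁻¹ + (1 - κ)⁻¹)) * (t₂ - t₁) ^ κ := by
  have hD := h.nonneg hT
  set δ := t₂ - t₁ with hδ
  have hδ0 : 0 < δ := by linarith
  have hi2 := h.intervalIntegrable' hκ (t := t₂) ⟨by linarith, h3⟩
  have hia : IntervalIntegrable (fun τ => G (t₂ - τ) τ) volume 0 t₁ := hi2.mono_set (by
    rw [Set.uIcc_of_le h1, Set.uIcc_of_le (by linarith)]; exact Set.Icc_subset_Icc le_rfl h2.le)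
  have hib : IntervalIntegrable (fun τ => G (t₂ - τ) τ) volume t₁ t₂ := hi2.mono_set (by
    rw [Set.uIcc_of_le h2.le, Set.uIcc_of_le (by linarith)]; exact Set.Icc_subset_Icc h1 le_rfl)
  have hi1 := h.intervalIntegrable' hκ (t := t₁) ⟨h1, by linarith⟩
  have e1 : ∫ τ in t₁..t₂, G (t₂ - τ) τ = ∫ r in (0 : ℝ)..δ, G r (t₂ - r) := by
    have := intervalIntegral.integral_comp_sub_left (a := t₁) (b := t₂)
      (fun r => G r (t₂ - r)) t₂
    simpa using this
  have e2 : ∫ τ in (0 : ℝ)..t₁, (G (t₂ - τ) τ - G (t₁ - τ) τ) =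
      ∫ r in (0 : ℝ)..t₁, (G (r + δ) (t₁ - r) - G r (t₁ - r)) := by
    have := intervalIntegral.integral_comp_sub_left (a := 0) (b := t₁)
      (fun r => G (r + δ) (t₁ - r) - G r (t₁ - r)) t₁
    simp only [sub_sub_cancel, sub_self, sub_zero] at this
    rw [← this]
    refine intervalIntegral.integral_congr fun τ _ => ?_
    simp only [hδ]
    ring_nf
  have e3 : duh G t₂ - duh G t₁ = (∫ r in (0 : ℝ)..δ, G r (t₂ - r)) +
      ∫ r in (0 : ℝ)..t₁, (G (r + δ) (t₁ - r) - G r (t₁ - r)) := by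
    rw [← e2, intervalIntegral.integral_sub hia hi1, ← e1, duh, duh,
      ← intervalIntegral.integral_add_adjacent_intervals hia hib]
    ring
  have b1 : |∫ r in (0 : ℝ)..δ, G r (t₂ - r)| ≤ D * (δ ^ κ / κ) :=
    sing_abs_integral_le hκ hδ0.le fun r hr => h.bd r ⟨hr.1, by linarith [hr.2]⟩ _
  have b2 : |∫ r in (0 : ℝ)..t₁, (G (r + δ) (t₁ - r) - G r (t₁ - r))| ≤
      (2 * D) * (κ⁻¹ + (1 - κ)⁻¹) * δ ^ κ := by
    refine split_abs_integral_le hκ hκ1 hδ0 (by positivity) h1 ?_ ?_ ?_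
    · have := hia.sub hi1
      have := this.comp_sub_left t₁
      simp only [sub_sub_cancel, sub_self, sub_zero] at this
      refine this.symm.congr fun r _ => ?_
      simp only [hδ]
      ring_nf
    · intro r hr
      have hr1 : r + δ ∈ Set.Ioc 0 T := ⟨by linarith [hr.1], by linarith [hr.2]⟩
      have h4 := h.bd (r + δ) hr1 (t₁ - r)
      have h5 := h.bd r ⟨hr.1, by linarith [hr.2]⟩ (t₁ - r)
      have h6 : (r + δ) ^ (κ - 1) ≤ r ^ (κ - 1) :=
        Real.rpow_le_rpow_of_nonpos hr.1 (by linarith) (by linarith)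
      have h7 := mul_le_mul_of_nonneg_left h6 hD
      have h8 := abs_sub (G (r + δ) (t₁ - r)) (G r (t₁ - r))
      linarith
    · intro r hr
      have hmem : ∀ ξ ∈ Set.Icc r (r + δ), ξ ∈ Set.Ioc 0 T := fun ξ hξ =>
        ⟨hr.1.trans_le hξ.1, hξ.2.trans (by linarith [hr.2])⟩
      have := Convex.norm_image_sub_le_of_norm_hasDerivWithin_le (𝕜 := ℝ)
        (f := fun ξ => G ξ (t₁ - r)) (s := Set.Icc r (r + δ)) (C := D * r ^ (κ - 2))
        (fun ξ hξ => (hd ξ (hmem ξ hξ) (t₁ - r)).hasDerivWithinAt)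
        (fun ξ hξ => (hb ξ (hmem ξ hξ) _).trans (mul_le_mul_of_nonneg_left
          (Real.rpow_le_rpow_of_nonpos hr.1 hξ.1 (by linarith)) hD)) (convex_Icc _ _)
        (Set.left_mem_Icc.2 (by linarith)) (Set.right_mem_Icc.2 (by linarith))
      rw [Real.norm_eq_abs, add_sub_cancel_left, Real.norm_of_nonneg hδ0.le] at this
      refine this.trans ?_
      have h0 : 0 ≤ r ^ (κ - 2) := Real.rpow_nonneg hr.1.le _
      rw [Real.rpow_one, show κ - 1 - 1 = κ - 2 by ring]
      nlinarith [mul_nonneg (mul_nonneg hD hδ0.le) h0]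
  rw [e3]
  refine (abs_add_le _ _).trans ((add_le_add b1 b2).trans (le_of_eq ?_))
  ring

lemma SingBd.duh_holder {G G' : ℝ → ℝ → ℝ} (hT : 0 < T) (hκ : 0 < κ) (hκ1 : κ < 1)
    (h : SingBd T κ D G) (hd : ∀ r ∈ Set.Ioc 0 T, ∀ τ, HasDerivAt (fun r => G r τ) (G' r τ) r)
    (hb : ∀ r ∈ Set.Ioc 0 T, ∀ τ, |G' r τ| ≤ D * r ^ (κ - 2)) {t₁ t₂ : ℝ}
    (h1 : t₁ ∈ Set.Icc 0 T) (h2 : t₂ ∈ Set.Icc 0 T) :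
    |duh G t₁ - duh G t₂| ≤ D * (κ⁻¹ + 2 * (κ⁻¹ + (1 - κ)⁻¹)) * |t₁ - t₂| ^ κ := by
  rcases lt_trichotomy t₁ t₂ with hlt | heq | hlt
  · rw [abs_sub_comm, abs_sub_comm t₁, abs_of_pos (sub_pos.2 hlt)]
    exact h.duh_holder_aux hT hκ hκ1 hd hb h1.1 hlt h2.2
  · simp [heq, Real.zero_rpow hκ.ne']
  · rw [abs_of_pos (sub_pos.2 hlt)]
    exact h.duh_holder_aux hT hκ hκ1 hd hb h2.1 hlt h1.2

/-- Interchange of the order of integration in an iterated Duhamel integral. -/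
lemma SingBd.integral_duh {G : ℝ → ℝ → ℝ} (hT : 0 < T) (hκ : 0 < κ) (h : SingBd T κ D G) {t : ℝ}
    (ht : t ∈ Set.Icc 0 T) :
    ∫ σ in (0 : ℝ)..t, duh G σ = ∫ τ in (0 : ℝ)..t, ∫ r in (0 : ℝ)..(t - τ), G r τ := by
  set Φ : ℝ → ℝ → ℝ := fun σ τ => if τ < σ then G (σ - τ) τ else 0 with hΦ
  set ν := volume.restrict (Set.Ioc (0 : ℝ) t) with hν
  have inner1 : ∀ σ ∈ Set.Ioc 0 t, ∀ H : ℝ → ℝ, IntegrableOn H (Set.Ioo 0 σ) →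
      Integrable (fun τ => if τ < σ then H τ else 0) ν ∧
      ∫ τ, (if τ < σ then H τ else 0) ∂ν = ∫ τ in (0 : ℝ)..σ, H τ := by
    intro σ hσ H hH
    have e : (fun τ => if τ < σ then H τ else 0) = (Set.Iio σ).indicator H := by
      ext τ; simp [Set.indicator]
    have e2 : Set.Iio σ ∩ Set.Ioc 0 t = Set.Ioo 0 σ := by
      ext τ; simp only [Set.mem_inter_iff, Set.mem_Iio, Set.mem_Ioc, Set.mem_Ioo]
      exact ⟨fun h => ⟨h.2.1, h.1⟩, fun h => ⟨h.2, h.1, h.2.le.trans hσ.2⟩⟩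
    constructor
    · rw [e, integrable_indicator_iff measurableSet_Iio, IntegrableOn, hν,
        Measure.restrict_restrict measurableSet_Iio, e2]
      exact hH
    · rw [e, integral_indicator measurableSet_Iio, hν,
        Measure.restrict_restrict measurableSet_Iio, e2, ← integral_Ioc_eq_integral_Ioo,
        intervalIntegral.integral_of_le hσ.1.le]
  have hG : ∀ σ ∈ Set.Ioc 0 t, IntegrableOn (fun τ => G (σ - τ) τ) (Set.Ioo 0 σ) := by
    intro σ hσ
    rw [← intervalIntegrable_iff_integrableOn_Ioo_of_le hσ.1.le]
    exact h.intervalIntegrable' hκ ⟨hσ.1.le, hσ.2.trans ht.2⟩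
  have hmeas : AEStronglyMeasurable (Function.uncurry Φ) (ν.prod ν) := by
    have e : Function.uncurry Φ =
        {p : ℝ × ℝ | p.2 < p.1}.indicator (fun p => G (p.1 - p.2) p.2) := by
      ext p; simp [Set.indicator, hΦ, Function.uncurry]
    have hm : MeasurableSet {p : ℝ × ℝ | p.2 < p.1} :=
      measurableSet_lt measurable_snd measurable_fst
    rw [e, aestronglyMeasurable_indicator_iff hm]
    refine ContinuousOn.aestronglyMeasurable ?_ hm
    exact h.cont.comp (f := fun p : ℝ × ℝ => (p.1 - p.2, p.2)) (by fun_prop)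
      fun p hp => ⟨by simpa using hp, trivial⟩
  have hInt : Integrable (Function.uncurry Φ) (ν.prod ν) := by
    rw [integrable_prod_iff hmeas]
    constructor
    · rw [hν, ae_restrict_iff' measurableSet_Ioc]
      exact Eventually.of_forall fun σ hσ => (inner1 σ hσ _ (hG σ hσ)).1
    · have hm2 := hmeas.norm.integral_prod_right'
      have : IsFiniteMeasure ν := by rw [hν]; infer_instance
      refine Integrable.of_bound hm2 (D * (T ^ κ / κ)) ?_
      rw [hν, ae_restrict_iff' measurableSet_Ioc]
      refine Eventually.of_forall fun σ hσ => ?_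
      have e3 : ∀ τ, ‖Function.uncurry Φ (σ, τ)‖ = if τ < σ then |G (σ - τ) τ| else 0 := by
        intro τ
        simp only [Function.uncurry, hΦ]
        split_ifs <;> simp
      simp only [e3]
      rw [← hν, (inner1 σ hσ (fun τ => |G (σ - τ) τ|) (hG σ hσ).norm).2]
      have hB : SingBd T κ D (fun r τ => |G r τ|) :=
        ⟨h.cont.norm, fun r hr τ => by simpa using h.bd r hr τ⟩
      simpa [duh] using hB.abs_duh_le hT hκ ⟨hσ.1.le, hσ.2.trans ht.2⟩
  have swap := integral_integral_swap hInt
  rw [intervalIntegral.integral_of_le ht.1, intervalIntegral.integral_of_le ht.1]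
  have eL : ∫ σ in Set.Ioc 0 t, duh G σ = ∫ σ in Set.Ioc 0 t, ∫ τ, Φ σ τ ∂ν := by
    refine setIntegral_congr_fun measurableSet_Ioc fun σ hσ => ?_
    exact (inner1 σ hσ _ (hG σ hσ)).2.symm
  rw [eL, swap]
  refine setIntegral_congr_fun measurableSet_Ioc fun τ hτ => ?_
  have e4 : (fun σ => Φ σ τ) = (Set.Ioi τ).indicator fun σ => G (σ - τ) τ := by
    ext σ; simp [Set.indicator, hΦ]
  have e5 : Set.Ioi τ ∩ Set.Ioc 0 t = Set.Ioc τ t := by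
    ext σ; simp only [Set.mem_inter_iff, Set.mem_Ioi, Set.mem_Ioc]
    exact ⟨fun h => ⟨h.1, h.2.2⟩, fun h => ⟨h.1, hτ.1.trans h.1, h.2⟩⟩
  rw [e4, integral_indicator measurableSet_Ioi, hν,
    Measure.restrict_restrict measurableSet_Ioi, e5, ← intervalIntegral.integral_of_le hτ.2]
  have := intervalIntegral.integral_comp_sub_right (a := τ) (b := t) (fun r => G r τ) τ
  rwa [sub_self] at this

end singular

/-- Scaled convolution with a kernel, for data extended in time by clamping to `[0,T]`. -/
def kerG (T : ℝ) (K : Spc n → ℝ) (m : ℕ) (f : ℝ → Spc n → ℝ) (x : Spc n) (r τ : ℝ) : ℝ :=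
  (Real.sqrt r ^ m)⁻¹ * op K (Real.sqrt r) (f (clampT T τ)) x

section potentials

variable {μ lam a A T : ℝ} {K : Spc n → ℝ} {f : ℝ → Spc n → ℝ}

lemma HolderBd.statBd_clamp (hT : 0 ≤ T) (ha : 0 ≤ a) (hl : 0 < lam) (h : HolderBd T lam a A f)
    (τ : ℝ) : StatBd lam a (2 * 2 ^ (a + lam) * A) (f (clampT T τ)) :=
  h.statBd hT ha hl (clampT_mem hT τ)

lemma kerG_continuousOn (hμ : 0 < μ) (h : IsK μ K) (hT : 0 ≤ T) (ha : 0 ≤ a) (hl : 0 < lam)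
    (hf : HolderBd T lam a A f) (m : ℕ) (x : Spc n) :
    ContinuousOn (Function.uncurry (kerG T K m f x)) (Set.Ioi 0 ×ˢ Set.univ) := by
  have h1 : Continuous fun p : ℝ × ℝ => op K (Real.sqrt p.1) (f (clampT T p.2)) x := by
    refine op_continuous hμ h (X := ℝ × ℝ) (g := fun p => f (clampT T p.2)) ?_
      (fun p y => (hf.statBd_clamp hT ha hl p.2).abs_le ha y) (by fun_prop) continuous_const
    exact (hf.continuous_clamp hT hl).comp
      (by fun_prop : Continuous fun p : (ℝ × ℝ) × Spc n => (p.1.2, p.2))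
  refine ContinuousOn.mul (ContinuousOn.inv₀ (by fun_prop) ?_) h1.continuousOn
  rintro ⟨r, τ⟩ ⟨hr, -⟩
  exact pow_ne_zero _ (Real.sqrt_pos.2 hr).ne'

lemma sqrt_pow_inv_mul {r : ℝ} (hr : 0 < r) (m : ℕ) :
    (Real.sqrt r ^ m)⁻¹ * Real.sqrt r ^ lam = r ^ (lam / 2 - m / 2) := by
  rw [Real.sqrt_eq_rpow, ← Real.rpow_natCast, ← Real.rpow_mul hr.le, ← Real.rpow_neg hr.le,
    ← Real.rpow_mul hr.le, ← Real.rpow_add hr]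
  ring_nf

/-- Bound for zero-mean kernels. -/
lemma kerG_zero_mean (hμ : 0 < μ) (h : IsK μ K) (h0 : ∫ z, K z = 0) (hT : 0 ≤ T) (ha : 0 ≤ a)
    (hl : 0 < lam) (m : ℕ) :
    ∃ C : ℝ, 0 ≤ C ∧ ∀ (f : ℝ → Spc n → ℝ) (A : ℝ), HolderBd T lam a A f →
      ∀ r ∈ Set.Ioc 0 T, ∀ τ x,
        wt x ^ (a + lam) * |kerG T K m f x r τ| ≤ C * A * r ^ (lam / 2 - m / 2) := by
  obtain ⟨C, hC, hb⟩ := op_zero_mean_bound (lam := lam) hμ h h0 ha hl (Real.sqrt_nonneg T)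
  refine ⟨C * (2 * 2 ^ (a + lam)), by positivity, fun f A hf r hr τ x => ?_⟩
  have h1 := hb _ _ (hf.statBd_clamp hT ha hl τ) (Real.sqrt r) (Real.sqrt_nonneg _)
    (Real.sqrt_le_sqrt hr.2) x
  have hp : 0 < (Real.sqrt r ^ m)⁻¹ := by have := Real.sqrt_pos.2 hr.1; positivity
  rw [kerG, abs_mul, abs_of_pos hp, ← sqrt_pow_inv_mul hr.1]
  have := mul_le_mul_of_nonneg_left h1 hp.le
  linarith

lemma rpow_le_of_le_T {p q r : ℝ} (hpq : p ≤ q) (hr : r ∈ Set.Ioc 0 T) :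
    r ^ q ≤ T ^ (q - p) * r ^ p := by
  have h1 : r ^ (q - p) ≤ T ^ (q - p) := Real.rpow_le_rpow hr.1.le hr.2 (by linarith)
  have h2 : r ^ q = r ^ (q - p) * r ^ p := by rw [← Real.rpow_add hr.1]; ring_nf
  rw [h2]
  exact mul_le_mul_of_nonneg_right h1 (Real.rpow_nonneg hr.1.le _)

lemma kerG_bound (hμ : 0 < μ) (h : IsK μ K) (hT : 0 < T) (ha : 0 ≤ a)
    (hl : 0 < lam) (hl1 : lam < 1) {m : ℕ} (hm : m ≤ 2) (h0 : m = 0 ∨ ∫ z, K z = 0) :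
    ∃ C : ℝ, 0 ≤ C ∧ ∀ (f : ℝ → Spc n → ℝ) (A : ℝ), HolderBd T lam a A f →
      ∀ r ∈ Set.Ioc 0 T, ∀ τ x, wt x ^ a * |kerG T K m f x r τ| ≤ C * A * r ^ (lam / 2 - 1) := by
  rcases h0 with rfl | h0
  · obtain ⟨C, hC, hb⟩ := op_sup_bound (lam := lam) hμ h ha (Real.sqrt_nonneg T)
    refine ⟨C * (2 * 2 ^ (a + lam)) * T ^ (1 - lam / 2), by positivity, fun f A hf r hr τ x => ?_⟩
    have h1 := hb _ _ (hf.statBd_clamp hT.le ha hl τ) (Real.sqrt r) (Real.sqrt_nonneg _)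
      (Real.sqrt_le_sqrt hr.2) x
    have hA := hf.nonneg hT.le
    have h2 := rpow_le_of_le_T (p := lam / 2 - 1) (q := 0) (by linarith) hr
    rw [Real.rpow_zero, show (0 : ℝ) - (lam / 2 - 1) = 1 - lam / 2 by ring] at h2
    have h3 : 0 ≤ C * (2 * 2 ^ (a + lam) * A) := by positivity
    have h4 := mul_le_mul_of_nonneg_left h2 h3
    simp only [kerG, pow_zero, inv_one, one_mul]
    linarith
  · obtain ⟨C, hC, hb⟩ := kerG_zero_mean (lam := lam) hμ h h0 hT.le ha hl m
    refine ⟨C * T ^ (1 - (m : ℝ) / 2), by positivity, fun f A hf r hr τ x => ?_⟩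
    have hA := hf.nonneg hT.le
    have hm' : (m : ℝ) ≤ 2 := by exact_mod_cast hm
    have h2 := rpow_le_of_le_T (p := lam / 2 - 1) (q := lam / 2 - m / 2) (by linarith) hr
    rw [show lam / 2 - (m : ℝ) / 2 - (lam / 2 - 1) = 1 - m / 2 by ring] at h2
    have h3 : wt x ^ a ≤ wt x ^ (a + lam) :=
      Real.rpow_le_rpow_of_exponent_le (one_le_wt x) (by linarith)
    calc wt x ^ a * |kerG T K m f x r τ| ≤ wt x ^ (a + lam) * |kerG T K m f x r τ| :=
          mul_le_mul_of_nonneg_right h3 (abs_nonneg _)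
      _ ≤ C * A * r ^ (lam / 2 - m / 2) := hb f A hf r hr τ x
      _ ≤ C * A * (T ^ (1 - (m : ℝ) / 2) * r ^ (lam / 2 - 1)) := by gcongr
      _ = _ := by ring

/-- The kernel of the derivative of `kerG T K m` in `r`. -/
def radKer (K : Spc n → ℝ) (K' : Fin n → Spc n → ℝ) (m : ℕ) (z : Spc n) : ℝ :=
  2⁻¹ * (scaleKer K K' z + -(m : ℝ) * K z)

lemma IsK.radKer (h : IsK μ K) {K' : Fin n → Spc n → ℝ} (hK' : ∀ i, IsK μ (K' i)) (m : ℕ) :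
    IsK μ (radKer K K' m) := ((h.scaleKer hK').add (h.smul _)).smul _

lemma IsK.integral_radKer (hμ : 0 < μ) (h : IsK μ K) {K' : Fin n → Spc n → ℝ}
    (hK' : ∀ i, IsK μ (K' i)) (hd : ∀ z, HasFDerivAt K (gradForm fun i => K' i z) z) {m : ℕ}
    (h0 : m = 0 ∨ ∫ z, K z = 0) : ∫ z, NSdeRham.radKer K K' m z = 0 := by
  simp only [NSdeRham.radKer]
  rw [integral_const_mul, integral_add ((h.scaleKer hK').integrable hμ)
    ((h.integrable hμ).const_mul _), integral_const_mul, h.integral_scaleKer_eq_zero hμ hK' hd]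
  rcases h0 with rfl | h0
  · simp
  · simp [h0]

lemma kerG_hasDerivAt (hμ : 0 < μ) (h : IsK μ K) {K' : Fin n → Spc n → ℝ}
    (hK' : ∀ i, IsK μ (K' i)) (hd : ∀ z, HasFDerivAt K (gradForm fun i => K' i z) z)
    (hT : 0 ≤ T) (ha : 0 ≤ a) (hl : 0 < lam) (hf : HolderBd T lam a A f) (m : ℕ) (x : Spc n)
    {r : ℝ} (hr : 0 < r) (τ : ℝ) :
    HasDerivAt (fun r => kerG T K m f x r τ) (kerG T (radKer K K' m) (m + 2) f x r τ) r := by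
  have hs := Real.sqrt_pos.2 hr
  have hst := hf.statBd_clamp hT ha hl τ
  have h1 := op_hasDerivAt_scale hμ h hK' hd hst.cont (hst.abs_le ha) hs x
  have h2 : HasDerivAt Real.sqrt (1 / (2 * Real.sqrt r)) r := Real.hasDerivAt_sqrt hr.ne'
  have h3 := h1.comp r h2
  have h4 := (h2.pow m).fun_inv (pow_ne_zero m hs.ne')
  have h5 := h4.mul h3
  refine h5.congr_deriv ?_
  have e : op (radKer K K' m) (Real.sqrt r) (f (clampT T τ)) x =
      2⁻¹ * (op (scaleKer K K') (Real.sqrt r) (f (clampT T τ)) x +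
        -(m : ℝ) * op K (Real.sqrt r) (f (clampT T τ)) x) := by
    rw [← op_smul (K := K), ← op_add hμ (h.scaleKer hK') (h.smul _) hst.cont (hst.abs_le ha),
      ← op_smul]
    rfl
  simp only [kerG, e, Function.comp]
  cases m with
  | zero => simp; field_simp
  | succ m =>
    simp only [Nat.add_sub_cancel, Pi.pow_apply, pow_succ]
    push_cast
    field_simp
    ring

lemma kerG_hasFDerivAt (hμ : 0 < μ) (h : IsK μ K) {K' : Fin n → Spc n → ℝ}
    (hK' : ∀ i, IsK μ (K' i)) (hd : ∀ z, HasFDerivAt K (gradForm fun i => K' i z) z)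
    (hT : 0 ≤ T) (ha : 0 ≤ a) (hl : 0 < lam) (hf : HolderBd T lam a A f) (m : ℕ) (x : Spc n)
    {r : ℝ} (hr : 0 < r) (τ : ℝ) :
    HasFDerivAt (fun x => kerG T K m f x r τ)
      (gradForm fun i => kerG T (K' i) (m + 1) f x r τ) x := by
  have hs := Real.sqrt_pos.2 hr
  have hst := hf.statBd_clamp hT ha hl τ
  have h1 := (op_hasFDerivAt hμ h hK' hd hst.cont (hst.abs_le ha) hs x).const_mul
    ((Real.sqrt r ^ m)⁻¹)
  refine h1.congr_fderiv ?_
  rw [← gradForm_smul]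
  simp only [kerG, pow_succ, mul_inv]
  congr 1
  ext i
  ring

/-- The potential with kernel `kerG T K m`. -/
def kerPot (T : ℝ) (K : Spc n → ℝ) (m : ℕ) (f : ℝ → Spc n → ℝ) (t : ℝ) (x : Spc n) : ℝ :=
  duh (kerG T K m f x) t

lemma kerG_singBd (hμ : 0 < μ) (h : IsK μ K) (hT : 0 < T) (ha : 0 ≤ a)
    (hl : 0 < lam) (hl1 : lam < 1) {m : ℕ} (hm : m ≤ 2) (h0 : m = 0 ∨ ∫ z, K z = 0) :
    ∃ C : ℝ, 0 ≤ C ∧ ∀ (f : ℝ → Spc n → ℝ) (A : ℝ), HolderBd T lam a A f →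
      ∀ x, SingBd T (lam / 2) (C * A * (wt x ^ a)⁻¹) (kerG T K m f x) := by
  obtain ⟨C, hC, hb⟩ := kerG_bound hμ h hT ha hl hl1 hm h0
  refine ⟨C, hC, fun f A hf x => ⟨kerG_continuousOn hμ h hT.le ha hl hf m x, fun r hr τ => ?_⟩⟩
  have h1 := hb f A hf r hr τ x
  have h2 := wt_rpow_pos x a
  rw [mul_right_comm, ← div_eq_mul_inv, le_div_iff₀ h2]
  linarith

lemma kerPot_bounds (hμ : 0 < μ) (h : IsK μ K) (hT : 0 < T) (ha : 0 ≤ a)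
    (hl : 0 < lam) (hl1 : lam < 1) {m : ℕ} (hm : m ≤ 2) (h0 : m = 0 ∨ ∫ z, K z = 0) :
    ∃ C : ℝ, 0 ≤ C ∧ ∀ (f : ℝ → Spc n → ℝ) (A : ℝ), HolderBd T lam a A f →
      (∀ t ∈ Set.Icc (0 : ℝ) T, ∀ x, wt x ^ a * ‖kerPot T K m f t x‖ ≤ C * A) ∧
      ∀ t₁ ∈ Set.Icc (0 : ℝ) T, ∀ t₂ ∈ Set.Icc (0 : ℝ) T, ∀ x,
        wt x ^ a * ‖kerPot T K m f t₁ x - kerPot T K m f t₂ x‖ ≤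
          C * A * |t₁ - t₂| ^ (lam / 2) := by
  obtain ⟨K', hK', hd⟩ := h.exists_grad
  obtain ⟨C, hC, hb⟩ := kerG_singBd hμ h hT ha hl hl1 hm h0
  obtain ⟨C', hC', hb'⟩ := kerG_zero_mean (lam := lam) hμ (h.radKer hK' m)
    (h.integral_radKer hμ hK' hd h0) hT.le ha hl (m + 2)
  set κ := lam / 2 with hκ
  have hκ0 : 0 < κ := by linarith
  have hκ1 : κ < 1 := by linarith
  set D := C + C' * T ^ (1 - (m : ℝ) / 2)
  have hD : 0 ≤ D := by positivity
  set E := κ⁻¹ + 2 * (κ⁻¹ + (1 - κ)⁻¹) with hE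
  have hκ2 : 0 < 1 - κ := by linarith
  have hE0 : 0 ≤ E := by positivity
  refine ⟨C * (T ^ κ / κ) + D * E, by positivity, fun f A hf => ⟨fun t ht x => ?_,
    fun t₁ h1 t₂ h2 x => ?_⟩⟩
  · have hA := hf.nonneg hT.le
    have h1 := (hb f A hf x).abs_duh_le hT hκ0 ht
    have h2 := wt_rpow_pos x a
    have h3 := mul_le_mul_of_nonneg_left h1 h2.le
    have h4 : wt x ^ a * (C * A * (wt x ^ a)⁻¹ * (T ^ κ / κ)) = C * (T ^ κ / κ) * A := by
      field_simp
    rw [h4] at h3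
    refine h3.trans ?_
    have : 0 ≤ D * E * A := by positivity
    linarith
  · have hA := hf.nonneg hT.le
    have h2w := wt_rpow_pos x a
    have hS : SingBd T κ (D * A * (wt x ^ a)⁻¹) (kerG T K m f x) := by
      refine ⟨(hb f A hf x).cont, fun r hr τ => ((hb f A hf x).bd r hr τ).trans ?_⟩
      have := Real.rpow_nonneg hr.1.le (κ - 1)
      gcongr
      have : 0 ≤ C' * T ^ (1 - (m : ℝ) / 2) := by positivity
      linarith
    have h3 := hS.duh_holder hT hκ0 hκ1
      (fun r hr τ => kerG_hasDerivAt hμ h hK' hd hT.le ha hl hf m x hr.1 τ) ?_ h1 h2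
    · have h4 := mul_le_mul_of_nonneg_left h3 h2w.le
      have h5 : wt x ^ a * (D * A * (wt x ^ a)⁻¹ * E * |t₁ - t₂| ^ κ) =
        D * E * A * |t₁ - t₂| ^ κ := by field_simp
      rw [← hE, h5] at h4
      refine h4.trans ?_
      gcongr
      have : 0 ≤ C * (T ^ κ / κ) := by positivity
      linarith
    · intro r hr τ
      have h4 := hb' f A hf r hr τ x
      have hm' : (m : ℝ) ≤ 2 := by exact_mod_cast hm
      have h5 := rpow_le_of_le_T (p := κ - 2) (q := κ - (m + 2 : ℕ) / 2)
        (by push_cast; linarith) hr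
      rw [show κ - ((m + 2 : ℕ) : ℝ) / 2 - (κ - 2) = 1 - m / 2 by push_cast; ring] at h5
      have h6 : wt x ^ a ≤ wt x ^ (a + lam) :=
        Real.rpow_le_rpow_of_exponent_le (one_le_wt x) (by linarith)
      have h7 := mul_le_mul_of_nonneg_right h6 (abs_nonneg (kerG T (NSdeRham.radKer K K' m) (m + 2) f x r τ))
      have h8 := mul_le_mul_of_nonneg_left h5 (mul_nonneg hC' hA)
      have h9 : 0 ≤ C * A * r ^ (κ - 2) :=
        mul_nonneg (mul_nonneg hC hA) (Real.rpow_nonneg hr.1.le _)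
      rw [mul_right_comm, ← div_eq_mul_inv, le_div_iff₀ h2w]
      calc _ = wt x ^ a * |kerG T (NSdeRham.radKer K K' m) (m + 2) f x r τ| := mul_comm _ _
        _ ≤ C' * A * (T ^ (1 - (m : ℝ) / 2) * r ^ (κ - 2)) := h7.trans (h4.trans h8)
        _ ≤ (C + C' * T ^ (1 - (m : ℝ) / 2)) * A * r ^ (κ - 2) := by linarith
        _ = _ := by ring

end potentials

section gradients

variable {μ lam a A T : ℝ} {K : Spc n → ℝ} {f : ℝ → Spc n → ℝ}

lemma integrable_gradForm {X : Type*} [MeasurableSpace X] {ν : Measure X} {c : Fin n → X → ℝ}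
    (h : ∀ i, Integrable (c i) ν) : Integrable (fun y => gradForm fun i => c i y) ν := by
  have h2 : Continuous fun p : Fin n → ℝ => gradForm p :=
    continuous_gradForm (c := fun i (p : Fin n → ℝ) => p i) fun i => continuous_apply i
  refine Integrable.mono' (g := fun y => ∑ i, |c i y|)
    (integrable_finsetSum Finset.univ fun i _ => (h i).norm) ?_
    (Eventually.of_forall fun y => norm_gradForm_le _)
  exact h2.comp_aestronglyMeasurable (f := fun y i => c i y)
    (aemeasurable_pi_iff.2 fun i => (h i).aestronglyMeasurable.aemeasurable).aestronglyMeasurable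

lemma kerPot_hasFDerivAt (hμ : 0 < μ) (h : IsK μ K) {K' : Fin n → Spc n → ℝ}
    (hK' : ∀ i, IsK μ (K' i)) (hd : ∀ z, HasFDerivAt K (gradForm fun i => K' i z) z)
    (hT : 0 < T) (ha : 0 ≤ a) (hl : 0 < lam) (hl1 : lam < 1) {m : ℕ} (hm : m + 1 ≤ 2)
    (h0 : m = 0 ∨ ∫ z, K z = 0) (hf : HolderBd T lam a A f) {t : ℝ} (ht : t ∈ Set.Icc (0 : ℝ) T)
    (x : Spc n) :
    HasFDerivAt (kerPot T K m f t) (gradForm fun i => kerPot T (K' i) (m + 1) f t x) x := by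
  have hA := hf.nonneg hT.le
  have hz : ∀ i, m + 1 = 0 ∨ ∫ z, K' i z = 0 := fun i =>
    Or.inr (h.integral_grad_eq_zero hμ hK' hd i)
  obtain ⟨C₀, hC₀, hb₀⟩ := kerG_singBd hμ h hT ha hl hl1 (by omega : m ≤ 2) h0
  choose C hC hb using fun i => kerG_bound hμ (hK' i) hT ha hl hl1 hm (hz i)
  choose C₁ hC₁ hb₁ using fun i => kerG_singBd hμ (hK' i) hT ha hl hl1 hm (hz i)
  have hκ : 0 < lam / 2 := by linarith
  have hInt : ∀ y, IntervalIntegrable (fun r => kerG T K m f y r (t - r)) volume 0 t := fun y =>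
    (hb₀ f A hf y).intervalIntegrable hκ ht t
  have hInt' : ∀ i y, IntervalIntegrable (fun r => kerG T (K' i) (m + 1) f y r (t - r))
      volume 0 t := fun i y => (hb₁ i f A hf y).intervalIntegrable hκ ht t
  have hgint : IntervalIntegrable
      (fun r => gradForm fun i => kerG T (K' i) (m + 1) f x r (t - r)) volume 0 t := by
    rw [intervalIntegrable_iff]
    exact integrable_gradForm fun i => intervalIntegrable_iff.1 (hInt' i x)
  have key := intervalIntegral.hasFDerivAt_integral_of_dominated_of_fderiv_le (𝕜 := ℝ)
    (μ := volume) (a := 0) (b := t) (x₀ := x) (s := Set.univ)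
    (F := fun y r => kerG T K m f y r (t - r))
    (F' := fun y r => gradForm fun i => kerG T (K' i) (m + 1) f y r (t - r))
    (bound := fun r => ∑ i, C i * A * r ^ (lam / 2 - 1)) Filter.univ_mem
    (Eventually.of_forall fun y => (intervalIntegrable_iff.1 (hInt y)).aestronglyMeasurable)
    (hInt x) (intervalIntegrable_iff.1 hgint).aestronglyMeasurable ?_ ?_ ?_
  · have e : kerPot T K m f t = fun y => ∫ r in (0 : ℝ)..t, kerG T K m f y r (t - r) :=
      funext fun y => duh_eq _ _
    rw [e]
    refine key.congr_fderiv ?_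
    rw [intervalIntegral.integral_of_le ht.1, integral_gradForm fun i => by
      have := hInt' i x
      rwa [intervalIntegrable_iff_integrableOn_Ioc_of_le ht.1] at this]
    congr 1
    ext i
    rw [← intervalIntegral.integral_of_le ht.1]
    exact (duh_eq _ _).symm
  · refine Eventually.of_forall fun r hr y _ => ?_
    rw [Set.uIoc_of_le ht.1] at hr
    refine (norm_gradForm_le _).trans (Finset.sum_le_sum fun i _ => ?_)
    refine le_trans ?_ (hb i f A hf r ⟨hr.1, hr.2.trans ht.2⟩ (t - r) y)
    exact le_mul_of_one_le_left (abs_nonneg _) (Real.one_le_rpow (one_le_wt y) ha)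
  · rw [intervalIntegrable_iff]
    exact integrable_finsetSum _ fun i _ => intervalIntegrable_iff.1
      ((intervalIntegral.intervalIntegrable_rpow' (by linarith)).const_mul _)
  · refine Eventually.of_forall fun r hr y _ => ?_
    rw [Set.uIoc_of_le ht.1] at hr
    exact kerG_hasFDerivAt hμ h hK' hd hT.le ha hl hf m y hr.1 (t - r)

lemma Near.of_mem_segment {x y ξ : Spc n} (h : Near x y) (hξ : ξ ∈ segment ℝ x y) : Near x ξ := by
  unfold Near at *
  obtain ⟨θ, ⟨h0, h1⟩, rfl⟩ := (segment_eq_image' ℝ x y ▸ hξ :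
    ξ ∈ (fun θ : ℝ => x + θ • (y - x)) '' Set.Icc (0 : ℝ) 1)
  rw [show x - (x + θ • (y - x)) = θ • (x - y) by rw [smul_sub, smul_sub]; abel, norm_smul,
    Real.norm_of_nonneg h0]
  nlinarith [norm_nonneg (x - y)]

lemma Near.norm_sub_le_wt {x y : Spc n} (h : Near x y) : ‖x - y‖ ≤ 3 * wt x := by
  unfold Near at h
  linarith [one_le_wt x, norm_le_wt x]

/-- A weighted gradient bound along a segment gives a weighted Lipschitz bound. -/
lemma Near.abs_sub_le {x y : Spc n} (h : Near x y) {g : Spc n → ℝ} {g' : Fin n → Spc n → ℝ}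
    (hd : ∀ ξ, HasFDerivAt g (gradForm fun i => g' i ξ) ξ) {p : ℝ} {B : Fin n → ℝ}
    (hB : ∀ i ξ, wt ξ ^ p * |g' i ξ| ≤ B i) :
    wt x ^ p * |g x - g y| ≤ 7 ^ |p| * (∑ i, B i) * ‖x - y‖ := by
  have hw := wt_rpow_pos x p
  have key := Convex.norm_image_sub_le_of_norm_hasFDerivWithin_le (𝕜 := ℝ) (f := g)
    (s := segment ℝ x y) (C := (7 ^ |p| * ∑ i, B i) / wt x ^ p)
    (fun ξ _ => (hd ξ).hasFDerivWithinAt) (fun ξ hξ => ?_) (convex_segment x y)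
    (right_mem_segment ℝ x y) (left_mem_segment ℝ x y)
  · rw [Real.norm_eq_abs, div_mul_eq_mul_div, le_div_iff₀ hw] at key
    linarith
  · rw [le_div_iff₀ hw]
    have h1 := (h.of_mem_segment hξ).wt_rpow_le p
    have h2 : wt ξ ^ p * ‖gradForm fun i => g' i ξ‖ ≤ ∑ i, B i := by
      refine (mul_le_mul_of_nonneg_left (norm_gradForm_le _) (wt_rpow_pos ξ p).le).trans ?_
      rw [Finset.mul_sum]
      exact Finset.sum_le_sum fun i _ => hB i ξ
    have h3 := norm_nonneg (gradForm fun i => g' i ξ)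
    have h4 : (0 : ℝ) < 7 ^ |p| := by positivity
    calc _ ≤ ‖gradForm fun i => g' i ξ‖ * (7 ^ |p| * wt ξ ^ p) :=
          mul_le_mul_of_nonneg_left h1 h3
      _ = 7 ^ |p| * (wt ξ ^ p * ‖gradForm fun i => g' i ξ‖) := by ring
      _ ≤ _ := mul_le_mul_of_nonneg_left h2 h4.le

lemma holderBd_of_grad (hl : 0 < lam) (hl1 : lam < 1) {u : ℝ → Spc n → ℝ}
    {g : Fin n → ℝ → Spc n → ℝ} {b B : ℝ} {B' : Fin n → ℝ} (hg : IsGrad T u g)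
    (hB0 : 0 ≤ B) (hB' : ∀ i, 0 ≤ B' i)
    (hsup : ∀ t ∈ Set.Icc (0 : ℝ) T, ∀ x, wt x ^ b * ‖u t x‖ ≤ B)
    (htime : ∀ t₁ ∈ Set.Icc (0 : ℝ) T, ∀ t₂ ∈ Set.Icc (0 : ℝ) T, ∀ x,
        wt x ^ b * ‖u t₁ x - u t₂ x‖ ≤ B * |t₁ - t₂| ^ (lam / 2))
    (hgr : ∀ i, ∀ t ∈ Set.Icc (0 : ℝ) T, ∀ x, wt x ^ (b + 1) * ‖g i t x‖ ≤ B' i) :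
    HolderBd T lam b (B + 7 ^ |b + 1| * (∑ i, B' i) * 3) u := by
  have hs : 0 ≤ ∑ i, B' i := Finset.sum_nonneg fun i _ => hB' i
  have hE : 0 ≤ 7 ^ |b + 1| * (∑ i, B' i) * 3 := by positivity
  refine ⟨fun t ht x => (hsup t ht x).trans (by linarith), fun t ht x y hxy => ?_,
    fun t ht s hs x => (htime t ht s hs x).trans ?_⟩
  · have h1 := hxy.abs_sub_le (hg t ht) (p := b + 1) (B := B') fun i ξ => hgr i t ht ξ
    have hw := wt_pos x
    have h2 : ‖x - y‖ ≤ ‖x - y‖ ^ lam * (3 * wt x ^ (1 - lam)) := by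
      rcases (norm_nonneg (x - y)).eq_or_lt with h | h
      · rw [← h, Real.zero_rpow hl.ne']; simp
      · calc ‖x - y‖ = ‖x - y‖ ^ lam * ‖x - y‖ ^ (1 - lam) := by
              rw [← Real.rpow_add h]; simp
          _ ≤ ‖x - y‖ ^ lam * (3 * wt x) ^ (1 - lam) := by
              gcongr
              exact hxy.norm_sub_le_wt
          _ ≤ _ := by
              rw [Real.mul_rpow (by norm_num) hw.le]
              gcongr
              calc (3 : ℝ) ^ (1 - lam) ≤ 3 ^ (1 : ℝ) :=
                    Real.rpow_le_rpow_of_exponent_le (by norm_num) (by linarith)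
                _ = 3 := Real.rpow_one _
    have e : wt x ^ (b + 1) = wt x ^ (b + lam) * wt x ^ (1 - lam) := by
      rw [← Real.rpow_add hw]; ring_nf
    have hq := wt_rpow_pos x (1 - lam)
    rw [Real.norm_eq_abs]
    have h3 : (wt x ^ (b + lam) * |u t x - u t y|) * wt x ^ (1 - lam) ≤
        (7 ^ |b + 1| * (∑ i, B' i) * 3 * ‖x - y‖ ^ lam) * wt x ^ (1 - lam) := by
      calc _ = wt x ^ (b + 1) * |u t x - u t y| := by rw [e]; ring
        _ ≤ _ := h1
        _ ≤ 7 ^ |b + 1| * (∑ i, B' i) * (‖x - y‖ ^ lam * (3 * wt x ^ (1 - lam))) := by gcongr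
        _ = _ := by ring
    have h4 := le_of_mul_le_mul_right h3 hq
    have : 0 ≤ B * ‖x - y‖ ^ lam := by positivity
    linarith
  · gcongr; linarith

/-- Spatial Hölder bound for the singular potential. -/
lemma kerPot_space (hμ : 0 < μ) (h : IsK μ K) (hT : 0 < T) (ha : 0 ≤ a)
    (hl : 0 < lam) (hl1 : lam < 1) (h0 : ∫ z, K z = 0) :
    ∃ C : ℝ, 0 ≤ C ∧ ∀ (f : ℝ → Spc n → ℝ) (A : ℝ), HolderBd T lam a A f →
      ∀ t ∈ Set.Icc (0 : ℝ) T, ∀ x y, Near x y →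
        wt x ^ (a + lam) * ‖kerPot T K 2 f t x - kerPot T K 2 f t y‖ ≤
          C * A * ‖x - y‖ ^ lam := by
  obtain ⟨K', hK', hd⟩ := h.exists_grad
  obtain ⟨C₁, hC₁, hb₁⟩ := kerG_zero_mean (lam := lam) hμ h h0 hT.le ha hl 2
  choose C₂ hC₂ hb₂ using fun i => kerG_zero_mean (lam := lam) hμ (hK' i)
    (h.integral_grad_eq_zero hμ hK' hd i) hT.le ha hl 3
  obtain ⟨C₃, hC₃, hb₃⟩ := kerG_singBd hμ h hT ha hl hl1 le_rfl (Or.inr h0)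
  set p := a + lam with hp
  set κ := lam / 2 with hκ
  have hκ0 : 0 < κ := by linarith
  have h7 := one_le_seven_rpow p
  set S := ∑ i, C₂ i
  have hS : 0 ≤ S := Finset.sum_nonneg fun i _ => hC₂ i
  set D := 7 ^ |p| * (2 * C₁ + S) with hD
  have hD0 : 0 ≤ D := by positivity
  have hh : 0 < 1 / 2 - κ := by linarith
  refine ⟨D * (κ⁻¹ + (1 / 2 - κ)⁻¹), by positivity, fun f A hf t ht x y hxy => ?_⟩
  have hA := hf.nonneg hT.le
  have hw := wt_rpow_pos x p
  rcases (norm_nonneg (x - y)).eq_or_lt with hz | hpos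
  · have : x = y := by rwa [eq_comm, norm_eq_zero, sub_eq_zero] at hz
    subst this
    simp [Real.zero_rpow hl.ne']
  have hInt : ∀ y, IntervalIntegrable (fun r => kerG T K 2 f y r (t - r)) volume 0 t := fun y =>
    (hb₃ f A hf y).intervalIntegrable hκ0 ht t
  have key := split_abs_integral_le (κ := κ) (D := D * A) (β := 1 / 2) (H := ‖x - y‖ ^ 2) hκ0
    (by linarith) (by positivity) (by positivity) ht.1
    (((hInt x).sub (hInt y)).const_mul (wt x ^ p)) ?_ ?_
  · rw [intervalIntegral.integral_const_mul, intervalIntegral.integral_sub (hInt x) (hInt y),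
      abs_mul, abs_of_pos hw] at key
    have e1 : (‖x - y‖ ^ 2) ^ κ = ‖x - y‖ ^ lam := by
      rw [← Real.rpow_natCast, ← Real.rpow_mul (norm_nonneg _), hκ]
      congr 1; push_cast; ring
    rw [e1] at key
    rw [Real.norm_eq_abs, kerPot, kerPot, duh_eq, duh_eq]
    refine key.trans (le_of_eq (by ring))
  · intro r hr
    have hr' : r ∈ Set.Ioc 0 T := ⟨hr.1, hr.2.le.trans ht.2⟩
    have h1 := hb₁ f A hf r hr' (t - r) x
    have h2 := hb₁ f A hf r hr' (t - r) y
    rw [show κ - ((2 : ℕ) : ℝ) / 2 = κ - 1 by push_cast; ring] at h1 h2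
    have hq : 0 ≤ C₁ * A * r ^ (κ - 1) :=
      mul_nonneg (mul_nonneg hC₁ hA) (Real.rpow_nonneg hr.1.le _)
    have h3 : wt x ^ p * |kerG T K 2 f y r (t - r)| ≤ 7 ^ |p| * (C₁ * A * r ^ (κ - 1)) := by
      refine (mul_le_mul_of_nonneg_right (hxy.wt_rpow_le p) (abs_nonneg _)).trans ?_
      rw [mul_assoc]
      exact mul_le_mul_of_nonneg_left h2 (by positivity)
    have h4 := mul_le_mul_of_nonneg_left
      (abs_sub (kerG T K 2 f x r (t - r)) (kerG T K 2 f y r (t - r))) hw.le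
    rw [abs_mul, abs_of_pos hw]
    have h5 : 0 ≤ 7 ^ |p| * S * A * r ^ (κ - 1) := by
      have := Real.rpow_nonneg hr.1.le (κ - 1)
      positivity
    have h6 : C₁ * A * r ^ (κ - 1) ≤ 7 ^ |p| * (C₁ * A * r ^ (κ - 1)) :=
      le_mul_of_one_le_left hq h7
    rw [hD]
    nlinarith
  · intro r hr
    have hr' : r ∈ Set.Ioc 0 T := ⟨hr.1, hr.2.le.trans ht.2⟩
    have h1 := hxy.abs_sub_le (g := fun ξ => kerG T K 2 f ξ r (t - r))
      (fun ξ => kerG_hasFDerivAt hμ h hK' hd hT.le ha hl hf 2 ξ hr.1 (t - r)) (p := p)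
      (B := fun i => C₂ i * A * r ^ (κ - (3 : ℕ) / 2))
      fun i ξ => hb₂ i f A hf r hr' (t - r) ξ
    rw [← Finset.sum_mul, ← Finset.sum_mul] at h1
    rw [abs_mul, abs_of_pos hw]
    have e1 : (‖x - y‖ ^ 2) ^ (1 / 2 : ℝ) = ‖x - y‖ := by
      rw [← Real.sqrt_eq_rpow, Real.sqrt_sq (norm_nonneg _)]
    rw [e1, show κ - 1 - 1 / 2 = κ - ((3 : ℕ) : ℝ) / 2 by push_cast; ring]
    refine h1.trans ?_
    have hq := Real.rpow_nonneg hr.1.le (κ - ((3 : ℕ) : ℝ) / 2)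
    have h5 : 0 ≤ 7 ^ |p| * C₁ * A * r ^ (κ - ((3 : ℕ) : ℝ) / 2) * ‖x - y‖ := by positivity
    rw [hD]
    nlinarith

end gradients

section heat

variable {μ lam a A T : ℝ} {K : Spc n → ℝ} {f : ℝ → Spc n → ℝ}

/-- The heat kernel at time one. -/
def gk (μ : ℝ) (z : Spc n) : ℝ :=
  (4 * Real.pi * μ) ^ (-(n : ℝ) / 2) * Real.exp (-‖z‖ ^ 2 / (4 * μ))

/-- First derivatives of `gk`. -/
def gk1 (μ : ℝ) (i : Fin n) (z : Spc n) : ℝ := -(2 * μ)⁻¹ * (z i * gk μ z)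

/-- Second derivatives of `gk`. -/
def gk2 (μ : ℝ) (i j : Fin n) (z : Spc n) : ℝ :=
  -(2 * μ)⁻¹ * ((if j = i then 1 else 0) * gk μ z + z i * gk1 μ j z)

lemma isK_gk (μ : ℝ) : IsK μ (gk (n := n) μ) := IsK.gauss.smul _

lemma isK_gk1 (μ : ℝ) (i : Fin n) : IsK μ (gk1 μ i) := ((isK_gk μ).coord i).smul _

lemma isK_gk2 (μ : ℝ) (i j : Fin n) : IsK μ (gk2 μ i j) :=
  (((isK_gk μ).smul _).add ((isK_gk1 μ j).coord i)).smul _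

lemma hasFDerivAt_gk (μ : ℝ) (z : Spc n) :
    HasFDerivAt (gk μ) (gradForm fun i => gk1 μ i z) z := by
  refine ((hasFDerivAt_gauss μ z).const_mul ((4 * Real.pi * μ) ^ (-(n : ℝ) / 2))).congr_fderiv ?_
  rw [← gradForm_smul]
  congr 1
  ext i
  simp only [gk1, gk]
  ring

lemma hasFDerivAt_gk1 (μ : ℝ) (i : Fin n) (z : Spc n) :
    HasFDerivAt (gk1 μ i) (gradForm fun j => gk2 μ i j z) z := by
  refine (((hasFDerivAt_coord i z).mul (hasFDerivAt_gk μ z)).const_mul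
    (-(2 * μ)⁻¹)).congr_fderiv ?_
  rw [← gradForm_smul (z i), ← gradForm_smul (gk μ z), ← gradForm_add, ← gradForm_smul]
  congr 1
  ext j
  simp only [gk2]
  ring

lemma integral_gk (hμ : 0 < μ) : ∫ z : Spc n, gk μ z = 1 := by
  have h1 := GaussianFourier.integral_rexp_neg_mul_sq_norm (V := Spc n)
    (b := (4 * μ)⁻¹) (by positivity)
  have h2 : ∀ z : Spc n, gk μ z =
      (4 * Real.pi * μ) ^ (-(n : ℝ) / 2) * Real.exp (-(4 * μ)⁻¹ * ‖z‖ ^ 2) := fun z => by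
    unfold gk; congr 2; field_simp
  simp only [h2]
  rw [integral_const_mul, h1, finrank_euclideanSpace_fin,
    show Real.pi / (4 * μ)⁻¹ = 4 * Real.pi * μ by field_simp,
    ← Real.rpow_add (by positivity)]
  ring_nf
  simp

lemma integral_gk1 (hμ : 0 < μ) (i : Fin n) : ∫ z : Spc n, gk1 μ i z = 0 :=
  (isK_gk μ).integral_grad_eq_zero hμ (isK_gk1 μ) (hasFDerivAt_gk μ) i

lemma integral_gk2 (hμ : 0 < μ) (i j : Fin n) : ∫ z : Spc n, gk2 μ i j z = 0 :=
  (isK_gk1 μ i).integral_grad_eq_zero hμ (isK_gk2 μ i) (hasFDerivAt_gk1 μ i) j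

lemma radKer_gk (hμ : 0 < μ) (z : Spc n) :
    radKer (gk μ) (gk1 μ) 0 z = μ * ∑ i, gk2 μ i i z := by
  simp only [radKer, scaleKer, gk2, if_true, one_mul, ← Finset.mul_sum, Finset.sum_add_distrib]
  simp only [Finset.sum_const, Finset.card_univ, Fintype.card_fin, nsmul_eq_mul]
  push_cast
  field_simp
  ring

lemma op_zero_scale (hK : ∫ z, K z = 1) (g : Spc n → ℝ) (x : Spc n) : op K 0 g x = g x := by
  simp only [op, zero_smul, sub_zero]
  rw [integral_mul_const, hK, one_mul]

lemma heatKer_eq (hμ : 0 < μ) {r : ℝ} (hr : 0 < r) (y : Spc n) :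
    heatKer μ y r = (Real.sqrt r ^ n)⁻¹ * gk μ ((Real.sqrt r)⁻¹ • y) := by
  have hs := Real.sqrt_pos.2 hr
  rw [heatKer, if_pos hr, gk, norm_smul, Real.norm_of_nonneg (inv_nonneg.2 hs.le), mul_pow, inv_pow,
    Real.sq_sqrt hr.le, Real.mul_rpow (by positivity) hr.le, mul_comm (_ ^ _) (r ^ _), mul_assoc]
  congr 1
  · rw [Real.sqrt_eq_rpow, ← Real.rpow_natCast, ← Real.rpow_mul hr.le, ← Real.rpow_neg hr.le]
    ring_nf
  · congr 2
    field_simp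

lemma volPot_eq_kerPot (hμ : 0 < μ) {t : ℝ} (ht : t ∈ Set.Icc (0 : ℝ) T) (x : Spc n) :
    volPot μ f t x = kerPot T (gk μ) 0 f t x := by
  unfold volPot kerPot duh
  rw [intervalIntegral.integral_of_le ht.1, integral_Ioc_eq_integral_Ioo,
    integral_Ioc_eq_integral_Ioo]
  refine setIntegral_congr_fun measurableSet_Ioo fun τ hτ => ?_
  have hr : 0 < t - τ := sub_pos.2 hτ.2
  simp only [kerG, pow_zero, inv_one, one_mul]
  rw [op_eq _ (Real.sqrt_pos.2 hr), clampT_eq ⟨hτ.1.le, hτ.2.le.trans ht.2⟩, ← integral_const_mul]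
  refine integral_congr_ae (Eventually.of_forall fun y => ?_)
  simp only [heatKer_eq hμ hr, mul_assoc]

lemma kerPot_sum (hμ : 0 < μ) {ι : Type*} (S : Finset ι) {K : ι → Spc n → ℝ}
    (hK : ∀ i ∈ S, IsK μ (K i)) (h0 : ∀ i ∈ S, ∫ z, K i z = 0) (c : ℝ) (hT : 0 < T) (ha : 0 ≤ a)
    (hl : 0 < lam) (hl1 : lam < 1) (hf : HolderBd T lam a A f) {t : ℝ}
    (ht : t ∈ Set.Icc (0 : ℝ) T) (x : Spc n) :
    kerPot T (fun z => c * ∑ i ∈ S, K i z) 2 f t x = c * ∑ i ∈ S, kerPot T (K i) 2 f t x := by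
  have h1 : ∀ r τ, kerG T (fun z => c * ∑ i ∈ S, K i z) 2 f x r τ =
      c * ∑ i ∈ S, kerG T (K i) 2 f x r τ := fun r τ => by
    have hst := hf.statBd_clamp hT.le ha hl τ
    simp only [kerG, ← Finset.mul_sum]
    rw [op_smul]
    have : op (fun z => ∑ i ∈ S, K i z) (Real.sqrt r) (f (clampT T τ)) x =
        ∑ i ∈ S, op (K i) (Real.sqrt r) (f (clampT T τ)) x := by
      simp only [op, Finset.sum_mul]
      exact integral_finsetSum S fun i hi => op_integrable hμ (hK i hi) hst.cont (hst.abs_le ha) _ _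
    rw [this]; ring
  simp only [kerPot, duh, h1]
  rw [intervalIntegral.integral_const_mul, intervalIntegral.integral_finsetSum fun i hi => ?_]
  obtain ⟨C, hC, hb⟩ := kerG_singBd (lam := lam) hμ (hK i hi) hT ha hl hl1 le_rfl (Or.inr (h0 i hi))
  exact (hb f A hf x).intervalIntegrable' (by linarith) ht

lemma kerPot_gk_eq (hμ : 0 < μ) (hT : 0 < T) (ha : 0 ≤ a)
    (hl : 0 < lam) (hl1 : lam < 1) (hf : HolderBd T lam a A f) {t : ℝ}
    (ht : t ∈ Set.Icc (0 : ℝ) T) (x : Spc n) :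
    kerPot T (gk μ) 0 f t x = (∫ τ in (0 : ℝ)..t, f τ x) +
      ∫ τ in (0 : ℝ)..t, kerPot T (radKer (gk μ) (gk1 μ) 0) 2 f τ x := by
  have hκ : 0 < lam / 2 := by linarith
  have hrad : IsK μ (radKer (gk (n := n) μ) (gk1 μ) 0) := (isK_gk μ).radKer (isK_gk1 μ) 0
  have hrad0 := (isK_gk (n := n) μ).integral_radKer hμ (isK_gk1 μ) (hasFDerivAt_gk μ) (m := 0)
    (Or.inl rfl)
  obtain ⟨C, hC, hb⟩ := kerG_singBd hμ hrad hT ha hl hl1 le_rfl (Or.inr hrad0)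
  have hS := hb f A hf x
  have hop : Continuous fun p : ℝ × ℝ => op (gk μ) (Real.sqrt p.1) (f (clampT T p.2)) x := by
    refine op_continuous hμ (isK_gk μ) (X := ℝ × ℝ) (g := fun p => f (clampT T p.2)) ?_
      (fun p y => (hf.statBd_clamp hT.le ha hl p.2).abs_le ha y) (by fun_prop) continuous_const
    exact (hf.continuous_clamp hT.le hl).comp
      (by fun_prop : Continuous fun p : (ℝ × ℝ) × Spc n => (p.1.2, p.2))
  have hG : ∀ r τ, kerG T (gk μ) 0 f x r τ = op (gk μ) (Real.sqrt r) (f (clampT T τ)) x :=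
    fun r τ => by simp [kerG]
  have hftc : ∀ τ, ∀ r ∈ Set.Icc 0 T, ∫ ρ in (0 : ℝ)..r, kerG T (radKer (gk μ) (gk1 μ) 0) 2 f x ρ τ =
      kerG T (gk μ) 0 f x r τ - f (clampT T τ) x := fun τ r hr => by
    rw [intervalIntegral.integral_eq_sub_of_hasDerivAt_of_le hr.1
      (f := fun r => kerG T (gk μ) 0 f x r τ)]
    · congr 1
      rw [hG, Real.sqrt_zero, op_zero_scale (integral_gk hμ)]
    · simp only [hG]
      exact (hop.comp (by fun_prop : Continuous fun r : ℝ => (r, τ))).continuousOn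
    · exact fun ρ hρ => kerG_hasDerivAt hμ (isK_gk μ) (isK_gk1 μ) (hasFDerivAt_gk μ) hT.le ha hl hf
        0 x hρ.1 τ
    · exact sing_intervalIntegrable hκ hr.1
        (hS.cont.comp (by fun_prop : Continuous fun r : ℝ => (r, τ)).continuousOn
          fun ρ hρ => ⟨hρ.1, trivial⟩)
        fun ρ hρ => hS.bd ρ ⟨hρ.1, hρ.2.le.trans hr.2⟩ τ
  have h1 : ∫ τ in (0 : ℝ)..t, kerPot T (radKer (gk μ) (gk1 μ) 0) 2 f τ x =
      ∫ τ in (0 : ℝ)..t, (kerG T (gk μ) 0 f x (t - τ) τ - f (clampT T τ) x) := by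
    unfold kerPot
    rw [hS.integral_duh hT hκ ht]
    refine intervalIntegral.integral_congr fun τ hτ => ?_
    rw [Set.uIcc_of_le ht.1] at hτ
    exact hftc τ _ ⟨by linarith [hτ.2], by linarith [hτ.1, ht.2]⟩
  have h2 : ∫ τ in (0 : ℝ)..t, f τ x = ∫ τ in (0 : ℝ)..t, f (clampT T τ) x := by
    refine intervalIntegral.integral_congr fun τ hτ => ?_
    rw [Set.uIcc_of_le ht.1] at hτ
    simp only [clampT_eq ⟨hτ.1, hτ.2.trans ht.2⟩]
  have hc1 : Continuous fun τ => f (clampT T τ) x :=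
    (hf.continuous_clamp hT.le hl).comp (by fun_prop : Continuous fun τ : ℝ => (τ, x))
  have hc2 : Continuous fun τ => kerG T (gk μ) 0 f x (t - τ) τ := by
    simp only [hG]
    exact hop.comp (by fun_prop : Continuous fun τ : ℝ => (t - τ, τ))
  rw [h1, h2, intervalIntegral.integral_sub (hc2.intervalIntegrable _ _)
    (hc1.intervalIntegrable _ _)]
  unfold kerPot duh
  ring

/-- Weighted Schauder estimate of lowest order for the heat potential. -/
theorem volPot_estimate (hμ : 0 < μ) (hT : 0 < T) (ha : 0 ≤ a) (hl : 0 < lam) (hl1 : lam < 1) :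
    ∃ C : ℝ, 0 ≤ C ∧ ∀ (f : ℝ → Spc n → ℝ) (A : ℝ), HolderBd T lam a A f →
      ∃ (g₁ : Fin n → ℝ → Spc n → ℝ) (g₂ : Fin n → Fin n → ℝ → Spc n → ℝ),
        IsGrad T (volPot μ f) g₁ ∧ (∀ i, IsGrad T (g₁ i) (g₂ i)) ∧
        HolderBd T lam (a - 2) (C * A) (volPot μ f) ∧
        (∀ i, HolderBd T lam (a - 1) (C * A) (g₁ i)) ∧
        (∀ i j, HolderBd T lam a (C * A) (g₂ i j)) ∧
        IsTDeriv T (volPot μ f) (fun t x => μ * ∑ i, g₂ i i t x + f t x) := by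
  obtain ⟨C₀, hC₀, hb₀⟩ := kerPot_bounds (lam := lam) hμ (isK_gk (n := n) μ) hT ha hl hl1
    (Nat.zero_le 2) (Or.inl rfl)
  choose C₁ hC₁ hb₁ using fun i => kerPot_bounds (lam := lam) hμ (isK_gk1 (n := n) μ i) hT ha hl hl1
    one_le_two (Or.inr (integral_gk1 hμ i))
  choose C₂ hC₂ hb₂ using fun i j => kerPot_bounds (lam := lam) hμ (isK_gk2 (n := n) μ i j) hT ha hl
    hl1 le_rfl (Or.inr (integral_gk2 hμ i j))
  choose C₃ hC₃ hb₃ using fun i j => kerPot_space (lam := lam) hμ (isK_gk2 (n := n) μ i j) hT ha hl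
    hl1 (integral_gk2 hμ i j)
  set c := (7 : ℝ) ^ |a - 1 + 1|
  set D₀ := C₀ + c * (∑ i, C₁ i) * 3 with hD₀
  set D₁ := fun i => C₁ i + c * (∑ j, C₂ i j) * 3 with hD₁
  have hc : 0 ≤ c := by positivity
  have h₀ : 0 ≤ D₀ :=
    add_nonneg hC₀ (mul_nonneg (mul_nonneg hc (Finset.sum_nonneg fun i _ => hC₁ i)) (by norm_num))
  have h₁ : ∀ i, 0 ≤ D₁ i := fun i => add_nonneg (hC₁ i)
    (mul_nonneg (mul_nonneg hc (Finset.sum_nonneg fun j _ => hC₂ i j)) (by norm_num))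
  have h₂ : ∀ i j, 0 ≤ C₂ i j + C₃ i j := fun i j => add_nonneg (hC₂ i j) (hC₃ i j)
  have hs1 : 0 ≤ ∑ i, D₁ i := Finset.sum_nonneg fun i _ => h₁ i
  have hs2 : 0 ≤ ∑ i, ∑ j, (C₂ i j + C₃ i j) :=
    Finset.sum_nonneg fun i _ => Finset.sum_nonneg fun j _ => h₂ i j
  refine ⟨D₀ + ∑ i, D₁ i + ∑ i, ∑ j, (C₂ i j + C₃ i j), by positivity, fun f A hf => ?_⟩
  have hA := hf.nonneg hT.le
  have hw : ∀ (x : Spc n), wt x ^ (a - 1) ≤ wt x ^ a := fun x =>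
    Real.rpow_le_rpow_of_exponent_le (one_le_wt x) (by linarith)
  have hg0 : IsGrad T (kerPot T (gk μ) 0 f) (fun i => kerPot T (gk1 μ i) 1 f) := fun t ht x =>
    kerPot_hasFDerivAt hμ (isK_gk μ) (isK_gk1 μ) (hasFDerivAt_gk μ) hT ha hl hl1 (by norm_num)
      (Or.inl rfl) hf ht x
  have hg1 : ∀ i, IsGrad T (kerPot T (gk1 μ i) 1 f) (fun j => kerPot T (gk2 μ i j) 2 f) :=
    fun i t ht x => kerPot_hasFDerivAt hμ (isK_gk1 μ i) (isK_gk2 μ i) (hasFDerivAt_gk1 μ i) hT ha hl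
      hl1 (by norm_num) (Or.inr (integral_gk1 hμ i)) hf ht x
  have hH0 : HolderBd T lam (a - 1) (D₀ * A) (kerPot T (gk μ) 0 f) := by
    have := holderBd_of_grad hl hl1 hg0 (b := a - 1) (B := C₀ * A) (B' := fun i => C₁ i * A)
      (by positivity) (fun i => mul_nonneg (hC₁ i) hA)
      (fun t ht x => (mul_le_mul_of_nonneg_right (hw x) (norm_nonneg _)).trans
        ((hb₀ f A hf).1 t ht x))
      (fun t₁ ht₁ t₂ ht₂ x => (mul_le_mul_of_nonneg_right (hw x) (norm_nonneg _)).trans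
        ((hb₀ f A hf).2 t₁ ht₁ t₂ ht₂ x))
      (fun i t ht x => by rw [sub_add_cancel]; exact (hb₁ i f A hf).1 t ht x)
    refine this.mono (le_of_eq ?_)
    rw [hD₀, ← Finset.sum_mul]
    ring
  have hH1 : ∀ i, HolderBd T lam (a - 1) (D₁ i * A) (kerPot T (gk1 μ i) 1 f) := fun i => by
    have := holderBd_of_grad hl hl1 (hg1 i) (b := a - 1) (B := C₁ i * A) (B' := fun j => C₂ i j * A)
      (mul_nonneg (hC₁ i) hA) (fun j => mul_nonneg (hC₂ i j) hA)
      (fun t ht x => (mul_le_mul_of_nonneg_right (hw x) (norm_nonneg _)).trans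
        ((hb₁ i f A hf).1 t ht x))
      (fun t₁ ht₁ t₂ ht₂ x => (mul_le_mul_of_nonneg_right (hw x) (norm_nonneg _)).trans
        ((hb₁ i f A hf).2 t₁ ht₁ t₂ ht₂ x))
      (fun j t ht x => by rw [sub_add_cancel]; exact (hb₂ i j f A hf).1 t ht x)
    refine this.mono (le_of_eq ?_)
    rw [hD₁, ← Finset.sum_mul]
    ring
  have hH2 : ∀ i j, HolderBd T lam a ((C₂ i j + C₃ i j) * A) (kerPot T (gk2 μ i j) 2 f) := fun i j =>
    { sup := fun t ht x => ((hb₂ i j f A hf).1 t ht x).trans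
        (mul_le_mul_of_nonneg_right (by linarith [hC₃ i j]) hA)
      space := fun t ht x y hxy => (hb₃ i j f A hf t ht x y hxy).trans
        (mul_le_mul_of_nonneg_right (mul_le_mul_of_nonneg_right (by linarith [hC₂ i j]) hA)
          (by positivity))
      time := fun t₁ ht₁ t₂ ht₂ x => ((hb₂ i j f A hf).2 t₁ ht₁ t₂ ht₂ x).trans
        (mul_le_mul_of_nonneg_right (mul_le_mul_of_nonneg_right (by linarith [hC₃ i j]) hA)
          (by positivity)) }
  have hvol : ∀ t ∈ Set.Icc (0 : ℝ) T, ∀ x, kerPot T (gk μ) 0 f t x = volPot μ f t x :=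
    fun t ht x => (volPot_eq_kerPot hμ ht x).symm
  refine ⟨fun i => kerPot T (gk1 μ i) 1 f, fun i j => kerPot T (gk2 μ i j) 2 f, hg0.congr hvol, hg1,
    ((hH0.weight_mono (by linarith)).mono ?_).congr hvol, fun i => (hH1 i).mono ?_,
    fun i j => (hH2 i j).mono ?_, IsTDeriv.congr (fun t ht x => ?_) hvol⟩
  · exact mul_le_mul_of_nonneg_right (by linarith) hA
  · refine mul_le_mul_of_nonneg_right ?_ hA
    linarith [Finset.single_le_sum (f := D₁) (fun i _ => h₁ i) (Finset.mem_univ i)]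
  · refine mul_le_mul_of_nonneg_right ?_ hA
    have e1 := Finset.single_le_sum (f := fun j => C₂ i j + C₃ i j) (fun j _ => h₂ i j)
      (Finset.mem_univ j)
    have e2 := Finset.single_le_sum (f := fun i => ∑ j, (C₂ i j + C₃ i j))
      (fun i _ => Finset.sum_nonneg fun j _ => h₂ i j) (Finset.mem_univ i)
    linarith
  · have hvH : HolderBd T lam a (|μ| * ∑ i, ((C₂ i i + C₃ i i) * A) + A)
        (fun t x => μ * ∑ i, kerPot T (gk2 μ i i) 2 f t x + f t x) :=
      ((HolderBd.sum Finset.univ fun i _ => hH2 i i).const_mul μ).add hf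
    refine hasDerivWithinAt_of_integral_eq (F := fun t => kerPot T (gk μ) 0 f t x) hT.le
      (hvH.continuousOn_time hl x) (fun t ht => ?_) t ht
    have e0 : kerPot T (gk μ) 0 f 0 x = 0 := by simp [kerPot, duh]
    have hrad : radKer (gk (n := n) μ) (gk1 μ) 0 = fun z => μ * ∑ i, gk2 μ i i z :=
      funext (radKer_gk hμ)
    rw [e0, zero_add, kerPot_gk_eq hμ hT ha hl hl1 hf ht x, hrad, ← intervalIntegral.integral_add
      (hf.intervalIntegrable hl x ht)]
    · refine intervalIntegral.integral_congr fun τ hτ => ?_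
      rw [Set.uIcc_of_le ht.1] at hτ
      rw [kerPot_sum hμ Finset.univ (fun i _ => isK_gk2 μ i i) (fun i _ => integral_gk2 hμ i i) μ hT ha
        hl hl1 hf ⟨hτ.1, hτ.2.trans ht.2⟩, add_comm]
    · have h3 := (((HolderBd.sum Finset.univ fun i _ => hH2 i i).const_mul μ).congr
        (v := fun t x => kerPot T (fun z => μ * ∑ i, gk2 μ i i z) 2 f t x) fun t ht x => by
          rw [kerPot_sum hμ Finset.univ (fun i _ => isK_gk2 μ i i) (fun i _ => integral_gk2 hμ i i) μ
            hT ha hl hl1 hf ht])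
      exact h3.intervalIntegrable hl x ht

end heat

section regularity

variable {μ lam a b A B T : ℝ} {f : ℝ → Spc n → ℝ}

lemma volPot_isGrad (hμ : 0 < μ) (hT : 0 < T) (ha : 0 ≤ a) (hb : 0 ≤ b) (hl : 0 < lam)
    (hl1 : lam < 1) (hf : HolderBd T lam a A f) {g : Fin n → ℝ → Spc n → ℝ} (hfg : IsGrad T f g)
    (hg : ∀ i, HolderBd T lam b B (g i)) :
    IsGrad T (volPot μ f) (fun i => volPot μ (g i)) := by
  refine IsGrad.congr (u := kerPot T (gk μ) 0 f) (fun t ht x => ?_)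
    fun t ht x => (volPot_eq_kerPot hμ ht x).symm
  refine (kerPot_hasFDerivAt hμ (isK_gk μ) (isK_gk1 μ) (hasFDerivAt_gk μ) hT ha hl hl1 (by norm_num)
    (Or.inl rfl) hf ht x).congr_fderiv ?_
  congr 1
  ext i
  rw [volPot_eq_kerPot hμ ht x]
  unfold kerPot duh
  rw [intervalIntegral.integral_of_le ht.1, intervalIntegral.integral_of_le ht.1,
    integral_Ioc_eq_integral_Ioo, integral_Ioc_eq_integral_Ioo]
  refine setIntegral_congr_fun measurableSet_Ioo fun τ hτ => ?_
  have hs := Real.sqrt_pos.2 (sub_pos.2 hτ.2)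
  have hst := hf.statBd_clamp hT.le ha hl τ
  have hst' := fun j => (hg j).statBd_clamp hT.le hb hl τ
  have h1 := op_hasFDerivAt hμ (isK_gk μ) (isK_gk1 μ) (hasFDerivAt_gk μ) hst.cont (hst.abs_le ha)
    hs x
  have h2 := op_hasFDerivAt_right hμ (isK_gk μ) hst.cont (hst.abs_le ha) (fun j => (hst' j).cont)
    (fun j => (hst' j).abs_le hb) (hfg _ (clampT_mem hT.le τ)) (Real.sqrt (t - τ)) x
  have h3 := pd_of_hasFDerivAt h1 i
  rw [pd_of_hasFDerivAt h2 i] at h3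
  simp only [kerG, zero_add, pow_one, pow_zero, inv_one, one_mul]
  exact h3.symm

lemma volPot_spaceBd (hμ : 0 < μ) (hT : 0 < T) (hl : 0 < lam) (hl1 : lam < 1) (n M : ℕ)
    (ha : 0 ≤ a) :
    ∃ C : ℝ, 0 ≤ C ∧ ∀ (f : ℝ → Spc n → ℝ) (A : ℝ), SpaceBd T lam M a A f →
      SpaceBd T lam (M + 2) (a - 2) (C * A) (volPot μ f) := by
  induction M generalizing a with
  | zero =>
    obtain ⟨C, hC, hb⟩ := volPot_estimate (n := n) hμ hT ha hl hl1
    refine ⟨C, hC, fun f A hf => ?_⟩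
    obtain ⟨g₁, g₂, hg1, hg2, h0, h1, h2, -⟩ := hb f A hf
    refine ⟨h0, g₁, hg1, fun i => ⟨?_, g₂ i, hg2 i, fun j => ?_⟩⟩
    · rw [show a - 2 + 1 = a - 1 by ring]; exact h1 i
    · rw [show a - 2 + 1 + 1 = a by ring]; exact h2 i j
  | succ M ih =>
    obtain ⟨C, hC, hb⟩ := volPot_estimate (n := n) hμ hT ha hl hl1
    obtain ⟨C', hC', hb'⟩ := ih (a := a + 1) (by linarith)
    refine ⟨C + C', by positivity, fun f A hf => ?_⟩
    have hA := hf.nonneg hT.le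
    obtain ⟨hf0, g, hfg, hg⟩ := hf
    obtain ⟨g₁, g₂, -, -, h0, -⟩ := hb f A hf0
    refine ⟨h0.mono (mul_le_mul_of_nonneg_right (by linarith) hA), fun i => volPot μ (g i),
      volPot_isGrad hμ hT ha (by linarith : 0 ≤ a + 1) hl hl1 hf0 hfg fun i => (hg i).holderBd,
      fun i => ?_⟩
    rw [show a - 2 + 1 = a + 1 - 2 by ring]
    exact (hb' _ _ (hg i)).mono (mul_le_mul_of_nonneg_right (by linarith) hA)

lemma volPot_isTDeriv (hμ : 0 < μ) (hT : 0 < T) (ha : 0 ≤ a) (hl : 0 < lam) (hl1 : lam < 1)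
    (hf : HolderBd T lam a A f) :
    IsTDeriv T (volPot μ f) fun t x => μ * ∑ i, pd i (pd i (volPot μ f t)) x + f t x := by
  obtain ⟨C, hC, hb⟩ := volPot_estimate (n := n) hμ hT ha hl hl1
  obtain ⟨g₁, g₂, hg1, hg2, -, -, -, h⟩ := hb f A hf
  intro t ht x
  have e : ∀ i, pd i (pd i (volPot μ f t)) x = g₂ i i t x := fun i => by
    rw [show pd i (volPot μ f t) = g₁ i t from funext fun y => hg1.pd_eq ht y i]
    exact (hg2 i).pd_eq ht x i
  simp only [e]
  exact h t ht x

lemma volPot_parBd_step (hμ : 0 < μ) (hT : 0 < T) (hl : 0 < lam) (hl1 : lam < 1) (s k : ℕ)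
    (ha : 0 ≤ a) {C₁ : ℝ} (hC₁ : 0 ≤ C₁)
    (hb₁ : ∀ (f : ℝ → Spc n → ℝ) (A : ℝ), ParBd T lam s k a A f →
      ParBd T lam s (k + 2) (a - 2) (C₁ * A) (volPot μ f)) :
    ∃ C : ℝ, 0 ≤ C ∧ ∀ (f : ℝ → Spc n → ℝ) (A : ℝ), ParBd T lam s k a A f →
      ParBd T lam (s + 1) k (a - 2) (C * A) (volPot μ f) := by
  obtain ⟨C₀, hC₀, hb₀⟩ := volPot_spaceBd hμ hT hl hl1 n (2 * s + k) ha
  refine ⟨C₀ + (|μ| * (n * C₁) + 1), by positivity, fun f A hf => ?_⟩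
  have hA := hf.nonneg hT.le
  refine ⟨?_, _, volPot_isTDeriv hμ hT ha hl hl1 hf.spaceBd.holderBd, ?_⟩
  · rw [show 2 * (s + 1) + k = 2 * s + k + 2 by ring]
    exact (hb₀ f A hf.spaceBd).mono (mul_le_mul_of_nonneg_right (by
      have : 0 ≤ |μ| * (n * C₁) + 1 := by positivity
      linarith) hA)
  · have hu := hb₁ f A hf
    have h2 : ∀ i, ParBd T lam s k (a - 2) (C₁ * A) (fun t => pd i (pd i (volPot μ f t))) :=
      fun i => ((hu.pd hT.le hl i).pd hT.le hl i).weight_mono (by linarith)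
    have h3 := ((ParBd.sum Finset.univ fun i _ => h2 i).const_mul μ).add
      (hf.weight_mono (by linarith : a - 2 ≤ a))
    refine h3.mono (le_of_eq_of_le ?_ (mul_le_mul_of_nonneg_right
      (le_add_of_nonneg_left hC₀ : |μ| * (n * C₁) + 1 ≤ _) hA))
    simp only [Finset.sum_const, Finset.card_univ, Fintype.card_fin, nsmul_eq_mul]
    ring

/-- Weighted parabolic Schauder estimate for the heat potential. -/
theorem volPot_parBd (hμ : 0 < μ) (hT : 0 < T) (hl : 0 < lam) (hl1 : lam < 1) (n s k : ℕ)
    (ha : 0 ≤ a) :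
    ∃ C : ℝ, 0 ≤ C ∧ ∀ (f : ℝ → Spc n → ℝ) (A : ℝ), ParBd T lam s k a A f →
      ParBd T lam (s + 1) k (a - 2) (C * A) (volPot μ f) := by
  induction s generalizing k with
  | zero =>
    obtain ⟨C, hC, hb⟩ := volPot_spaceBd hμ hT hl hl1 n k ha
    exact volPot_parBd_step hμ hT hl hl1 0 k ha hC hb
  | succ s ih =>
    obtain ⟨C, hC, hb⟩ := ih (k + 2)
    exact volPot_parBd_step hμ hT hl hl1 (s + 1) k ha hC fun f A hf => hb f A hf.of_succ

end regularity

section translation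

variable {F G : Type*} [NormedAddCommGroup F] [NormedAddCommGroup G] {T lam δ A : ℝ}

lemma wt_zero : wt (0 : Spc n) = 1 := by simp [wt]

lemma one_le_wt_rpow_of_unit {x : Spc n} (hx : ‖x‖ ≤ 1) (p : ℝ) : 1 ≤ 7 ^ |p| * wt x ^ p := by
  have h := (near_of_norm_le_two (x := (0 : Spc n)) (y := x) (by simpa using by linarith)).wt_rpow_le
    p
  rwa [wt_zero, Real.one_rpow] at h

lemma wt_rpow_le_of_unit {x : Spc n} (hx : ‖x‖ ≤ 1) (p : ℝ) : wt x ^ p ≤ 7 ^ |p| := by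
  have h := (near_of_norm_le_two (x := (0 : Spc n)) (y := x)
    (by simpa using by linarith)).wt_rpow_le' p
  rwa [wt_zero, Real.one_rpow, mul_one] at h

lemma near_of_le_half {x y : Spc n} (h : ‖x - y‖ ≤ ‖x‖ / 2) : Near x y := by
  unfold Near; linarith

lemma Near.wt_rpow_le_wt2 {x y : Spc n} (h : Near x y) (p : ℝ) :
    wt x ^ p ≤ 7 ^ |p| * wt2 x y ^ p ∧ wt y ^ p ≤ 7 ^ |p| * wt2 x y ^ p ∧
      wt2 x y ^ p ≤ 7 ^ |p| * wt x ^ p := by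
  have h7 := one_le_seven_rpow p
  unfold wt2
  rcases max_choice (wt x) (wt y) with e | e <;> rw [e]
  · exact ⟨le_mul_of_one_le_left (wt_rpow_pos x p).le h7, h.wt_rpow_le' p,
      le_mul_of_one_le_left (wt_rpow_pos x p).le h7⟩
  · exact ⟨h.wt_rpow_le p, le_mul_of_one_le_left (wt_rpow_pos y p).le h7, h.wt_rpow_le' p⟩

/-- A bound on the norm `eAniso0` yields pointwise bounds. -/
lemma HolderBd.of_eAniso0 (hl : 0 < lam) (δ : ℝ) :
    ∃ C : ℝ, 0 ≤ C ∧ ∀ (A : ℝ) (v : ℝ → Spc n → F), 0 ≤ A →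
      eAniso0 T lam δ v ≤ ENNReal.ofReal A → HolderBd T lam δ (C * A) v := by
  have hC : ∀ p : ℝ, (0 : ℝ) ≤ 7 ^ |p| := fun p => by positivity
  set C : ℝ := 1 + 7 ^ |δ + lam| + 4 ^ lam * (1 + 7 ^ |δ|) with hCdef
  have h40 : (0 : ℝ) ≤ 4 ^ lam * (1 + 7 ^ |δ|) := by positivity
  have hC1 : 1 ≤ C := by linarith [hC (δ + lam)]
  have hC7 : 7 ^ |δ + lam| ≤ C := by linarith
  have hC4 : 4 ^ lam * (1 + 7 ^ |δ|) ≤ C := by linarith [hC (δ + lam)]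
  refine ⟨C, by linarith, fun A v hA h => ?_⟩
  have hAC : A ≤ C * A := le_mul_of_one_le_left hA hC1
  unfold eAniso0 at h
  rw [if_neg hl.ne'] at h
  have hsp : ∀ t ∈ Set.Icc (0 : ℝ) T, eHol0 lam δ (v t) ≤ ENNReal.ofReal A := fun t ht =>
    (le_iSup (fun t : Set.Icc (0 : ℝ) T => eHol0 lam δ (v t)) ⟨t, ht⟩).trans (le_self_add.trans h)
  simp only [eHol0, if_neg hl.ne'] at hsp
  have hsup : ∀ t ∈ Set.Icc (0 : ℝ) T, ∀ x, wt x ^ δ * ‖v t x‖ ≤ A := fun t ht x => by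
    rw [← ENNReal.ofReal_le_ofReal_iff hA]
    exact (le_iSup (fun x => ENNReal.ofReal (wt x ^ δ * ‖v t x‖)) x).trans
      ((le_add_self.trans le_self_add).trans (hsp t ht))
  have hW : ∀ t ∈ Set.Icc (0 : ℝ) T, ∀ x y, x ≠ y → ‖x - y‖ ≤ ‖x‖ / 2 →
      wt2 x y ^ (δ + lam) * ‖v t x - v t y‖ ≤ A * ‖x - y‖ ^ lam := fun t ht x y hxy hd => by
    have hpos : 0 < ‖x - y‖ ^ lam := Real.rpow_pos_of_pos (norm_pos_iff.2 (sub_ne_zero.2 hxy)) _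
    rw [← div_le_iff₀ hpos, ← ENNReal.ofReal_le_ofReal_iff hA]
    refine le_trans ?_ (le_add_self.trans (hsp t ht))
    unfold eWHold
    exact le_iSup_of_le x (le_iSup_of_le y (le_iSup_of_le ⟨hxy, hd⟩ le_rfl))
  have hO : ∀ t ∈ Set.Icc (0 : ℝ) T, ∀ x y, x ≠ y → ‖x‖ ≤ 1 → ‖y‖ ≤ 1 →
      ‖v t x - v t y‖ ≤ A * ‖x - y‖ ^ lam := fun t ht x y hxy hx hy => by
    have hpos : 0 < ‖x - y‖ ^ lam := Real.rpow_pos_of_pos (norm_pos_iff.2 (sub_ne_zero.2 hxy)) _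
    rw [← div_le_iff₀ hpos, ← ENNReal.ofReal_le_ofReal_iff hA]
    refine le_trans ?_ ((le_self_add.trans le_self_add).trans (hsp t ht))
    unfold eOHold
    refine le_trans ?_ le_add_self
    exact le_iSup_of_le x (le_iSup_of_le y (le_iSup_of_le ⟨hx, hy, hxy⟩ le_rfl))
  refine ⟨fun t ht x => (hsup t ht x).trans hAC, fun t ht x y hxy => ?_, fun t₁ ht₁ t₂ ht₂ x => ?_⟩
  · rcases eq_or_ne x y with rfl | hne
    · simp [Real.zero_rpow hl.ne']
    have hd0 : 0 ≤ ‖x - y‖ ^ lam := by positivity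
    have hd := norm_pos_iff.2 (sub_ne_zero.2 hne)
    by_cases c1 : ‖x - y‖ ≤ ‖x‖ / 2
    · calc wt x ^ (δ + lam) * ‖v t x - v t y‖
          ≤ 7 ^ |δ + lam| * wt2 x y ^ (δ + lam) * ‖v t x - v t y‖ := by
            gcongr; exact (hxy.wt_rpow_le_wt2 _).1
        _ ≤ 7 ^ |δ + lam| * (A * ‖x - y‖ ^ lam) := by
            rw [mul_assoc]; exact mul_le_mul_of_nonneg_left (hW t ht x y hne c1) (hC _)
        _ ≤ C * (A * ‖x - y‖ ^ lam) := by gcongr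
        _ = C * A * ‖x - y‖ ^ lam := by ring
    by_cases c2 : ‖y - x‖ ≤ ‖y‖ / 2
    · have hn := near_of_le_half c2
      calc wt x ^ (δ + lam) * ‖v t x - v t y‖
          ≤ 7 ^ |δ + lam| * wt2 y x ^ (δ + lam) * ‖v t x - v t y‖ := by
            gcongr; exact (hn.wt_rpow_le_wt2 _).2.1
        _ ≤ 7 ^ |δ + lam| * (A * ‖y - x‖ ^ lam) := by
            rw [mul_assoc, norm_sub_rev (v t x)]
            exact mul_le_mul_of_nonneg_left (hW t ht y x hne.symm c2) (hC _)
        _ ≤ C * (A * ‖y - x‖ ^ lam) := by gcongr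
        _ = C * A * ‖x - y‖ ^ lam := by rw [norm_sub_rev]; ring
    by_cases c3 : ‖x‖ ≤ 1 ∧ ‖y‖ ≤ 1
    · calc wt x ^ (δ + lam) * ‖v t x - v t y‖
          ≤ 7 ^ |δ + lam| * (A * ‖x - y‖ ^ lam) := by
            gcongr
            · exact wt_rpow_le_of_unit c3.1 _
            · exact hO t ht x y hne c3.1 c3.2
        _ ≤ C * (A * ‖x - y‖ ^ lam) := by gcongr
        _ = C * A * ‖x - y‖ ^ lam := by ring
    · rw [norm_sub_rev y x] at c2
      have hw : wt x ≤ 4 * ‖x - y‖ := by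
        have h1 := wt_le_one_add x
        rw [not_and_or] at c3
        rcases c3 with c3 | c3 <;> linarith
      have hwl : wt x ^ lam ≤ 4 ^ lam * ‖x - y‖ ^ lam := by
        rw [← Real.mul_rpow (by norm_num) hd.le]
        exact Real.rpow_le_rpow (wt_pos x).le hw hl.le
      have hv : wt x ^ δ * ‖v t x - v t y‖ ≤ (1 + 7 ^ |δ|) * A := by
        calc wt x ^ δ * ‖v t x - v t y‖ ≤ wt x ^ δ * (‖v t x‖ + ‖v t y‖) := by
              gcongr; exacts [(wt_rpow_pos x δ).le, norm_sub_le _ _]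
          _ = wt x ^ δ * ‖v t x‖ + wt x ^ δ * ‖v t y‖ := by ring
          _ ≤ A + 7 ^ |δ| * wt y ^ δ * ‖v t y‖ := by
              gcongr
              exacts [hsup t ht x, hxy.wt_rpow_le δ]
          _ ≤ A + 7 ^ |δ| * A := by rw [mul_assoc]; gcongr; exact hsup t ht y
          _ = (1 + 7 ^ |δ|) * A := by ring
      calc wt x ^ (δ + lam) * ‖v t x - v t y‖
          = wt x ^ lam * (wt x ^ δ * ‖v t x - v t y‖) := by
            rw [Real.rpow_add (wt_pos x)]; ring
        _ ≤ 4 ^ lam * ‖x - y‖ ^ lam * ((1 + 7 ^ |δ|) * A) := by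
            gcongr
            exact mul_nonneg (wt_rpow_pos x δ).le (norm_nonneg _)
        _ = 4 ^ lam * (1 + 7 ^ |δ|) * (A * ‖x - y‖ ^ lam) := by ring
        _ ≤ C * (A * ‖x - y‖ ^ lam) := by gcongr
        _ = C * A * ‖x - y‖ ^ lam := by ring
  · rcases eq_or_ne t₁ t₂ with rfl | hne
    · simp [Real.zero_rpow (by linarith : lam / 2 ≠ 0)]
    have hpos : 0 < |t₁ - t₂| ^ (lam / 2) := Real.rpow_pos_of_pos (abs_pos.2 (sub_ne_zero.2 hne)) _
    refine le_trans ?_ (mul_le_mul_of_nonneg_right hAC hpos.le)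
    rw [← div_le_iff₀ hpos, ← ENNReal.ofReal_le_ofReal_iff hA]
    refine le_trans ?_ (le_add_self.trans h)
    refine le_iSup_of_le (⟨t₁, ht₁⟩ : Set.Icc (0 : ℝ) T) (le_iSup_of_le ⟨t₂, ht₂⟩
      (le_iSup_of_le hne ?_))
    exact le_iSup (fun x => ENNReal.ofReal
      (wt x ^ δ * ‖v t₁ x - v t₂ x‖ / |t₁ - t₂| ^ (lam / 2))) x

/-- Pointwise bounds yield a bound on the norm `eAniso0`. -/
lemma HolderBd.eAniso0_le (hl : 0 < lam) (hT : 0 ≤ T) (δ : ℝ) :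
    ∃ C : ℝ, 0 ≤ C ∧ ∀ (A : ℝ) (v : ℝ → Spc n → F),
      HolderBd T lam δ A v → eAniso0 T lam δ v ≤ ENNReal.ofReal (C * A) := by
  have hC : ∀ p : ℝ, (0 : ℝ) ≤ 7 ^ |p| := fun p => by positivity
  refine ⟨7 ^ |δ| + 7 ^ |δ + lam| + 1 + 7 ^ |δ + lam| + 1, by positivity, fun A v h => ?_⟩
  have hA := h.nonneg hT
  have hsplit : ENNReal.ofReal ((7 ^ |δ| + 7 ^ |δ + lam| + 1 + 7 ^ |δ + lam| + 1) * A) =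
      ENNReal.ofReal (7 ^ |δ| * A) + ENNReal.ofReal (7 ^ |δ + lam| * A) + ENNReal.ofReal A +
        ENNReal.ofReal (7 ^ |δ + lam| * A) + ENNReal.ofReal A := by
    rw [← ENNReal.ofReal_add (by positivity) (by positivity),
      ← ENNReal.ofReal_add (by positivity) (by positivity),
      ← ENNReal.ofReal_add (by positivity) (by positivity),
      ← ENNReal.ofReal_add (by positivity) (by positivity)]
    congr 1; ring
  rw [hsplit]
  unfold eAniso0
  rw [if_neg hl.ne']
  refine add_le_add (iSup_le fun t => ?_) ?_
  · rw [eHol0, if_neg hl.ne']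
    refine add_le_add (add_le_add (add_le_add ?_ ?_) ?_) ?_
    · refine iSup₂_le fun x hx => ENNReal.ofReal_le_ofReal ?_
      calc ‖v t x‖ ≤ 7 ^ |δ| * wt x ^ δ * ‖v t x‖ :=
            le_mul_of_one_le_left (norm_nonneg _) (one_le_wt_rpow_of_unit hx δ)
        _ ≤ 7 ^ |δ| * A := by rw [mul_assoc]; gcongr; exact h.sup t t.2 x
    · refine iSup_le fun x => iSup₂_le fun y hxy => ENNReal.ofReal_le_ofReal ?_
      obtain ⟨hx, hy, hne⟩ := hxy
      have hn : Near x y := near_of_norm_le_two ((norm_sub_le _ _).trans (by linarith))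
      have hpos : 0 < ‖x - y‖ ^ lam := Real.rpow_pos_of_pos (norm_pos_iff.2 (sub_ne_zero.2 hne)) _
      rw [div_le_iff₀ hpos]
      calc ‖v t x - v t y‖ ≤ 7 ^ |δ + lam| * wt x ^ (δ + lam) * ‖v t x - v t y‖ :=
            le_mul_of_one_le_left (norm_nonneg _) (one_le_wt_rpow_of_unit hx _)
        _ ≤ 7 ^ |δ + lam| * (A * ‖x - y‖ ^ lam) := by
            rw [mul_assoc]; exact mul_le_mul_of_nonneg_left (h.space t t.2 x y hn) (hC _)
        _ = 7 ^ |δ + lam| * A * ‖x - y‖ ^ lam := by ring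
    · exact iSup_le fun x => ENNReal.ofReal_le_ofReal (h.sup t t.2 x)
    · refine iSup_le fun x => iSup₂_le fun y hxy => ENNReal.ofReal_le_ofReal ?_
      obtain ⟨hne, hd⟩ := hxy
      have hn := near_of_le_half hd
      have hpos : 0 < ‖x - y‖ ^ lam := Real.rpow_pos_of_pos (norm_pos_iff.2 (sub_ne_zero.2 hne)) _
      rw [div_le_iff₀ hpos]
      calc wt2 x y ^ (δ + lam) * ‖v t x - v t y‖
          ≤ 7 ^ |δ + lam| * wt x ^ (δ + lam) * ‖v t x - v t y‖ := by
            gcongr; exact (hn.wt_rpow_le_wt2 _).2.2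
        _ ≤ 7 ^ |δ + lam| * (A * ‖x - y‖ ^ lam) := by
            rw [mul_assoc]; exact mul_le_mul_of_nonneg_left (h.space t t.2 x y hn) (hC _)
        _ = 7 ^ |δ + lam| * A * ‖x - y‖ ^ lam := by ring
  · refine iSup_le fun t₁ => iSup_le fun t₂ => iSup₂_le fun hne x => ENNReal.ofReal_le_ofReal ?_
    have hpos : 0 < |(t₁ : ℝ) - t₂| ^ (lam / 2) :=
      Real.rpow_pos_of_pos (abs_pos.2 (sub_ne_zero.2 hne)) _
    rw [div_le_iff₀ hpos]
    exact h.time t₁ t₁.2 t₂ t₂.2 x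

end translation

section derivatives

variable {T lam a A : ℝ} {M k s : ℕ} {u v : ℝ → Spc n → ℝ}

lemma exists_iteratedFDeriv_pd (m : ℕ) (i : Fin n) :
    ∃ L : ContinuousMultilinearMap ℝ (fun _ : Fin (m + 1) => Spc n) ℝ →L[ℝ]
        ContinuousMultilinearMap ℝ (fun _ : Fin m => Spc n) ℝ,
      ∀ f : Spc n → ℝ, ContDiff ℝ (m + 1 : ℕ) f → ∀ x,
        iteratedFDeriv ℝ m (pd i f) x = L (iteratedFDeriv ℝ (m + 1) f x) := by
  let ev : (Spc n →L[ℝ] ℝ) →L[ℝ] ℝ :=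
    ContinuousLinearMap.apply ℝ ℝ (EuclideanSpace.single i (1 : ℝ))
  refine ⟨(ContinuousLinearMap.compContinuousMultilinearMapL ℝ (fun _ : Fin m => Spc n)
    (Spc n →L[ℝ] ℝ) ℝ ev).comp
      ((continuousMultilinearCurryRightEquiv' ℝ m (Spc n) ℝ).toContinuousLinearEquiv :
        _ →L[ℝ] _), fun f hf x => ?_⟩
  have hd : ContDiff ℝ m (fderiv ℝ f) := hf.fderiv_right (by norm_cast)
  have h1 : pd i f = ev ∘ fderiv ℝ f := rfl
  rw [h1, ev.iteratedFDeriv_comp_left hd.contDiffAt le_rfl, iteratedFDeriv_succ_eq_comp_right]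
  simp

lemma exists_iteratedFDeriv_succ (n m : ℕ) :
    ∃ L : Fin n → ContinuousMultilinearMap ℝ (fun _ : Fin m => Spc n) ℝ →L[ℝ]
        ContinuousMultilinearMap ℝ (fun _ : Fin (m + 1) => Spc n) ℝ,
      ∀ f : Spc n → ℝ, ContDiff ℝ (m + 1 : ℕ) f → ∀ x,
        iteratedFDeriv ℝ (m + 1) f x = ∑ i, L i (iteratedFDeriv ℝ m (pd i f) x) := by
  let S : Fin n → ℝ →L[ℝ] (Spc n →L[ℝ] ℝ) := fun i =>
    ContinuousLinearMap.toSpanSingleton ℝ (EuclideanSpace.proj i)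
  let R := (continuousMultilinearCurryRightEquiv' ℝ m (Spc n)
    ℝ).symm.toContinuousLinearEquiv.toContinuousLinearMap
  refine ⟨fun i => R.comp
      (ContinuousLinearMap.compContinuousMultilinearMapL ℝ (fun _ : Fin m => Spc n)
        ℝ (Spc n →L[ℝ] ℝ) (S i)), fun f hf x => ?_⟩
  have hd : ContDiff ℝ m (fderiv ℝ f) := hf.fderiv_right (by norm_cast)
  have hp : ∀ i, ContDiff ℝ m (pd i f) := fun i => hd.clm_apply contDiff_const
  have h1 : fderiv ℝ f = fun y => ∑ i, (S i ∘ pd i f) y := by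
    funext y
    rw [← gradForm_pd]
    rfl
  rw [iteratedFDeriv_succ_eq_comp_right]
  change R (iteratedFDeriv ℝ m (fderiv ℝ f) x) = _
  rw [h1, iteratedFDeriv_fun_sum_apply (f := fun i y => (S i ∘ pd i f) y)
    fun i _ => ((S i).contDiff.comp (hp i)).contDiffAt, map_sum]
  refine Finset.sum_congr rfl fun i _ => ?_
  have := (S i).iteratedFDeriv_comp_left (hp i).contDiffAt (x := x) le_rfl
  exact congrArg _ this

lemma SpaceBd.of_iteratedFDeriv (n : ℕ) (T lam : ℝ) (M : ℕ) (a : ℝ) :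
    ∃ C, 0 ≤ C ∧ ∀ A (u : ℝ → Spc n → ℝ), 0 ≤ A → (∀ t ∈ Set.Icc (0 : ℝ) T, ContDiff ℝ M (u t)) →
      (∀ m ≤ M, HolderBd T lam (a + m) A (fun t => iteratedFDeriv ℝ m (u t))) →
      SpaceBd T lam M a (C * A) u := by
  have hzero : ∃ C, 0 ≤ C ∧ ∀ a A (u : ℝ → Spc n → ℝ), 0 ≤ A →
      HolderBd T lam (a + (0 : ℕ)) A (fun t => iteratedFDeriv ℝ 0 (u t)) →
        HolderBd T lam a (C * A) u := by
    let L : ContinuousMultilinearMap ℝ (fun _ : Fin 0 => Spc n) ℝ →L[ℝ] ℝ :=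
      ((continuousMultilinearCurryFin0 ℝ (Spc n) ℝ).toContinuousLinearEquiv : _ →L[ℝ] _)
    refine ⟨‖L‖, L.opNorm_nonneg, fun a A u hA h => ?_⟩
    have h1 := h.clm L
    rw [Nat.cast_zero, add_zero] at h1
    refine h1.congr fun t _ x => ?_
    simp [L, iteratedFDeriv_zero_eq_comp]
  obtain ⟨C₀, hC₀, h₀⟩ := hzero
  induction M generalizing a with
  | zero => exact ⟨C₀, hC₀, fun A u hA _ h => h₀ a A u hA (h 0 le_rfl)⟩
  | succ M ih =>
    obtain ⟨C₁, hC₁, h₁⟩ := ih (a + 1)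
    choose L hL using fun (m : ℕ) (i : Fin n) => exists_iteratedFDeriv_pd m i
    let K : ℝ := ∑ m ∈ Finset.range (M + 1), ∑ i, ‖L m i‖
    have hK : ∀ m ≤ M, ∀ i, ‖L m i‖ ≤ K := fun m hm i =>
      (Finset.single_le_sum (f := fun i => ‖L m i‖) (fun _ _ => ContinuousLinearMap.opNorm_nonneg _)
        (Finset.mem_univ i)).trans (Finset.single_le_sum (f := fun m => ∑ i, ‖L m i‖)
          (fun _ _ => Finset.sum_nonneg fun _ _ => ContinuousLinearMap.opNorm_nonneg _)
          (Finset.mem_range.2 (by omega)))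
    have hK0 : 0 ≤ K := Finset.sum_nonneg fun _ _ => Finset.sum_nonneg fun _ _ => ContinuousLinearMap.opNorm_nonneg _
    refine ⟨C₀ + C₁ * K, by positivity, fun A u hA hu h => ⟨?_, fun i t => NSdeRham.pd i (u t),
      fun t ht x => ?_, fun i => ?_⟩⟩
    · exact (h₀ a A u hA (h 0 (by omega))).mono (by nlinarith [mul_nonneg (mul_nonneg hC₁ hK0) hA])
    · exact hasFDerivAt_pd ((hu t ht).differentiable (by norm_cast) x)
    · refine (h₁ (K * A) (fun t => NSdeRham.pd i (u t)) (by positivity) (fun t ht => ?_)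
        fun m hm => ?_).mono (by nlinarith [mul_nonneg hC₀ hA])
      · exact ((hu t ht).fderiv_right (by norm_cast)).clm_apply contDiff_const
      · have h2 := (h (m + 1) (by omega)).clm (L m i)
        rw [show a + ((m + 1 : ℕ) : ℝ) = a + 1 + m by push_cast; ring] at h2
        refine (h2.mono (mul_le_mul_of_nonneg_right (hK m hm i) hA)).congr fun t ht x => ?_
        exact (hL m i (u t) ((hu t ht).of_le (by norm_cast; omega)) x).symm

lemma SpaceBd.contDiff (hl : 0 < lam) (h : SpaceBd T lam M a A u) {t : ℝ}
    (ht : t ∈ Set.Icc (0 : ℝ) T) : ContDiff ℝ M (u t) := by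
  induction M generalizing a u with
  | zero =>
    rw [Nat.cast_zero, contDiff_zero]
    exact (HolderBd.continuousOn hl h).comp_continuous (f := fun x => (t, x)) (by fun_prop)
      fun x => ⟨ht, trivial⟩
  | succ M ih =>
    obtain ⟨-, g, hg, hb⟩ := h
    rw [Nat.cast_add, Nat.cast_one, contDiff_succ_iff_fderiv]
    refine ⟨fun x => (hg t ht x).differentiableAt, fun h => ?_, ?_⟩
    · exact absurd h (WithTop.coe_ne_top (a := (M : ℕ∞)))
    · have : fderiv ℝ (u t) = fun x => gradForm fun i => g i t x := funext fun x => (hg t ht x).fderiv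
      rw [this]
      unfold gradForm
      exact ContDiff.sum fun i _ => (ih (hb i)).smul contDiff_const

lemma SpaceBd.iteratedFDeriv (n : ℕ) (T lam : ℝ) (hT : 0 ≤ T) (hl : 0 < lam) (M : ℕ) (a : ℝ) :
    ∃ C, 0 ≤ C ∧ ∀ A (u : ℝ → Spc n → ℝ), SpaceBd T lam M a A u →
      ∀ m ≤ M, HolderBd T lam (a + m) (C * A) (fun t => iteratedFDeriv ℝ m (u t)) := by
  induction M generalizing a with
  | zero =>
    let L : ℝ →L[ℝ] ContinuousMultilinearMap ℝ (fun _ : Fin 0 => Spc n) ℝ :=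
      ((continuousMultilinearCurryFin0 ℝ (Spc n) ℝ).symm.toContinuousLinearEquiv : _ →L[ℝ] _)
    refine ⟨‖L‖, L.opNorm_nonneg, fun A u h m hm => ?_⟩
    obtain rfl : m = 0 := by omega
    rw [Nat.cast_zero, add_zero]
    refine ((h : HolderBd T lam a A u).clm L).congr fun t _ x => ?_
    simp [L, iteratedFDeriv_zero_eq_comp]
  | succ M ih =>
    obtain ⟨C₀, hC₀, h₀⟩ := ih a
    obtain ⟨C₁, hC₁, h₁⟩ := ih (a + 1)
    obtain ⟨L, hL⟩ := exists_iteratedFDeriv_succ n M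
    have hS : 0 ≤ ∑ i, ‖L i‖ := Finset.sum_nonneg fun _ _ => ContinuousLinearMap.opNorm_nonneg _
    refine ⟨C₀ + (∑ i, ‖L i‖) * C₁, by positivity, fun A u h m hm => ?_⟩
    have hA := h.nonneg hT
    rcases Nat.lt_or_ge M m with hm' | hm'
    · obtain rfl : m = M + 1 := by omega
      have h2 := HolderBd.sum Finset.univ fun i _ => (h₁ A _ (h.pd i) M le_rfl).clm (L i)
      rw [show a + 1 + (M : ℝ) = a + ((M + 1 : ℕ) : ℝ) by push_cast; ring, ← Finset.sum_mul] at h2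
      refine (h2.mono (by nlinarith [mul_nonneg hC₀ hA])).congr fun t ht x => ?_
      exact (hL (u t) (h.contDiff hl ht) x).symm
    · exact (h₀ A u h.of_succ m hm').mono (by nlinarith [mul_nonneg (mul_nonneg hS hC₁) hA])

lemma tDeriv_succ (T : ℝ) (j : ℕ) (u : ℝ → Spc n → ℝ) :
    tDeriv T (j + 1) u =
      tDeriv T j (fun t x => derivWithin (fun τ => u τ x) (Set.Icc (0 : ℝ) T) t) := by
  funext t x
  simp only [tDeriv, iteratedDerivWithin_succ']

lemma tDeriv_zero (T : ℝ) (u : ℝ → Spc n → ℝ) : tDeriv T 0 u = u := by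
  funext t x
  simp [tDeriv, iteratedDerivWithin_zero]

lemma mixDeriv_zero (T : ℝ) (m : ℕ) (u : ℝ → Spc n → ℝ) :
    mixDeriv T m 0 u = fun t => iteratedFDeriv ℝ m (u t) := by
  funext t
  rw [mixDeriv, tDeriv_zero]

lemma IsTDeriv.tDeriv_succ (hT : 0 < T) (h : IsTDeriv T u v) (j : ℕ) {t : ℝ}
    (ht : t ∈ Set.Icc (0 : ℝ) T) : tDeriv T (j + 1) u t = tDeriv T j v t := by
  funext x
  rw [NSdeRham.tDeriv_succ]
  refine iteratedDerivWithin_congr (fun τ hτ => ?_) ht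
  exact (h τ hτ x).derivWithin (uniqueDiffOn_Icc hT τ hτ)

lemma ParBd.of_mixDeriv (n : ℕ) (T lam : ℝ) (hT : 0 < T) (s k : ℕ) (a : ℝ) :
    ∃ C, 0 ≤ C ∧ ∀ A (u : ℝ → Spc n → ℝ), 0 ≤ A →
      (∀ x, ContDiffOn ℝ s (fun t => u t x) (Set.Icc 0 T)) →
      (∀ j ≤ s, ∀ t ∈ Set.Icc (0 : ℝ) T, ContDiff ℝ (2 * (s - j) + k : ℕ) (tDeriv T j u t)) →
      (∀ j ≤ s, ∀ m, m + 2 * j ≤ 2 * s + k → HolderBd T lam (a + m) A (mixDeriv T m j u)) →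
      ParBd T lam s k a (C * A) u := by
  induction s with
  | zero =>
    obtain ⟨C, hC, h⟩ := SpaceBd.of_iteratedFDeriv n T lam k a
    refine ⟨C, hC, fun A u hA _ h2 h3 => h A u hA (fun t ht => ?_) fun m hm => ?_⟩
    · simpa [tDeriv_zero] using h2 0 le_rfl t ht
    · simpa only [mixDeriv_zero] using h3 0 le_rfl m (by omega)
  | succ s ih =>
    obtain ⟨C, hC, h⟩ := SpaceBd.of_iteratedFDeriv n T lam (2 * (s + 1) + k) a
    obtain ⟨C', hC', h'⟩ := ih
    refine ⟨C + C', by positivity, fun A u hA h1 h2 h3 => ⟨?_,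
      fun t x => derivWithin (fun τ => u τ x) (Set.Icc (0 : ℝ) T) t, fun t ht x => ?_, ?_⟩⟩
    · refine (h A u hA (fun t ht => ?_) fun m hm => ?_).mono (by nlinarith [mul_nonneg hC' hA])
      · simpa only [tDeriv_zero, Nat.sub_zero] using h2 0 (by omega) t ht
      · simpa only [mixDeriv_zero] using h3 0 (by omega) m (by omega)
    · exact ((h1 x).differentiableOn (by norm_cast) t ht).hasDerivWithinAt
    · refine (h' A _ hA (fun x => ?_) (fun j hj t ht => ?_) fun j hj m hm => ?_).mono
        (by nlinarith [mul_nonneg hC hA])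
      · exact (h1 x).derivWithin (uniqueDiffOn_Icc hT) (by norm_cast)
      · have := h2 (j + 1) (by omega) t ht
        rwa [NSdeRham.tDeriv_succ, show s + 1 - (j + 1) = s - j by omega] at this
      · have := h3 (j + 1) (by omega) m (by omega)
        unfold mixDeriv at this ⊢
        rwa [NSdeRham.tDeriv_succ] at this

lemma ParBd.contDiffOn (hT : 0 < T) (hl : 0 < lam) (h : ParBd T lam s k a A u) (x : Spc n) :
    ContDiffOn ℝ s (fun t => u t x) (Set.Icc 0 T) := by
  induction s generalizing u with
  | zero =>
    rw [Nat.cast_zero, contDiffOn_zero]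
    exact h.spaceBd.holderBd.continuousOn_time hl x
  | succ s ih =>
    obtain ⟨-, v, hv, hb⟩ := h
    rw [Nat.cast_add, Nat.cast_one, contDiffOn_succ_iff_derivWithin (uniqueDiffOn_Icc hT)]
    refine ⟨fun t ht => (hv t ht x).differentiableWithinAt, fun h => ?_, ?_⟩
    · exact absurd h (WithTop.coe_ne_top (a := (s : ℕ∞)))
    · exact (ih hb).congr fun t ht => (hv t ht x).derivWithin (uniqueDiffOn_Icc hT t ht)

lemma ParBd.contDiff_tDeriv (hT : 0 < T) (hl : 0 < lam) (h : ParBd T lam s k a A u) {j : ℕ}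
    (hj : j ≤ s) {t : ℝ} (ht : t ∈ Set.Icc (0 : ℝ) T) :
    ContDiff ℝ (2 * (s - j) + k : ℕ) (tDeriv T j u t) := by
  induction s generalizing u j with
  | zero =>
    obtain rfl : j = 0 := by omega
    rw [tDeriv_zero]
    exact h.spaceBd.contDiff hl ht
  | succ s ih =>
    rcases j with _ | j
    · rw [tDeriv_zero]
      exact h.spaceBd.contDiff hl ht
    · obtain ⟨-, v, hv, hb⟩ := h
      rw [hv.tDeriv_succ hT j ht, show s + 1 - (j + 1) = s - j by omega]
      exact ih hb (by omega)

lemma ParBd.mixDeriv (n : ℕ) (T lam : ℝ) (hT : 0 < T) (hl : 0 < lam) (s k : ℕ) (a : ℝ) :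
    ∃ C, 0 ≤ C ∧ ∀ A (u : ℝ → Spc n → ℝ), ParBd T lam s k a A u →
      ∀ j ≤ s, ∀ m, m + 2 * j ≤ 2 * s + k →
        HolderBd T lam (a + m) (C * A) (mixDeriv T m j u) := by
  induction s with
  | zero =>
    obtain ⟨C, hC, h⟩ := SpaceBd.iteratedFDeriv n T lam hT.le hl k a
    refine ⟨C, hC, fun A u hu j hj m hm => ?_⟩
    obtain rfl : j = 0 := by omega
    simpa only [mixDeriv_zero] using h A u hu m (by omega)
  | succ s ih =>
    obtain ⟨C, hC, h⟩ := SpaceBd.iteratedFDeriv n T lam hT.le hl (2 * (s + 1) + k) a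
    obtain ⟨C', hC', h'⟩ := ih
    refine ⟨C + C', by positivity, fun A u hu j hj m hm => ?_⟩
    have hA := hu.nonneg hT.le
    rcases j with _ | j
    · refine HolderBd.mono ?_ (by nlinarith [mul_nonneg hC' hA] : C * A ≤ _)
      simpa only [mixDeriv_zero] using h A u hu.spaceBd m (by omega)
    · obtain ⟨-, v, hv, hb⟩ := hu
      refine ((h' A v hb j (by omega) m (by omega)).mono
        (by nlinarith [mul_nonneg hC hA])).congr fun t ht x => ?_
      unfold NSdeRham.mixDeriv
      exact congrArg (fun f => _root_.iteratedFDeriv ℝ m f x) (hv.tDeriv_succ hT j ht).symm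

end derivatives

section norms

variable {T lam : ℝ}

lemma eAniso0_mixDeriv_le {k s b l j : ℕ} {δ : ℝ} {u : ℝ → Spc n → ℝ} (hb : b ≤ k)
    (hl : l + 2 * j ≤ 2 * s) :
    eAniso0 T lam (δ + b + l) (mixDeriv T (b + l) j u) ≤ eAnisoKS T k s lam δ u := by
  unfold eAnisoKS
  refine le_trans ?_ (Finset.single_le_sum_of_canonicallyOrdered
    (Finset.mem_range.2 (show b < k + 1 by omega)))
  refine le_trans ?_ (Finset.single_le_sum_of_canonicallyOrdered
    (Finset.mem_range.2 (show l < 2 * s + 1 by omega)))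
  refine le_trans ?_ (Finset.single_le_sum_of_canonicallyOrdered
    (Finset.mem_range.2 (show j < s + 1 by omega)))
  rw [if_pos hl]

lemma ParBd.of_eAnisoKS (n : ℕ) (hT : 0 < T) (hl : 0 < lam) (k s : ℕ) (δ : ℝ) :
    ∃ C, 0 ≤ C ∧ ∀ A (u : ℝ → Spc n → ℝ), 0 ≤ A → AnisoReg T k s u →
      eAnisoKS T k s lam δ u ≤ ENNReal.ofReal A → ParBd T lam s k δ (C * A) u := by
  obtain ⟨C, hC, h⟩ := ParBd.of_mixDeriv n T lam hT s k δ
  choose K hK hK' using fun m : ℕ => HolderBd.of_eAniso0 (n := n) (T := T)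
    (F := ContinuousMultilinearMap ℝ (fun _ : Fin m => Spc n) ℝ) hl (δ + m)
  refine ⟨C * ∑ m ∈ Finset.range (2 * s + k + 1), K m,
    mul_nonneg hC (Finset.sum_nonneg fun m _ => hK m), fun A u hA hu hn => ?_⟩
  rw [mul_assoc]
  refine h _ u (mul_nonneg (Finset.sum_nonneg fun m _ => hK m) hA) hu.1 (fun j hj t ht => ?_)
    fun j hj m hm => ?_
  · have := hu.2.1 j hj t ht
    norm_cast at this
  · refine (hK' m A _ hA (le_trans ?_ hn)).mono (mul_le_mul_of_nonneg_right
      (Finset.single_le_sum (f := K) (fun m _ => hK m) (Finset.mem_range.2 (by omega))) hA)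
    obtain ⟨b, l, rfl, hb, hl'⟩ : ∃ b l, m = b + l ∧ b ≤ k ∧ l + 2 * j ≤ 2 * s :=
      ⟨m - min m (2 * s - 2 * j), min m (2 * s - 2 * j), by omega, by omega, by omega⟩
    have := eAniso0_mixDeriv_le (T := T) (lam := lam) (u := u) (δ := δ) hb hl'
    rwa [add_assoc, ← Nat.cast_add] at this

lemma ParBd.anisoReg (hT : 0 < T) (hl : 0 < lam) {k s : ℕ} {δ A : ℝ} {u : ℝ → Spc n → ℝ}
    (h : ParBd T lam s k δ A u) : AnisoReg T k s u := by
  obtain ⟨C, -, hC⟩ := ParBd.mixDeriv n T lam hT hl s k δ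
  refine ⟨fun x => h.contDiffOn hT hl x, fun j hj t ht => ?_, fun j m hj hm => ?_⟩
  · have := h.contDiff_tDeriv hT hl hj ht
    norm_cast
  · exact ((hC A u h j hj m hm).continuousOn hl).comp_continuous
      (f := fun p : Set.Icc (0 : ℝ) T × Spc n => ((p.1 : ℝ), p.2)) (by fun_prop)
      fun p => ⟨p.1.2, trivial⟩

lemma ParBd.eAnisoKS_le (n : ℕ) (hT : 0 < T) (hl : 0 < lam) (k s : ℕ) (δ : ℝ) :
    ∃ C, 0 ≤ C ∧ ∀ A (u : ℝ → Spc n → ℝ), ParBd T lam s k δ A u →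
      eAnisoKS T k s lam δ u ≤ ENNReal.ofReal (C * A) := by
  obtain ⟨C, hC, h⟩ := ParBd.mixDeriv n T lam hT hl s k δ
  choose K hK hK' using fun m : ℕ => HolderBd.eAniso0_le (n := n) (T := T)
    (F := ContinuousMultilinearMap ℝ (fun _ : Fin m => Spc n) ℝ) hl hT.le (δ + m)
  refine ⟨∑ b ∈ Finset.range (k + 1), ∑ m ∈ Finset.range (2 * s + 1),
    ∑ j ∈ Finset.range (s + 1), K (b + m) * C, ?_, fun A u hu => ?_⟩
  · exact Finset.sum_nonneg fun b _ => Finset.sum_nonneg fun m _ => Finset.sum_nonneg fun j _ =>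
      mul_nonneg (hK _) hC
  have hA := hu.nonneg hT.le
  have h0 : ∀ b m : ℕ, 0 ≤ K (b + m) * C * A := fun b m => mul_nonneg (mul_nonneg (hK _) hC) hA
  simp only [Finset.sum_mul]
  rw [ENNReal.ofReal_sum_of_nonneg fun b _ => Finset.sum_nonneg fun m _ => Finset.sum_nonneg
    fun j _ => h0 b m]
  unfold eAnisoKS
  refine Finset.sum_le_sum fun b hb => ?_
  rw [ENNReal.ofReal_sum_of_nonneg fun m _ => Finset.sum_nonneg fun j _ => h0 b m]
  refine Finset.sum_le_sum fun m hm => ?_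
  rw [ENNReal.ofReal_sum_of_nonneg fun j _ => h0 b m]
  refine Finset.sum_le_sum fun j hj => ?_
  rw [Finset.mem_range] at hb hm hj
  split_ifs with hc
  · have := hK' (b + m) _ _ (h A u hu j (by omega) (b + m) (by omega))
    rwa [Nat.cast_add, ← add_assoc, ← mul_assoc] at this
  · exact zero_le

end norms

section forms

variable {T lam a b A B : ℝ} {s k q : ℕ}

lemma ParBd.of_CMemF (n q : ℕ) (hT : 0 < T) (hl : 0 < lam) (k s : ℕ) (δ : ℝ) :
    ∃ C, 0 ≤ C ∧ ∀ u : FormT n q, CMemF T k s lam δ u → ∀ N, eAnisoKSF T k s lam δ u ≤ N →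
      N ≠ ⊤ → ∀ I, ParBd T lam s k δ (C * N.toReal) (u I) := by
  obtain ⟨C, hC, h⟩ := ParBd.of_eAnisoKS n hT hl k s δ
  refine ⟨C, hC, fun u hu N hN hN' I => h _ _ ENNReal.toReal_nonneg (hu.1 I) ?_⟩
  rw [ENNReal.ofReal_toReal hN']
  refine le_trans ?_ hN
  exact Finset.single_le_sum_of_canonicallyOrdered (f := fun I => eAnisoKS T k s lam δ (u I))
    (Finset.mem_univ I)

lemma ParBd.cMemF (n q : ℕ) (hT : 0 < T) (hl : 0 < lam) (k s : ℕ) (δ K : ℝ) (hK : 0 ≤ K) :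
    ∃ C, 0 < C ∧ ∀ (u : FormT n q) (N : ℝ≥0∞), N ≠ ⊤ →
      (∀ I, ParBd T lam s k δ (K * N.toReal) (u I)) →
        CMemF T k s lam δ u ∧ eAnisoKSF T k s lam δ u ≤ ENNReal.ofReal C * N := by
  obtain ⟨C, hC, h⟩ := ParBd.eAnisoKS_le n hT hl k s δ
  have h1 : ∀ (u : FormT n q) (N : ℝ≥0∞), N ≠ ⊤ →
      (∀ I, ParBd T lam s k δ (K * N.toReal) (u I)) →
        eAnisoKSF T k s lam δ u ≤ ENNReal.ofReal ((∑ _I : Idx n q, C * K) + 1) * N := by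
    intro u N hN hu
    have h2 : eAnisoKSF T k s lam δ u ≤ ENNReal.ofReal (∑ _I : Idx n q, C * K * N.toReal) := by
      rw [ENNReal.ofReal_sum_of_nonneg fun _ _ => by positivity]
      refine Finset.sum_le_sum fun I _ => (h _ _ (hu I)).trans (le_of_eq ?_)
      rw [mul_assoc]
    refine h2.trans ?_
    conv_rhs => rw [← ENNReal.ofReal_toReal hN]
    rw [← ENNReal.ofReal_mul (by positivity), ← Finset.sum_mul]
    refine ENNReal.ofReal_le_ofReal (mul_le_mul_of_nonneg_right (by linarith)
      ENNReal.toReal_nonneg)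
  refine ⟨(∑ _I : Idx n q, C * K) + 1, by positivity, fun u N hN hu =>
    ⟨⟨fun I => (hu I).anisoReg hT hl, ?_⟩, h1 u N hN hu⟩⟩
  exact ne_top_of_le_ne_top (ENNReal.mul_ne_top ENNReal.ofReal_ne_top hN) (h1 u N hN hu)

lemma bilin_apply_eq_sum {ι κ : Type*} [Fintype ι] [Fintype κ] [DecidableEq ι] [DecidableEq κ]
    (M : (ι → ℝ) →ₗ[ℝ] (κ → ℝ) →ₗ[ℝ] ℝ) (f : ι → ℝ) (g : κ → ℝ) :
    M f g = ∑ i, ∑ j, M (Pi.single i 1) (Pi.single j 1) * (f i * g j) := by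
  have hf : M f g = M (∑ i, Pi.single i (f i)) (∑ j, Pi.single j (g j)) := by
    rw [Finset.univ_sum_single f, Finset.univ_sum_single g]
  rw [hf]
  simp only [map_sum, LinearMap.sum_apply]
  rw [Finset.sum_comm]
  refine Finset.sum_congr rfl fun i _ => Finset.sum_congr rfl fun j _ => ?_
  have h1 : (Pi.single i (f i) : ι → ℝ) = f i • Pi.single i 1 := by
    rw [← Pi.single_smul, smul_eq_mul, mul_one]
  have h2 : (Pi.single j (g j) : κ → ℝ) = g j • Pi.single j 1 := by
    rw [← Pi.single_smul, smul_eq_mul, mul_one]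
  rw [h1, h2]
  simp only [map_smul, LinearMap.smul_apply, smul_eq_mul]
  ring

lemma ParBd.bilin {ι κ : Type*} [Fintype ι] [Fintype κ] (n : ℕ) (hT : 0 ≤ T) (lam : ℝ) (s k : ℕ)
    (a b : ℝ) (M : (ι → ℝ) →ₗ[ℝ] (κ → ℝ) →ₗ[ℝ] ℝ) :
    ∃ C, 0 ≤ C ∧ ∀ A B (f : ι → ℝ → Spc n → ℝ) (g : κ → ℝ → Spc n → ℝ),
      (∀ i, ParBd T lam s k a A (f i)) → (∀ j, ParBd T lam s k b B (g j)) →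
        ParBd T lam s k (a + b) (C * (A * B))
          (fun t x => M (fun i => f i t x) fun j => g j t x) := by
  obtain ⟨C, hC, h⟩ := ParBd.exists_mul n T lam hT s k a b
  refine ⟨∑ i, ∑ j, |M (Pi.single i 1) (Pi.single j 1)| * C,
    Finset.sum_nonneg fun _ _ => Finset.sum_nonneg fun _ _ => mul_nonneg (abs_nonneg _) hC,
    fun A B f g hf hg => ?_⟩
  have hC' : (∑ i, ∑ j, |M (Pi.single i 1) (Pi.single j 1)| * C) * (A * B) =
      ∑ i, ∑ j, |M (Pi.single i 1) (Pi.single j 1)| * (C * (A * B)) := by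
    simp only [Finset.sum_mul, mul_assoc]
  rw [hC']
  refine ParBd.congr (ParBd.sum Finset.univ fun i _ => ParBd.sum Finset.univ fun j _ =>
    (h A B _ _ (hf i) (hg j)).const_mul _) fun t _ x => ?_
  exact (bilin_apply_eq_sum M _ _).symm

lemma ParBd.sign_mul {u : ℝ → Spc n → ℝ} (h : ParBd T lam s k a A u) (m : ℕ) :
    ParBd T lam s k a A (fun t x => (-1 : ℝ) ^ m * u t x) := by
  simpa using h.const_mul ((-1 : ℝ) ^ m)

lemma ParBd.dT (hT : 0 ≤ T) (hl : 0 < lam) {u : FormT n q} (hA : 0 ≤ A)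
    (h : ∀ I, ParBd T lam s (k + 1) a A (u I)) (J : Idx n (q + 1)) :
    ParBd T lam s k (a + 1) (n * A) (dT u J) := by
  have h1 : (n : ℝ) * A = ∑ _i : Fin n, A := by simp
  rw [h1]
  refine ParBd.sum Finset.univ fun i _ => ?_
  split_ifs
  · exact ((h _).pd hT hl i).sign_mul _
  · exact ParBd.zero.mono hA

lemma ParBd.dLowT (hT : 0 ≤ T) (hl : 0 < lam) {u : FormT n (q - 1)} (hA : 0 ≤ A)
    (h : ∀ I, ParBd T lam s (k + 1) a A (u I)) (J : Idx n q) :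
    ParBd T lam s k (a + 1) (n * A) (dLowT u J) := by
  have h1 : (n : ℝ) * A = ∑ _i : Fin n, A := by simp
  rw [h1]
  refine ParBd.sum Finset.univ fun i _ => ?_
  split_ifs
  · exact ((h _).pd hT hl i).sign_mul _
  · exact ParBd.zero.mono hA

lemma ParBd.coDT (hT : 0 ≤ T) (hl : 0 < lam) {u : FormT n q} (hA : 0 ≤ A)
    (h : ∀ I, ParBd T lam s (k + 1) a A (u I)) (K : Idx n (q - 1)) :
    ParBd T lam s k (a + 1) (n * A) (coDT u K) := by
  have h1 : (n : ℝ) * A = |(-1 : ℝ)| * ∑ _i : Fin n, A := by simp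
  rw [h1]
  refine ParBd.congr (ParBd.const_mul (ParBd.sum Finset.univ (v := fun i t x =>
    if h : i ∉ K.1 ∧ (insert i K.1).card = q then
      (-1 : ℝ) ^ (K.1.filter fun j => j < i).card *
        NSdeRham.pd i (u ⟨insert i K.1, h.2⟩ t) x
    else 0) fun i _ => ?_) (-1)) fun t _ x => neg_one_mul _
  split_ifs
  · exact ((h _).pd hT hl i).sign_mul _
  · exact ParBd.zero.mono hA

lemma ParBd.first_order_bilin (n q : ℕ) (hT : 0 ≤ T) (lam : ℝ) (s k : ℕ) (δ : ℝ)
    (M₁ : M1Type n q) :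
    ∃ C, 0 ≤ C ∧ ∀ A B (u w : FormT n q), 0 ≤ A → 0 ≤ B →
      (∀ J, ParBd T lam s k (δ + 1) A (NSdeRham.dT u J)) →
      (∀ J, ParBd T lam s k (δ + 1) A (NSdeRham.coDT u J)) →
      (∀ I, ParBd T lam s k δ B (w I)) →
      ∀ I, ParBd T lam s k (2 * δ + 1) (C * (A * B))
        (fun t x => M₁ (ddFib u t x) (fib w t x) I) := by
  choose C₁ hC₁ h₁ using fun I : Idx n q => ParBd.bilin n hT lam s k (δ + 1) δ
    ((M₁.compr₂ (LinearMap.proj I)).comp (LinearMap.inl ℝ _ _))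
  choose C₂ hC₂ h₂ using fun I : Idx n q => ParBd.bilin n hT lam s k (δ + 1) δ
    ((M₁.compr₂ (LinearMap.proj I)).comp (LinearMap.inr ℝ _ _))
  have hC : ∀ I, 0 ≤ C₁ I + C₂ I := fun I => add_nonneg (hC₁ I) (hC₂ I)
  refine ⟨∑ I, (C₁ I + C₂ I), Finset.sum_nonneg fun I _ => hC I,
    fun A B u w hA hB hd hc hw I => ?_⟩
  have e1 := (h₁ I A B _ _ hd hw).add (h₂ I A B _ _ hc hw)
  rw [show δ + 1 + δ = 2 * δ + 1 by ring, ← add_mul] at e1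
  refine (e1.mono (mul_le_mul_of_nonneg_right (Finset.single_le_sum (f := fun I => C₁ I + C₂ I)
    (fun I _ => hC I) (Finset.mem_univ I)) (mul_nonneg hA hB))).congr fun t _ x => ?_
  simp only [LinearMap.comp_apply, LinearMap.compr₂_apply, LinearMap.proj_apply, LinearMap.inl_apply,
    LinearMap.inr_apply]
  rw [← Pi.add_apply, ← LinearMap.add_apply, ← map_add]
  simp only [Prod.mk_add_mk, add_zero, zero_add]
  rfl

lemma ParBd.wop (n q : ℕ) (hT : 0 ≤ T) (lam : ℝ) (s k : ℕ) (δ : ℝ) (M₁ : M1Type n q) :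
    ∃ C, 0 ≤ C ∧ ∀ A B (w u : FormT n q), 0 ≤ A → 0 ≤ B →
      (∀ J, ParBd T lam s k (δ + 1) A (NSdeRham.dT u J)) →
      (∀ J, ParBd T lam s k (δ + 1) A (NSdeRham.coDT u J)) →
      (∀ I, ParBd T lam s k δ A (u I)) →
      (∀ J, ParBd T lam s k (δ + 1) B (NSdeRham.dT w J)) →
      (∀ J, ParBd T lam s k (δ + 1) B (NSdeRham.coDT w J)) →
      (∀ I, ParBd T lam s k δ B (w I)) →
      ∀ I, ParBd T lam s k (2 * δ + 1) (C * (A * B)) (Wop M₁ w u I) := by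
  obtain ⟨C, hC, h⟩ := ParBd.first_order_bilin n q hT lam s k δ M₁
  refine ⟨C + C, by positivity, fun A B w u hA hB hdu hcu hu hdw hcw hw I => ?_⟩
  have := (h A B u w hA hB hdu hcu hw I).add (h B A w u hB hA hdw hcw hu I)
  rw [mul_comm B A, ← add_mul] at this
  exact this

lemma ParBd.zeroth_order_bilin (n q : ℕ) (hT : 0 ≤ T) (lam : ℝ) (s k : ℕ) (δ : ℝ)
    (M₂ : M2Type n q) :
    ∃ C, 0 ≤ C ∧ ∀ A B (u w : FormT n q), 0 ≤ A → 0 ≤ B →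
      (∀ I, ParBd T lam s k δ A (u I)) → (∀ I, ParBd T lam s k δ B (w I)) →
      ∀ K, ParBd T lam s k (2 * δ) (C * (A * B)) (fun t x =>
        M₂ (fib u t x) (fib w t x) K + M₂ (fib w t x) (fib u t x) K) := by
  choose C hC h using fun K : Idx n (q - 1) => ParBd.bilin n hT lam s k δ δ
    (M₂.compr₂ (LinearMap.proj K))
  refine ⟨∑ K, (C K + C K), Finset.sum_nonneg fun K _ => add_nonneg (hC K) (hC K),
    fun A B u w hA hB hu hw K => ?_⟩
  have e1 := (h K A B _ _ hu hw).add (h K B A _ _ hw hu)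
  rw [mul_comm B A, ← add_mul, ← two_mul δ] at e1
  exact e1.mono (mul_le_mul_of_nonneg_right (Finset.single_le_sum (f := fun K => C K + C K)
    (fun K _ => add_nonneg (hC K) (hC K)) (Finset.mem_univ K)) (mul_nonneg hA hB))

lemma ParBd.bop (n q : ℕ) (hT : 0 ≤ T) (hl : 0 < lam) (s k : ℕ) (δ : ℝ) (M₁ : M1Type n q)
    (M₂ : M2Type n q) :
    ∃ C, 0 ≤ C ∧ ∀ A B (w u : FormT n q), 0 ≤ A → 0 ≤ B →
      (∀ I, ParBd T lam s (k + 1) δ A (u I)) → (∀ I, ParBd T lam s (k + 1) δ B (w I)) →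
      ∀ I, ParBd T lam s k (2 * δ + 1) (C * (A * B)) (Bop M₁ M₂ w u I) := by
  obtain ⟨C₁, hC₁, h₁⟩ := ParBd.wop n q hT lam s k δ M₁
  obtain ⟨C₂, hC₂, h₂⟩ := ParBd.zeroth_order_bilin n q hT lam s (k + 1) δ M₂
  refine ⟨C₁ * ((n + 1) * (n + 1)) + n * C₂, by positivity, fun A B w u hA hB hu hw I => ?_⟩
  have hn : ∀ {D : ℝ}, 0 ≤ D → n * D ≤ (n + 1) * D := fun hD => by linarith
  have hn' : ∀ {D : ℝ}, 0 ≤ D → D ≤ (n + 1) * D := fun hD => by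
    nlinarith [mul_nonneg (Nat.cast_nonneg (α := ℝ) n) hD]
  have e1 := h₁ ((n + 1) * A) ((n + 1) * B) w u (by positivity) (by positivity)
    (fun J => (ParBd.dT hT hl hA hu J).mono (hn hA))
    (fun J => (ParBd.coDT hT hl hA hu J).mono (hn hA))
    (fun I => ((hu I).order_mono (Nat.le_succ k)).mono (hn' hA))
    (fun J => (ParBd.dT hT hl hB hw J).mono (hn hB))
    (fun J => (ParBd.coDT hT hl hB hw J).mono (hn hB))
    (fun I => ((hw I).order_mono (Nat.le_succ k)).mono (hn' hB)) I
  have e2 := ParBd.dLowT hT hl (by positivity) (h₂ A B u w hA hB hu hw) I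
  have e3 := e1.add e2
  rw [show C₁ * ((n + 1) * A * ((n + 1) * B)) + n * (C₂ * (A * B)) =
    (C₁ * ((n + 1) * (n + 1)) + n * C₂) * (A * B) by ring] at e3
  exact e3

end forms

lemma volPotF_wop_parBd (n q s k : ℕ) {lam δ μ T : ℝ} (h1 : 0 < lam) (h2 : lam < 1) (hδ : 0 < δ)
    (hμ : 0 < μ) (hT : 0 < T) (M₁ : M1Type n q) (w : FormT n q) (hw : CMemD T k s lam δ w) :
    ∃ K, 0 ≤ K ∧ ∀ u : FormT n q, CMemD T k s lam δ u → eCD T k s lam δ u ≠ ⊤ ∧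
      ∀ I, ParBd T lam (s + 1) k (2 * δ - 1) (K * (eCD T k s lam δ u).toReal)
        (volPotF μ (Wop M₁ w u) I) := by
  obtain ⟨C₁, hC₁, p₁⟩ := ParBd.of_CMemF n q hT h1 k s δ
  obtain ⟨C₂, hC₂, p₂⟩ := ParBd.of_CMemF n (q + 1) hT h1 k s (δ + 1)
  obtain ⟨C₃, hC₃, p₃⟩ := ParBd.of_CMemF n (q - 1) hT h1 k s (δ + 1)
  obtain ⟨Cw, hCw, pw⟩ := ParBd.wop n q hT.le lam s k δ M₁
  obtain ⟨Cv, hCv, pv⟩ := volPot_parBd (n := n) hμ hT h1 h2 s k (a := 2 * δ + 1) (by positivity)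
  have key : ∀ u : FormT n q, CMemD T k s lam δ u → eCD T k s lam δ u ≠ ⊤ ∧
      (∀ J, ParBd T lam s k (δ + 1) ((C₁ + C₂ + C₃) * (eCD T k s lam δ u).toReal) (dT u J)) ∧
      (∀ J, ParBd T lam s k (δ + 1) ((C₁ + C₂ + C₃) * (eCD T k s lam δ u).toReal) (coDT u J)) ∧
      ∀ I, ParBd T lam s k δ ((C₁ + C₂ + C₃) * (eCD T k s lam δ u).toReal) (u I) := by
    intro u hu
    have hN : eCD T k s lam δ u ≠ ⊤ :=
      ENNReal.add_ne_top.2 ⟨ENNReal.add_ne_top.2 ⟨hu.1.2, hu.2.1.2⟩, hu.2.2.2⟩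
    have hr : 0 ≤ (eCD T k s lam δ u).toReal := ENNReal.toReal_nonneg
    refine ⟨hN, fun J => (p₂ _ hu.2.1 _ ?_ hN J).mono ?_, fun J => (p₃ _ hu.2.2 _ ?_ hN J).mono ?_,
      fun I => (p₁ _ hu.1 _ ?_ hN I).mono ?_⟩
    · exact le_add_right (le_add_left le_rfl)
    · exact mul_le_mul_of_nonneg_right (by linarith) hr
    · exact le_add_left le_rfl
    · exact mul_le_mul_of_nonneg_right (by linarith) hr
    · exact le_add_right (le_add_right le_rfl)
    · exact mul_le_mul_of_nonneg_right (by linarith) hr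
  obtain ⟨-, w₁, w₂, w₃⟩ := key w hw
  have hC : 0 ≤ C₁ + C₂ + C₃ := by positivity
  have hD : 0 ≤ (C₁ + C₂ + C₃) * (eCD T k s lam δ w).toReal :=
    mul_nonneg hC ENNReal.toReal_nonneg
  generalize (C₁ + C₂ + C₃) * (eCD T k s lam δ w).toReal = D at *
  refine ⟨Cv * (Cw * ((C₁ + C₂ + C₃) * D)), by positivity, fun u hu => ?_⟩
  obtain ⟨hN, u₁, u₂, u₃⟩ := key u hu
  refine ⟨hN, fun I => ?_⟩
  have h := pv _ _ (pw _ _ w u (mul_nonneg hC ENNReal.toReal_nonneg) hD u₁ u₂ u₃ w₁ w₂ w₃ I)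
  generalize (eCD T k s lam δ u).toReal = N at *
  rw [show 2 * δ + 1 - 2 = 2 * δ - 1 by ring] at h
  exact h.mono (le_of_eq (by ring))

lemma volPotF_bop_parBd (n q s k : ℕ) {lam δ μ T : ℝ} (h1 : 0 < lam) (h2 : lam < 1) (hδ : 0 < δ)
    (hμ : 0 < μ) (hT : 0 < T) (M₁ : M1Type n q) (M₂ : M2Type n q) (w : FormT n q)
    (hw : CMemF T (k + 1) s lam δ w) :
    ∃ K, 0 ≤ K ∧ ∀ u : FormT n q, CMemF T (k + 1) s lam δ u →
      ∀ I, ParBd T lam (s + 1) k (2 * δ - 1) (K * (eAnisoKSF T (k + 1) s lam δ u).toReal)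
        (volPotF μ (Bop M₁ M₂ w u) I) := by
  obtain ⟨C, hC, p⟩ := ParBd.of_CMemF n q hT h1 (k + 1) s δ
  obtain ⟨Cb, hCb, pb⟩ := ParBd.bop n q hT.le h1 s k δ M₁ M₂
  obtain ⟨Cv, hCv, pv⟩ := volPot_parBd (n := n) hμ hT h1 h2 s k (a := 2 * δ + 1) (by positivity)
  refine ⟨Cv * (Cb * (C * (C * (eAnisoKSF T (k + 1) s lam δ w).toReal))), by positivity,
    fun u hu I => ?_⟩
  have h := pv _ _ (pb _ _ w u (mul_nonneg hC ENNReal.toReal_nonneg)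
    (mul_nonneg hC ENNReal.toReal_nonneg) (p u hu _ le_rfl hu.2) (p w hw _ le_rfl hw.2) I)
  rw [show 2 * δ + 1 - 2 = 2 * δ - 1 by ring] at h
  exact h.mono (le_of_eq (by ring))

/-- continuity of `Ψ_{μ,q}B_q(w,·)`, `Ψ_{μ,q}W_q` and
`(d_q ⊕ d_{q-1}^*)Ψ_{μ,q}W_q` on the anisotropic weighted scales. -/
theorem stmt6 (n q s k : ℕ) (hn : 2 ≤ n) (hq : q ≤ n) (hs : 1 ≤ s) (hk : 1 ≤ k)
    (lam δ μ T : ℝ) (h1 : 0 < lam) (h2 : lam < 1) (hδ : 0 < δ) (hμ : 0 < μ) (hT : 0 < T)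
    (M₁ : M1Type n q) (M₂ : M2Type n q) (w : FormT n q) (hw : CMemD T k s lam δ w) :
    (∃ C : ℝ, 0 < C ∧ ∀ u : FormT n q, CMemF T k s lam δ u →
      CMemF T (k - 1) (s + 1) lam (2 * δ - 1) (volPotF μ (Bop M₁ M₂ w u)) ∧
      eAnisoKSF T (k - 1) (s + 1) lam (2 * δ - 1) (volPotF μ (Bop M₁ M₂ w u)) ≤
        ENNReal.ofReal C * eAnisoKSF T k s lam δ u) ∧
    (∃ C : ℝ, 0 < C ∧ ∀ u : FormT n q, CMemD T k s lam δ u →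
      CMemF T k (s + 1) lam (2 * δ - 1) (volPotF μ (Wop M₁ w u)) ∧
      eAnisoKSF T k (s + 1) lam (2 * δ - 1) (volPotF μ (Wop M₁ w u)) ≤
        ENNReal.ofReal C * eCD T k s lam δ u) ∧
    (∃ C : ℝ, 0 < C ∧ ∀ u : FormT n q, CMemD T k s lam δ u →
      CMemF T (k - 1) (s + 1) lam (2 * δ) (dT (volPotF μ (Wop M₁ w u))) ∧
      CMemF T (k - 1) (s + 1) lam (2 * δ) (coDT (volPotF μ (Wop M₁ w u))) ∧
      eAnisoKSF T (k - 1) (s + 1) lam (2 * δ) (dT (volPotF μ (Wop M₁ w u))) +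
          eAnisoKSF T (k - 1) (s + 1) lam (2 * δ) (coDT (volPotF μ (Wop M₁ w u))) ≤
        ENNReal.ofReal C * eCD T k s lam δ u) := by
  obtain ⟨k, rfl⟩ : ∃ k', k = k' + 1 := ⟨k - 1, by omega⟩
  rw [Nat.add_sub_cancel]
  obtain ⟨K₁, hK₁, b₁⟩ := volPotF_bop_parBd n q s k h1 h2 hδ hμ hT M₁ M₂ w hw.1
  obtain ⟨K₂, hK₂, b₂⟩ := volPotF_wop_parBd n q s (k + 1) h1 h2 hδ hμ hT M₁ w hw
  refine ⟨?_, ?_, ?_⟩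
  · obtain ⟨C, hC, c⟩ := ParBd.cMemF n q hT h1 k (s + 1) (2 * δ - 1) K₁ hK₁
    exact ⟨C, hC, fun u hu => c _ _ hu.2 (b₁ u hu)⟩
  · obtain ⟨C, hC, c⟩ := ParBd.cMemF n q hT h1 (k + 1) (s + 1) (2 * δ - 1) K₂ hK₂
    exact ⟨C, hC, fun u hu => c _ _ (b₂ u hu).1 (b₂ u hu).2⟩
  · obtain ⟨C, hC, c⟩ := ParBd.cMemF n (q + 1) hT h1 k (s + 1) (2 * δ) (n * K₂) (by positivity)
    obtain ⟨C', hC', c'⟩ := ParBd.cMemF n (q - 1) hT h1 k (s + 1) (2 * δ) (n * K₂) (by positivity)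
    refine ⟨C + C', add_pos hC hC', fun u hu => ?_⟩
    obtain ⟨hN, b⟩ := b₂ u hu
    have hA : 0 ≤ K₂ * (eCD T (k + 1) s lam δ u).toReal := mul_nonneg hK₂ ENNReal.toReal_nonneg
    have e : 2 * δ - 1 + 1 = 2 * δ := by ring
    have d₁ := c _ _ hN fun J => by
      have h := ParBd.dT hT.le h1 hA b J
      rwa [e, ← mul_assoc] at h
    have d₂ := c' _ _ hN fun J => by
      have h := ParBd.coDT hT.le h1 hA b J
      rwa [e, ← mul_assoc] at h
    refine ⟨d₁.1, d₂.1, ?_⟩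
    rw [ENNReal.ofReal_add hC.le hC'.le, add_mul]
    exact add_le_add d₁.2 d₂.2

end NSdeRham

end
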